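/- Let K = ℚ(i), the subfield of ℂ generated over ℚ by i. The only pairs (x, y) ∈ K × K satisfying y² = −x⁶ − 9x⁴ − 11x² + 37 are (x, y) = (±2i, ±1) and (x, y) = (±1, ±4) (all eight sign combinations). (Consequently X₀(37)(ℚ(i)) consists of these eight affine points together with the two cusps at infinity.) -/

import Mathlib

open Polynomial Module in
/-- The totally real cubic field generated by a root of `X ^ 3 - 4 * X + 2`, presented by a power
basis and its three real embeddings. -/
class TotallyRealCubic (L : Type) [Field L] [NumberField L] where
  u : L
  u_cube : u ^ 3 = 4 * u - 2
  basis : Basis (Fin 3) ℚ L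
  basis_apply : ∀ i, basis i = u ^ (i : ℕ)
  σ₁ : L →+* ℝ
  σ₂ : L →+* ℝ
  σ₃ : L →+* ℝ
  σ₁_gt : 53 / 100 < σ₁ u
  σ₁_lt : σ₁ u < 54 / 100
  σ₂_gt : 167 / 100 < σ₂ u
  σ₂_lt : σ₂ u < 168 / 100
  σ₃_gt : -222 / 100 < σ₃ u
  σ₃_lt : σ₃ u < -221 / 100

namespace TotallyRealCubic

open Polynomial Module NumberField

section Existence

theorem irreducible_cubic : Irreducible (X ^ 3 - C 4 * X + C 2 : ℚ[X]) := by
  have hd : (X ^ 3 - C 4 * X + C 2 : ℚ[X]).natDegree = 3 := by compute_degree!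
  have hm : (X ^ 3 - C 4 * X + C 2 : ℤ[X]).Monic := by monicity!
  have hdz : (X ^ 3 - C 4 * X + C 2 : ℤ[X]).natDegree = 3 := by compute_degree!
  have he : (X ^ 3 - C 4 * X + C 2 : ℤ[X]).IsEisensteinAt (Ideal.span {2}) := by
    refine ⟨?_, ?_, ?_⟩
    · rw [hm.leadingCoeff, Ideal.mem_span_singleton]; decide
    · intro n hn
      rw [hdz] at hn
      rw [Ideal.mem_span_singleton]
      interval_cases n <;> simp [coeff_X]
    · rw [Ideal.span_singleton_pow, Ideal.mem_span_singleton]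
      simp [coeff_X]
  have hi := he.irreducible ((Ideal.span_singleton_prime (by norm_num)).2 Int.prime_two)
    hm.isPrimitive (by omega)
  have := (hm.irreducible_iff_irreducible_map_fraction_map (K := ℚ)).1 hi
  have e : (X ^ 3 - C 4 * X + C 2 : ℤ[X]).map (algebraMap ℤ ℚ) = X ^ 3 - C 4 * X + C 2 := by
    simp only [Polynomial.map_add, Polynomial.map_sub, Polynomial.map_mul, Polynomial.map_pow,
      map_X, map_ofNat, Polynomial.map_ofNat]
  rwa [e] at this

theorem exists_root (a b : ℝ) (hab : a ≤ b)
    (h : (a ^ 3 - 4 * a + 2) * (b ^ 3 - 4 * b + 2) < 0) :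
    ∃ r, a < r ∧ r < b ∧ r ^ 3 - 4 * r + 2 = 0 := by
  have hc : ContinuousOn (fun x : ℝ => x ^ 3 - 4 * x + 2) (Set.Icc a b) := by fun_prop
  rcases mul_neg_iff.1 h with ⟨h1, h2⟩ | ⟨h1, h2⟩
  · obtain ⟨r, hr, hr'⟩ := intermediate_value_Ioo' hab hc ⟨h2, h1⟩
    exact ⟨r, hr.1, hr.2, hr'⟩
  · obtain ⟨r, hr, hr'⟩ := intermediate_value_Ioo hab hc ⟨h1, h2⟩
    exact ⟨r, hr.1, hr.2, hr'⟩

theorem exists_model : ∃ (L : Type) (_ : Field L) (_ : NumberField L),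
    Nonempty (TotallyRealCubic L) := by
  have : Fact (Irreducible (X ^ 3 - C 4 * X + C 2 : ℚ[X])) := ⟨irreducible_cubic⟩
  have hne : (X ^ 3 - C 4 * X + C 2 : ℚ[X]) ≠ 0 := irreducible_cubic.ne_zero
  have hd : (X ^ 3 - C 4 * X + C 2 : ℚ[X]).natDegree = 3 := by compute_degree!
  let pb := AdjoinRoot.powerBasis hne
  have hdim : pb.dim = 3 := by simpa [pb] using hd
  have : CharZero (AdjoinRoot (X ^ 3 - C 4 * X + C 2 : ℚ[X])) :=
    charZero_of_injective_algebraMap (FaithfulSMul.algebraMap_injective ℚ _)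
  have hfin : Module.Finite ℚ (AdjoinRoot (X ^ 3 - C 4 * X + C 2 : ℚ[X])) := pb.finite
  have hnf : NumberField (AdjoinRoot (X ^ 3 - C 4 * X + C 2 : ℚ[X])) :=
    { to_finiteDimensional := by convert hfin }
  obtain ⟨r₁, h1, h1', h1r⟩ := exists_root (53 / 100) (54 / 100) (by norm_num) (by norm_num)
  obtain ⟨r₂, h2, h2', h2r⟩ := exists_root (167 / 100) (168 / 100) (by norm_num) (by norm_num)
  obtain ⟨r₃, h3, h3', h3r⟩ := exists_root (-222 / 100) (-221 / 100) (by norm_num) (by norm_num)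
  have hev : ∀ r : ℝ, r ^ 3 - 4 * r + 2 = 0 →
      eval₂ (algebraMap ℚ ℝ) r (X ^ 3 - C 4 * X + C 2 : ℚ[X]) = 0 := by
    intro r hr
    simpa [eval₂_add, eval₂_sub, eval₂_mul] using hr
  refine ⟨_, inferInstance, hnf, ⟨{
    u := AdjoinRoot.root _
    u_cube := ?_
    basis := (pb.basis.reindex (finCongr hdim)).mapCoeffs (RingEquiv.refl ℚ) ?_
    basis_apply := ?_
    σ₁ := AdjoinRoot.lift (algebraMap ℚ ℝ) r₁ (hev _ h1r)
    σ₂ := AdjoinRoot.lift (algebraMap ℚ ℝ) r₂ (hev _ h2r)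
    σ₃ := AdjoinRoot.lift (algebraMap ℚ ℝ) r₃ (hev _ h3r)
    σ₁_gt := by simpa using h1
    σ₁_lt := by simpa using h1'
    σ₂_gt := by simpa using h2
    σ₂_lt := by simpa using h2'
    σ₃_gt := by simpa using h3
    σ₃_lt := by simpa using h3' }⟩⟩
  · have := AdjoinRoot.eval₂_root (X ^ 3 - C 4 * X + C 2 : ℚ[X])
    simp only [eval₂_add, eval₂_sub, eval₂_mul, eval₂_pow, eval₂_X, map_ofNat, eval₂_ofNat] at this
    linear_combination this
  · intro c x
    simp
  · intro i
    simp [pb]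

end Existence

end TotallyRealCubic

namespace TotallyRealCubic

open Polynomial Module NumberField

variable {L : Type} [Field L] [NumberField L] [TotallyRealCubic L]

theorem exists_coords (x : L) : ∃ a b c : ℚ, x = a + b * u + c * u ^ 2 := by
  refine ⟨basis.repr x 0, basis.repr x 1, basis.repr x 2, ?_⟩
  conv_lhs => rw [← (basis : Basis (Fin 3) ℚ L).sum_repr x]
  simp [Fin.sum_univ_three, basis_apply, Algebra.smul_def]

theorem leftMulMatrix_coords (a b c : ℚ) :
    Algebra.leftMulMatrix (basis : Basis (Fin 3) ℚ L) (a + b * u + c * u ^ 2 : L) =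
      !![a, -2 * c, -2 * b; b, a + 4 * c, 4 * b - 2 * c; c, b, a + 4 * c] := by
  ext i j
  rw [Algebra.leftMulMatrix_eq_repr_mul]
  have h : ∀ j, (a + b * u + c * u ^ 2 : L) * basis j =
      ∑ i, (!![a, -2 * c, -2 * b; b, a + 4 * c, 4 * b - 2 * c; c, b, a + 4 * c] :
        Matrix (Fin 3) (Fin 3) ℚ) i j • (basis i : L) := by
    intro j
    simp only [Fin.sum_univ_three, basis_apply, Algebra.smul_def, eq_ratCast]
    fin_cases j
    · simp
    · simp
      linear_combination (c : L) * u_cube (L := L)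
    · simp
      linear_combination ((c : L) * u + b) * u_cube (L := L)
  rw [h j, Basis.repr_sum_self]

theorem norm_coords (a b c : ℚ) :
    Algebra.norm ℚ (a + b * u + c * u ^ 2 : L) =
      a * ((a + 4 * c) ^ 2 - b * (4 * b - 2 * c)) - b * (-2 * c * (a + 4 * c) + 2 * b ^ 2)
        + c * (-2 * c * (4 * b - 2 * c) + 2 * b * (a + 4 * c)) := by
  rw [Algebra.norm_eq_matrix_det (basis : Basis (Fin 3) ℚ L), leftMulMatrix_coords,
    Matrix.det_fin_three]
  simp
  ring

theorem trace_coords (a b c : ℚ) :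
    Algebra.trace ℚ L (a + b * u + c * u ^ 2) = 3 * a + 8 * c := by
  rw [Algebra.trace_eq_matrix_trace (basis : Basis (Fin 3) ℚ L), leftMulMatrix_coords,
    Matrix.trace_fin_three]
  simp
  ring

theorem u_ne_zero : (u : L) ≠ 0 := by
  intro h
  have := u_cube (L := L)
  rw [h] at this
  norm_num at this

theorem isIntegral_u : IsIntegral ℤ (u : L) := by
  refine ⟨X ^ 3 - C 4 * X + C 2, by monicity!, ?_⟩
  simp only [eval₂_add, eval₂_sub, eval₂_mul, eval₂_pow, eval₂_X, eval₂_C]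
  simp [u_cube]

/-- The integer `a + b * u + c * u ^ 2`. -/
noncomputable def mkInt (a b c : ℤ) : 𝓞 L :=
  a + b * ⟨u, isIntegral_u⟩ + c * ⟨u, isIntegral_u⟩ ^ 2

@[simp]
theorem coe_mkInt (a b c : ℤ) : ((mkInt a b c : 𝓞 L) : L) = a + b * u + c * u ^ 2 := by
  simp only [mkInt, map_add, map_mul, map_intCast]
  rfl

theorem norm_mkInt (a b c : ℤ) : Algebra.norm ℤ (mkInt a b c : 𝓞 L) =
      a * ((a + 4 * c) ^ 2 - b * (4 * b - 2 * c)) - b * (-2 * c * (a + 4 * c) + 2 * b ^ 2)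
        + c * (-2 * c * (4 * b - 2 * c) + 2 * b * (a + 4 * c)) := by
  have h := Algebra.coe_norm_int (mkInt a b c : 𝓞 L)
  have h2 := norm_coords (L := L) a b c
  rw [coe_mkInt] at h
  push_cast at h2
  rw [h2] at h
  exact_mod_cast h

theorem prime_mkInt {a b c : ℤ} (h : (Algebra.norm ℤ (mkInt a b c : 𝓞 L)).natAbs.Prime) :
    Prime (mkInt a b c : 𝓞 L) := by
  have h0 : (mkInt a b c : 𝓞 L) ≠ 0 := by
    intro h'
    rw [h'] at h
    simp [Algebra.norm_zero] at h
    exact Nat.not_prime_zero h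
  rw [← Ideal.span_singleton_prime h0]
  apply Ideal.isPrime_of_irreducible_absNorm
  rw [Ideal.absNorm_span_singleton]
  exact h

theorem finrank_eq : finrank ℚ L = 3 := by
  simp [finrank_eq_card_basis (basis : Basis (Fin 3) ℚ L)]

theorem discr_basis : Algebra.discr ℚ (basis : Basis (Fin 3) ℚ L) = 148 := by
  have h (a b c : ℚ) (x : L) (hx : x = a + b * u + c * u ^ 2) :
      Algebra.trace ℚ L x = 3 * a + 8 * c := by
    rw [hx, trace_coords]
  have h0 := h 1 0 0 ((u : L) ^ 0 * u ^ 0) (by simp)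
  have h1 := h 0 1 0 ((u : L) ^ 0 * u ^ 1) (by simp)
  have h1' := h 0 1 0 ((u : L) ^ 1 * u ^ 0) (by simp)
  have h2 := h 0 0 1 ((u : L) ^ 0 * u ^ 2) (by simp)
  have h2' := h 0 0 1 ((u : L) ^ 1 * u ^ 1) (by simp; ring)
  have h2'' := h 0 0 1 ((u : L) ^ 2 * u ^ 0) (by simp)
  have h3 := h (-2) 4 0 ((u : L) ^ 1 * u ^ 2) (by simp; linear_combination u_cube (L := L))
  have h3' := h (-2) 4 0 ((u : L) ^ 2 * u ^ 1) (by simp; linear_combination u_cube (L := L))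
  have h4 := h 0 (-2) 4 ((u : L) ^ 2 * u ^ 2) (by simp; linear_combination u * u_cube (L := L))
  rw [Algebra.discr_def, Matrix.det_fin_three]
  simp only [Algebra.traceMatrix_apply, Algebra.traceForm_apply, basis_apply, Fin.val_zero,
    Fin.val_one, Fin.val_two, h0, h1, h1', h2, h2', h2'', h3, h3', h4]
  norm_num

theorem abs_discr_le : |discr L| ≤ 148 := by
  let b := (RingOfIntegers.basis L).reindex
    (Fintype.equivFinOfCardEq (n := 3) (by rw [← finrank_eq_card_basis (integralBasis L), finrank_eq]))
  have hb : Algebra.discr ℤ b = discr L := discr_eq_discr L b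
  let w : Fin 3 → 𝓞 L := fun i => ⟨u, isIntegral_u⟩ ^ (i : ℕ)
  have hw : Algebra.discr ℤ w = 148 := by
    have : ((Algebra.discr ℤ w : ℤ) : ℚ) = 148 := by
      rw [← discr_basis (L := L), ← eq_intCast (algebraMap ℤ ℚ), Algebra.discr_def,
        Algebra.discr_def, RingHom.map_det]
      congr 1
      ext i j
      simp only [RingHom.mapMatrix_apply, Matrix.map_apply, Algebra.traceMatrix_apply,
        Algebra.traceForm_apply]
      rw [← Algebra.trace_localization ℤ (nonZeroDivisors ℤ) (Rₘ := ℚ) (Sₘ := L)]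
      congr 1
      simp only [basis_apply, w]
      simp
      rfl
    exact_mod_cast this
  have h := Algebra.discr_of_matrix_vecMul b (b.toMatrix w)
  rw [b.toMatrix_map_vecMul, hw, hb] at h
  have h1 : discr L ∣ 148 := Dvd.intro_left _ h.symm
  exact Int.le_of_dvd (by norm_num) ((abs_dvd _ _).2 h1)

end TotallyRealCubic

namespace TotallyRealCubic

open Polynomial Module NumberField

variable {L : Type} [Field L] [NumberField L] [TotallyRealCubic L]

theorem minkowski_lt : (4 / Real.pi) ^ InfinitePlace.nrComplexPlaces L *
    ((finrank ℚ L).factorial / (finrank ℚ L : ℝ) ^ (finrank ℚ L) * √|discr L|) < 4 := by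
  have h1 : InfinitePlace.nrComplexPlaces L ≤ 1 := by
    have := InfinitePlace.card_add_two_mul_card_eq_rank L
    rw [finrank_eq] at this
    omega
  have h2 : (4 / Real.pi) ^ InfinitePlace.nrComplexPlaces L ≤ 4 / 3 := by
    have hpi := Real.pi_gt_three
    have : 4 / Real.pi ≤ 4 / 3 := by gcongr
    interval_cases InfinitePlace.nrComplexPlaces L
    · norm_num
    · simpa using this
  have h3 : √|(discr L : ℝ)| < 13 := by
    rw [Real.sqrt_lt' (by norm_num)]
    have := abs_discr_le (L := L)
    have h : ((|discr L| : ℤ) : ℝ) ≤ 148 := by exact_mod_cast this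
    push_cast at h
    linarith
  rw [finrank_eq]
  norm_num [Nat.factorial]
  have h4 : 0 ≤ √|(discr L : ℝ)| := Real.sqrt_nonneg _
  calc _ ≤ (4 / 3) * (2 / 9 * √|(discr L : ℝ)|) := by gcongr
    _ < 4 := by linarith

theorem uInt_cube : (mkInt 0 1 0 : 𝓞 L) ^ 3 = 4 * mkInt 0 1 0 - 2 := by
  apply RingOfIntegers.ext
  simp only [map_pow, map_sub, map_mul, coe_mkInt, map_ofNat]
  simp [u_cube]

theorem prime_uInt : Prime (mkInt 0 1 0 : 𝓞 L) := by
  apply prime_mkInt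
  rw [norm_mkInt]
  norm_num

instance : IsPrincipalIdealRing (𝓞 L) := by
  refine RingOfIntegers.isPrincipalIdealRing_of_isPrincipal_of_norm_le_of_isPrime
    fun I hI hN => ?_
  have hlt : Ideal.absNorm (I : Ideal (𝓞 L)) < 4 := by
    exact_mod_cast hN.trans_lt minkowski_lt
  have hpos : Ideal.absNorm (I : Ideal (𝓞 L)) ≠ 0 := by
    rw [Ne, Ideal.absNorm_eq_zero_iff]
    exact nonZeroDivisors.coe_ne_zero I
  have hone : Ideal.absNorm (I : Ideal (𝓞 L)) ≠ 1 := by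
    rw [Ne, Ideal.absNorm_eq_one_iff]
    exact hI.ne_top
  have hmem := Ideal.absNorm_mem (I : Ideal (𝓞 L))
  have hu := uInt_cube (L := L)
  obtain h | h : Ideal.absNorm (I : Ideal (𝓞 L)) = 2 ∨ Ideal.absNorm (I : Ideal (𝓞 L)) = 3 := by
    omega
  · rw [h] at hmem
    have huI : (mkInt 0 1 0 : 𝓞 L) ∈ (I : Ideal (𝓞 L)) := by
      refine hI.mem_of_pow_mem 3 ?_
      rw [hu]
      have : (4 * mkInt 0 1 0 - 2 : 𝓞 L) = (2 * mkInt 0 1 0 - 1) * ((2 : ℕ) : 𝓞 L) := by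
        push_cast; ring
      rw [this]
      exact Ideal.mul_mem_left _ _ hmem
    have hp := prime_uInt (L := L)
    have hmax : (Ideal.span {(mkInt 0 1 0 : 𝓞 L)}).IsMaximal :=
      ((Ideal.span_singleton_prime hp.ne_zero).2 hp).isMaximal (by simpa using hp.ne_zero)
    have := hmax.eq_of_le hI.ne_top ((Ideal.span_singleton_le_iff_mem _).2 huI)
    rw [← this]
    exact ⟨_, rfl⟩
  · exfalso
    rw [h] at hmem
    have : Fintype (𝓞 L ⧸ (I : Ideal (𝓞 L))) := 
      have := Ideal.finiteQuotientOfFreeOfNeBot _ (nonZeroDivisors.coe_ne_zero I)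
      Fintype.ofFinite _
    have hmax : (I : Ideal (𝓞 L)).IsMaximal := hI.isMaximal (nonZeroDivisors.coe_ne_zero I)
    let _ := Ideal.Quotient.field (I : Ideal (𝓞 L))
    have hc : Fintype.card (𝓞 L ⧸ (I : Ideal (𝓞 L))) = 3 := by
      rw [← h, Ideal.absNorm_apply, Submodule.cardQuot_apply, Nat.card_eq_fintype_card]
    have hpow := FiniteField.pow_card (Ideal.Quotient.mk (I : Ideal (𝓞 L)) (mkInt 0 1 0))
    rw [hc] at hpow
    have hu' := congrArg (Ideal.Quotient.mk (I : Ideal (𝓞 L))) hu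
    rw [map_pow, hpow] at hu'
    have h3 := (Ideal.Quotient.eq_zero_iff_mem).2 hmem
    simp only [map_sub, map_mul, map_ofNat, Nat.cast_ofNat] at hu' h3
    have h1 : (1 : 𝓞 L ⧸ (I : Ideal (𝓞 L))) = 0 := by
      linear_combination h3 - hu' - (Ideal.Quotient.mk (I : Ideal (𝓞 L)) (mkInt 0 1 0)) * h3
    exact one_ne_zero h1

end TotallyRealCubic

namespace TotallyRealCubic

open Polynomial Module NumberField

variable {L : Type} [Field L] [NumberField L] [TotallyRealCubic L]

theorem rank_units_le : Units.rank L ≤ 2 := by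
  have h1 := InfinitePlace.card_add_two_mul_card_eq_rank L
  have h2 := InfinitePlace.card_eq_nrRealPlaces_add_nrComplexPlaces L
  rw [finrank_eq] at h1
  rw [Units.rank]
  omega

/-- The signs of an element under the three real embeddings. -/
noncomputable def signs (x : L) : Bool × Bool × Bool :=
  (decide (0 < σ₁ x), decide (0 < σ₂ x), decide (0 < σ₃ x))

theorem signs_mul_sq {x w : L} (hw : w ≠ 0) : signs (x * w ^ 2) = signs x := by
  have h (σ : L →+* ℝ) : 0 < σ (x * w ^ 2) ↔ 0 < σ x := by
    rw [map_mul, map_pow]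
    exact mul_pos_iff_of_pos_right (by have := (map_ne_zero σ).2 hw; positivity)
  simp only [signs, h]

def eps₁ : L := u - 1
def eps₂ : L := 2 * u - 1

theorem eps₁_mul : (eps₁ : L) * (u ^ 2 + u - 3) = 1 := by
  unfold eps₁; linear_combination u_cube (L := L)

theorem eps₂_mul : (eps₂ : L) * (15 - 2 * u - 4 * u ^ 2) = 1 := by
  unfold eps₂; linear_combination -8 * u_cube (L := L)

noncomputable def epsUnit₁ : (𝓞 L)ˣ :=
  Units.mkOfMulEqOne (mkInt (-1) 1 0) (mkInt (-3) 1 1) (by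
    apply RingOfIntegers.ext
    simp only [map_mul, coe_mkInt, map_one]
    push_cast
    linear_combination eps₁_mul (L := L) +
      (by unfold eps₁; ring :
        (-1 + 1 * u + 0 * u ^ 2 : L) * (-3 + 1 * u + 1 * u ^ 2) = eps₁ * (u ^ 2 + u - 3)))

noncomputable def epsUnit₂ : (𝓞 L)ˣ :=
  Units.mkOfMulEqOne (mkInt (-1) 2 0) (mkInt 15 (-2) (-4)) (by
    apply RingOfIntegers.ext
    simp only [map_mul, coe_mkInt, map_one]
    push_cast
    linear_combination eps₂_mul (L := L) +
      (by unfold eps₂; ring :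
        (-1 + 2 * u + 0 * u ^ 2 : L) * (15 + -2 * u + -4 * u ^ 2) = eps₂ * (15 - 2 * u - 4 * u ^ 2)))

theorem coe_epsUnit₁ : (((epsUnit₁ : (𝓞 L)ˣ) : 𝓞 L) : L) = eps₁ := by
  rw [epsUnit₁, Units.val_mkOfMulEqOne, coe_mkInt, eps₁]
  push_cast; ring

theorem coe_epsUnit₂ : (((epsUnit₂ : (𝓞 L)ˣ) : 𝓞 L) : L) = eps₂ := by
  rw [epsUnit₂, Units.val_mkOfMulEqOne, coe_mkInt, eps₂]
  push_cast; ring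

theorem signs_surjective (s : Bool × Bool × Bool) :
    ∃ e : (𝓞 L)ˣ, signs ((e : 𝓞 L) : L) = s := by
  have a1 := σ₁_gt (L := L)
  have a2 := σ₁_lt (L := L)
  have b1 := σ₂_gt (L := L)
  have b2 := σ₂_lt (L := L)
  have c1 := σ₃_gt (L := L)
  have c2 := σ₃_lt (L := L)
  have p1 : σ₁ (eps₁ : L) < 0 := by simp only [eps₁, map_sub, map_one]; linarith
  have p2 : 0 < σ₂ (eps₁ : L) := by simp only [eps₁, map_sub, map_one]; linarith
  have p3 : σ₃ (eps₁ : L) < 0 := by simp only [eps₁, map_sub, map_one]; linarith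
  have q1 : 0 < σ₁ (eps₂ : L) := by
    simp only [eps₂, map_sub, map_one, map_mul, map_ofNat]; linarith
  have q2 : 0 < σ₂ (eps₂ : L) := by
    simp only [eps₂, map_sub, map_one, map_mul, map_ofNat]; linarith
  have q3 : σ₃ (eps₂ : L) < 0 := by
    simp only [eps₂, map_sub, map_one, map_mul, map_ofNat]; linarith
  have r1 := mul_neg_of_neg_of_pos p1 q1
  have r2 := mul_pos p2 q2
  have r3 := mul_pos_of_neg_of_neg p3 q3
  obtain ⟨s1, s2, s3⟩ := s
  cases s1 <;> cases s2 <;> cases s3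
  · exact ⟨-1, by simp [signs]⟩
  · exact ⟨-epsUnit₂, by simp [signs, coe_epsUnit₂, q1.le, q2.le, q3]⟩
  · exact ⟨epsUnit₁, by simp [signs, coe_epsUnit₁, p1.le, p2, p3.le]⟩
  · exact ⟨epsUnit₁ * epsUnit₂, by
      simp [signs, coe_epsUnit₁, coe_epsUnit₂, r1.le, r2, r3]⟩
  · exact ⟨-(epsUnit₁ * epsUnit₂), by
      simp [signs, coe_epsUnit₁, coe_epsUnit₂, r1, r2.le, r3.le]⟩
  · exact ⟨-epsUnit₁, by simp [signs, coe_epsUnit₁, p1, p2.le, p3]⟩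
  · exact ⟨epsUnit₂, by simp [signs, coe_epsUnit₂, q1, q2, q3.le]⟩
  · exact ⟨1, by simp [signs]⟩

omit [NumberField L] [TotallyRealCubic L] in
theorem unit_coe_ne_zero (w : (𝓞 L)ˣ) : ((w : 𝓞 L) : L) ≠ 0 := by
  simp

/-- The representative of a unit modulo squares attached to exponents modulo `2`. -/
noncomputable def unitRep (s : Bool × (Fin (Units.rank L) → Bool)) : (𝓞 L)ˣ :=
  (if s.1 then -1 else 1) * ∏ i, if s.2 i then Units.fundSystem L i else 1

theorem exists_eq_unitRep (x : (𝓞 L)ˣ) : ∃ s, ∃ w : (𝓞 L)ˣ, x = unitRep s * w ^ 2 := by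
  obtain ⟨⟨ζ, e⟩, h, -⟩ := Units.exist_unique_eq_mul_prod L x
  have hodd : Odd (finrank ℚ L) := by rw [finrank_eq]; decide
  have hζ := Units.torsion_eq_one_or_neg_one_of_odd_finrank hodd ζ
  obtain ⟨b, hb⟩ : ∃ b : Bool, (ζ : (𝓞 L)ˣ) = if b then -1 else 1 := by
    rcases hζ with h | h
    · exact ⟨false, by simp [h]⟩
    · exact ⟨true, by simp [h]⟩
  refine ⟨(b, fun i => decide (e i % 2 = 1)), ∏ i, Units.fundSystem L i ^ (e i / 2), ?_⟩
  rw [h, unitRep, ← hb, mul_assoc, ← Finset.prod_pow, ← Finset.prod_mul_distrib]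
  congr 1
  refine Finset.prod_congr rfl fun i _ => ?_
  rw [← zpow_natCast, ← zpow_mul]
  rcases Int.emod_two_eq_zero_or_one (e i) with h | h
  · have : e i = e i / 2 * (2 : ℕ) := by push_cast; omega
    simp only [h, zero_ne_one, decide_false, Bool.false_eq_true, if_false, one_mul]
    rw [← this]
  · have : e i = 1 + e i / 2 * (2 : ℕ) := by push_cast; omega
    simp only [h, decide_true, if_true]
    conv_lhs => rw [this, zpow_add, zpow_one]

/-- A totally positive unit is a square. -/
theorem unit_eq_sq {x : (𝓞 L)ˣ} (hx : signs ((x : 𝓞 L) : L) = (true, true, true)) :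
    ∃ w : (𝓞 L)ˣ, x = w ^ 2 := by
  have hs (y w : (𝓞 L)ˣ) : signs (((y * w ^ 2 : (𝓞 L)ˣ) : 𝓞 L) : L) = signs ((y : 𝓞 L) : L) := by
    simp only [Units.val_mul, Units.val_pow_eq_pow_val, map_mul, map_pow]
    exact signs_mul_sq (unit_coe_ne_zero w)
  let F : Bool × (Fin (Units.rank L) → Bool) → Bool × Bool × Bool :=
    fun s => signs ((unitRep s : 𝓞 L) : L)
  have hsurj : Function.Surjective F := by
    intro t
    obtain ⟨e, he⟩ := signs_surjective (L := L) t
    obtain ⟨s, w, rfl⟩ := exists_eq_unitRep e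
    exact ⟨s, by rw [← he, hs]⟩
  have hcard : Fintype.card (Bool × (Fin (Units.rank L) → Bool)) ≤
      Fintype.card (Bool × Bool × Bool) := by
    simp only [Fintype.card_prod, Fintype.card_bool, Fintype.card_fun, Fintype.card_fin]
    have := Nat.pow_le_pow_right (n := 2) (by norm_num) (rank_units_le (L := L))
    omega
  have hinj : Function.Injective F := by
    have := (Function.Surjective.bijective_of_nat_card_le hsurj (by simpa [Nat.card_eq_fintype_card] using hcard))
    exact this.1
  obtain ⟨s, w, rfl⟩ := exists_eq_unitRep x
  have h0 : F s = F (false, fun _ => false) := by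
    simp only [F]
    rw [← hs (unitRep s) w, hx]
    simp [unitRep, signs]
  refine ⟨w, ?_⟩
  rw [hinj h0]
  simp [unitRep]

end TotallyRealCubic

namespace TotallyRealCubic

open Polynomial Module NumberField IsDedekindDomain

section Ord

variable {L : Type} [Field L] [NumberField L] {v : HeightOneSpectrum (𝓞 L)} {k m : ℤ} {x y z : L}

/-- The order of `z` at `v` is at least `k`. -/
def OrdGE (v : HeightOneSpectrum (𝓞 L)) (k : ℤ) (z : L) : Prop :=
  v.valuation L z ≤ WithZero.exp (-k)

/-- The order of `z` at `v` equals `k`. -/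
def OrdEq (v : HeightOneSpectrum (𝓞 L)) (k : ℤ) (z : L) : Prop :=
  v.valuation L z = WithZero.exp (-k)

theorem OrdEq.ge (h : OrdEq v k z) : OrdGE v k z := le_of_eq h

theorem OrdGE.mono (h : OrdGE v k z) (hm : m ≤ k) : OrdGE v m z :=
  le_trans h (WithZero.exp_le_exp.2 (by omega))

theorem OrdEq.ge_of_le (h : OrdEq v k z) (hm : m ≤ k) : OrdGE v m z := h.ge.mono hm

theorem OrdGE.add (hx : OrdGE v k x) (hy : OrdGE v k y) : OrdGE v k (x + y) :=
  (Valuation.map_add_le _ hx hy)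

theorem OrdGE.neg (hx : OrdGE v k x) : OrdGE v k (-x) := by
  unfold OrdGE; rwa [Valuation.map_neg]

theorem OrdEq.neg (hx : OrdEq v k x) : OrdEq v k (-x) := by
  unfold OrdEq; rwa [Valuation.map_neg]

theorem OrdGE.sub (hx : OrdGE v k x) (hy : OrdGE v k y) : OrdGE v k (x - y) := by
  rw [sub_eq_add_neg]; exact hx.add hy.neg

theorem OrdGE.mul (hx : OrdGE v k x) (hy : OrdGE v m y) : OrdGE v (k + m) (x * y) := by
  unfold OrdGE
  rw [map_mul, neg_add, WithZero.exp_add]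
  exact mul_le_mul' hx hy

theorem OrdEq.mul (hx : OrdEq v k x) (hy : OrdEq v m y) : OrdEq v (k + m) (x * y) := by
  unfold OrdEq
  rw [map_mul, neg_add, WithZero.exp_add, hx, hy]

theorem OrdEq.pow (hx : OrdEq v k x) (n : ℕ) : OrdEq v (n * k) (x ^ n) := by
  unfold OrdEq
  rw [map_pow, hx, ← WithZero.exp_nsmul]
  congr 1
  simp

theorem OrdEq.inv (hx : OrdEq v k x) : OrdEq v (-k) x⁻¹ := by
  unfold OrdEq
  rw [map_inv₀, hx, ← WithZero.exp_neg]

theorem OrdEq.div (hx : OrdEq v k x) (hy : OrdEq v m y) : OrdEq v (k - m) (x / y) := by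
  rw [div_eq_mul_inv, sub_eq_add_neg]; exact hx.mul hy.inv

theorem OrdGE.div (hx : OrdGE v k x) (hy : OrdEq v m y) : OrdGE v (k - m) (x / y) := by
  rw [div_eq_mul_inv, sub_eq_add_neg]; exact hx.mul hy.inv.ge

theorem OrdGE.pow (hx : OrdGE v k x) (n : ℕ) : OrdGE v (n * k) (x ^ n) := by
  unfold OrdGE
  rw [map_pow]
  refine (pow_le_pow_left' hx n).trans_eq ?_
  rw [← WithZero.exp_nsmul]
  congr 1
  simp

theorem OrdEq.ne_zero (hx : OrdEq v k x) : x ≠ 0 := by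
  rintro rfl
  simp [OrdEq] at hx
  exact WithZero.exp_ne_zero hx.symm

theorem exists_ordEq (v : HeightOneSpectrum (𝓞 L)) (hx : x ≠ 0) : ∃ k, OrdEq v k x := by
  have h : v.valuation L x ≠ 0 := (Valuation.ne_zero_iff _).2 hx
  refine ⟨-WithZero.log (v.valuation L x), ?_⟩
  rw [OrdEq, neg_neg, WithZero.exp_log h]

theorem OrdGE.exists_ordEq (h : OrdGE v k x) (hx : x ≠ 0) : ∃ m, k ≤ m ∧ OrdEq v m x := by
  obtain ⟨m, hm⟩ := TotallyRealCubic.exists_ordEq v hx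
  refine ⟨m, ?_, hm⟩
  have := h
  rw [OrdGE, hm, WithZero.exp_le_exp] at this
  omega

theorem OrdEq.le_of_ge (h : OrdEq v k x) (h' : OrdGE v m x) : m ≤ k := by
  rw [OrdGE, h, WithZero.exp_le_exp] at h'
  omega

theorem OrdEq.unique (h : OrdEq v k x) (h' : OrdEq v m x) : k = m :=
  le_antisymm (h'.le_of_ge h.ge) (h.le_of_ge h'.ge)

theorem OrdEq.add_ge (hx : OrdEq v k x) (hy : OrdGE v m y) (h : k < m) : OrdEq v k (x + y) := by
  unfold OrdEq
  rw [Valuation.map_add_eq_of_lt_left, hx]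
  rw [hx]
  exact lt_of_le_of_lt hy (WithZero.exp_lt_exp.2 (by omega))

theorem OrdEq.ge_add (hy : OrdEq v k y) (hx : OrdGE v m x) (h : k < m) : OrdEq v k (x + y) := by
  rw [add_comm]; exact hy.add_ge hx h

theorem OrdEq.sub_ge (hx : OrdEq v k x) (hy : OrdGE v m y) (h : k < m) : OrdEq v k (x - y) := by
  rw [sub_eq_add_neg]; exact hx.add_ge hy.neg h

theorem OrdGE.zero : OrdGE v k (0 : L) := by
  simp [OrdGE]

theorem OrdGE.one : OrdGE v 0 (1 : L) := by
  simp [OrdGE]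

theorem OrdEq.one : OrdEq v 0 (1 : L) := by
  simp [OrdEq]

theorem ordGE_algebraMap (a : 𝓞 L) : OrdGE v 0 (a : L) := by
  simpa [OrdGE] using v.valuation_le_one a

theorem ordGE_intCast (a : ℤ) : OrdGE v 0 (a : L) := by
  simpa using ordGE_algebraMap (v := v) (a : 𝓞 L)

theorem ordGE_natCast (a : ℕ) : OrdGE v 0 (a : L) := by
  simpa using ordGE_algebraMap (v := v) (a : 𝓞 L)

theorem ordGE_ofNat (a : ℕ) [a.AtLeastTwo] : OrdGE v 0 (OfNat.ofNat a : L) :=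
  ordGE_natCast a

theorem ordEq_unit (a : (𝓞 L)ˣ) : OrdEq v 0 ((a : 𝓞 L) : L) := by
  simp only [OrdEq, neg_zero, WithZero.exp_zero]
  rw [HeightOneSpectrum.valuation_eq_one_iff_notMem]
  exact fun h => v.isPrime.ne_top (Ideal.eq_top_of_isUnit_mem _ h a.isUnit)

theorem OrdEq.not_ge (h : OrdEq v k x) (hm : k < m) : ¬ OrdGE v m x := fun h' => by
  have := h.le_of_ge h'
  omega

theorem OrdGE.eq_of_not (h : OrdGE v k x) (h' : ¬ OrdGE v (k + 1) x) : OrdEq v k x := by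
  have hx : x ≠ 0 := by rintro rfl; exact h' OrdGE.zero
  obtain ⟨m, hm, hm'⟩ := h.exists_ordEq hx
  have : ¬ (k + 1 ≤ m) := fun hh => h' (hm'.ge_of_le hh)
  rwa [show k = m by omega]

/-- The height one prime generated by a prime element. -/
noncomputable def ofPrime {p : 𝓞 L} (hp : Prime p) : HeightOneSpectrum (𝓞 L) :=
  ⟨Ideal.span {p}, (Ideal.span_singleton_prime hp.ne_zero).2 hp, by simpa using hp.ne_zero⟩

theorem ordEq_ofPrime {p : 𝓞 L} (hp : Prime p) : OrdEq (ofPrime hp) 1 (p : L) := by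
  unfold OrdEq
  rw [HeightOneSpectrum.valuation_of_algebraMap]
  exact HeightOneSpectrum.intValuation_singleton _ hp.ne_zero rfl

theorem ordEq_zero_of_ne {p : 𝓞 L} (hp : Prime p) (h : v ≠ ofPrime hp) : OrdEq v 0 (p : L) := by
  simp only [OrdEq, neg_zero, WithZero.exp_zero]
  rw [HeightOneSpectrum.valuation_eq_one_iff_notMem]
  intro hm
  apply h
  ext1
  have hmax : (ofPrime hp).asIdeal.IsMaximal := (ofPrime hp).isMaximal
  exact (hmax.eq_of_le v.isPrime.ne_top ((Ideal.span_singleton_le_iff_mem _).2 hm)).symm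

/-- In an equation `z * (z ^ 2 + A * z + B) = y ^ 2` the order of `z` is even wherever `B` is a
unit. -/
theorem OrdEq.even_of_cubic {A B : L} (hz : OrdEq v k z) (hA : OrdGE v 0 A) (hB : OrdEq v 0 B)
    (h : z * (z ^ 2 + A * z + B) = y ^ 2) : Even k := by
  rcases lt_trichotomy k 0 with hk | rfl | hk
  · have h1 : OrdEq v (2 * k) (z ^ 2 + A * z + B) := by
      have h2 := (hz.pow 2).add_ge (m := k) ((hA.mul hz.ge).mono (by omega)) (by push_cast; omega)
      exact h2.add_ge hB.ge (by push_cast; omega)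
    have h3 := hz.mul h1
    rw [h] at h3
    have hy : y ≠ 0 := by rintro rfl; exact h3.ne_zero (by simp)
    obtain ⟨n, hn⟩ := exists_ordEq v hy
    have := h3.unique (hn.pow 2)
    push_cast at this
    exact ⟨n - k, by omega⟩
  · exact ⟨0, rfl⟩
  · have h1 : OrdEq v 0 (z ^ 2 + A * z + B) :=
      hB.ge_add (m := k) (((hz.pow 2).ge_of_le (by push_cast; omega)).add
        ((hA.mul hz.ge).mono (by omega))) hk
    have h3 := hz.mul h1
    rw [h] at h3
    have hy : y ≠ 0 := by rintro rfl; exact h3.ne_zero (by simp)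
    obtain ⟨n, hn⟩ := exists_ordEq v hy
    have := h3.unique (hn.pow 2)
    push_cast at this
    exact ⟨n, by omega⟩

end Ord

end TotallyRealCubic

namespace TotallyRealCubic

open Polynomial Module NumberField IsDedekindDomain

variable {L : Type} [Field L] [NumberField L] [TotallyRealCubic L]

/-- The ramified prime element of norm `-37`. -/
def rho : L := 4 * u ^ 2 + 2 * u - 13

/-- The unramified prime element of norm `-37`. -/
def theta : L := 2 * u + 3

theorem prime_rhoInt : Prime (mkInt (-13) 2 4 : 𝓞 L) := by
  apply prime_mkInt
  rw [norm_mkInt]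
  norm_num

theorem prime_thetaInt : Prime (mkInt 3 2 0 : 𝓞 L) := by
  apply prime_mkInt
  rw [norm_mkInt]
  norm_num

theorem coe_uInt : ((mkInt 0 1 0 : 𝓞 L) : L) = u := by
  rw [coe_mkInt]; push_cast; ring

theorem coe_rhoInt : ((mkInt (-13) 2 4 : 𝓞 L) : L) = rho := by
  rw [coe_mkInt, rho]; push_cast; ring

theorem coe_thetaInt : ((mkInt 3 2 0 : 𝓞 L) : L) = theta := by
  rw [coe_mkInt, theta]; push_cast; ring

variable (L) in
noncomputable def vu : HeightOneSpectrum (𝓞 L) := ofPrime prime_uInt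
variable (L) in
noncomputable def vrho : HeightOneSpectrum (𝓞 L) := ofPrime prime_rhoInt
variable (L) in
noncomputable def vtheta : HeightOneSpectrum (𝓞 L) := ofPrime prime_thetaInt

theorem ordEq_vu_u : OrdEq (vu L) 1 (u : L) := by
  rw [← coe_uInt]; exact ordEq_ofPrime _

theorem ordEq_vrho_rho : OrdEq (vrho L) 1 (rho : L) := by
  rw [← coe_rhoInt]; exact ordEq_ofPrime _

theorem ordEq_vtheta_theta : OrdEq (vtheta L) 1 (theta : L) := by
  rw [← coe_thetaInt]; exact ordEq_ofPrime _

theorem ordEq_u {v : HeightOneSpectrum (𝓞 L)} (h : v ≠ vu L) : OrdEq v 0 (u : L) := by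
  rw [← coe_uInt]; exact ordEq_zero_of_ne _ h

theorem ordEq_rho {v : HeightOneSpectrum (𝓞 L)} (h : v ≠ vrho L) : OrdEq v 0 (rho : L) := by
  rw [← coe_rhoInt]; exact ordEq_zero_of_ne _ h

theorem ordEq_theta {v : HeightOneSpectrum (𝓞 L)} (h : v ≠ vtheta L) :
    OrdEq v 0 (theta : L) := by
  rw [← coe_thetaInt]; exact ordEq_zero_of_ne _ h

theorem ordEq_eps₁ {v : HeightOneSpectrum (𝓞 L)} : OrdEq v 0 (eps₁ : L) := by
  rw [← coe_epsUnit₁]; exact ordEq_unit _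

theorem ordEq_eps₂ {v : HeightOneSpectrum (𝓞 L)} : OrdEq v 0 (eps₂ : L) := by
  rw [← coe_epsUnit₂]; exact ordEq_unit _

theorem norm_u : Algebra.norm ℚ (u : L) = -2 := by
  have := norm_coords (L := L) 0 1 0
  norm_num at this
  exact this

theorem norm_eps₁ : Algebra.norm ℚ (eps₁ : L) = 1 := by
  rw [show (eps₁ : L) = ((-1 : ℚ) : L) + ((1 : ℚ) : L) * u + ((0 : ℚ) : L) * u ^ 2 by
    rw [eps₁]; push_cast; ring, norm_coords]
  norm_num

theorem norm_eps₂ : Algebra.norm ℚ (eps₂ : L) = -1 := by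
  rw [show (eps₂ : L) = ((-1 : ℚ) : L) + ((2 : ℚ) : L) * u + ((0 : ℚ) : L) * u ^ 2 by
    rw [eps₂]; push_cast; ring, norm_coords]
  norm_num

theorem norm_rho : Algebra.norm ℚ (rho : L) = -37 := by
  rw [show (rho : L) = ((-13 : ℚ) : L) + ((2 : ℚ) : L) * u + ((4 : ℚ) : L) * u ^ 2 by
    rw [rho]; push_cast; ring, norm_coords]
  norm_num

theorem norm_theta : Algebra.norm ℚ (theta : L) = -37 := by
  rw [show (theta : L) = ((3 : ℚ) : L) + ((2 : ℚ) : L) * u + ((0 : ℚ) : L) * u ^ 2 by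
    rw [theta]; push_cast; ring, norm_coords]
  norm_num

theorem exists_unit_eq_mul_sq {e c : (𝓞 L)ˣ}
    (h : signs ((e : 𝓞 L) : L) = signs ((c : 𝓞 L) : L)) : ∃ w : (𝓞 L)ˣ, e = c * w ^ 2 := by
  have hpos : signs (((e * c : (𝓞 L)ˣ) : 𝓞 L) : L) = (true, true, true) := by
    simp only [signs, Prod.mk.injEq, decide_eq_decide] at h
    obtain ⟨h1, h2, h3⟩ := h
    have key (σ : L →+* ℝ) (h : 0 < σ ((e : 𝓞 L) : L) ↔ 0 < σ ((c : 𝓞 L) : L)) :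
        0 < σ (((e * c : (𝓞 L)ˣ) : 𝓞 L) : L) := by
      simp only [Units.val_mul, map_mul]
      have he : σ ((e : 𝓞 L) : L) ≠ 0 := (map_ne_zero σ).2 (unit_coe_ne_zero e)
      have hc : σ ((c : 𝓞 L) : L) ≠ 0 := (map_ne_zero σ).2 (unit_coe_ne_zero c)
      rcases lt_or_gt_of_ne he with h' | h'
      · have : σ ((c : 𝓞 L) : L) < 0 := by
          refine lt_of_le_of_ne (not_lt.1 fun h'' => ?_) hc
          exact absurd (h.2 h'') (not_lt.2 h'.le)
        exact mul_pos_of_neg_of_neg h' this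
      · exact mul_pos h' (h.1 h')
    simp only [signs, key σ₁ h1, key σ₂ h2, key σ₃ h3, decide_true]
  obtain ⟨w, hw⟩ := unit_eq_sq hpos
  refine ⟨w * c⁻¹, ?_⟩
  rw [mul_pow, ← hw, sq, mul_assoc e, mul_inv_cancel_left, mul_comm e, mul_inv_cancel_left]

omit [TotallyRealCubic L] in
theorem dvd_of_ordGE {p m : 𝓞 L} (hp : Prime p) (h : OrdGE (ofPrime hp) 1 (m : L)) : p ∣ m := by
  have : (ofPrime hp).valuation L (m : L) < 1 := by
    refine lt_of_le_of_lt h ?_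
    rw [← WithZero.exp_zero]
    exact WithZero.exp_lt_exp.2 (by norm_num)
  rw [HeightOneSpectrum.valuation_lt_one_iff_mem] at this
  exact Ideal.mem_span_singleton.1 this

/-- A nonzero integer whose order is even away from three given primes. -/
theorem exists_int_class (m : 𝓞 L) (hm : m ≠ 0)
    (hev : ∀ v, v ≠ vu L → v ≠ vrho L → v ≠ vtheta L → ∀ n, OrdEq v n (m : L) → Even n) :
    ∃ (e : (𝓞 L)ˣ) (i j k : ℕ) (w : 𝓞 L), m = (e : 𝓞 L) * (mkInt 0 1 0 : 𝓞 L) ^ i *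
      (mkInt (-13) 2 4 : 𝓞 L) ^ j * (mkInt 3 2 0 : 𝓞 L) ^ k * w ^ 2 := by
  revert hm hev
  induction m using IsWellFounded.induction (DvdNotUnit (α := 𝓞 L)) with
  | _ m ih =>
  intro hm hev
  by_cases hu : IsUnit m
  · obtain ⟨e, rfl⟩ := hu
    exact ⟨e, 0, 0, 0, 1, by simp⟩
  obtain ⟨p, hp, m', rfl⟩ := WfDvdMonoid.exists_irreducible_factor hu hm
  have hpu := hp.not_isUnit
  replace hp : Prime p := hp.prime
  have hm' : m' ≠ 0 := right_ne_zero_of_mul hm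
  have hlt : DvdNotUnit m' (p * m') := ⟨hm', p, hpu, mul_comm _ _⟩
  have key : ∀ v, v ≠ ofPrime hp → ∀ n, OrdEq v n (m' : L) →
      OrdEq v n ((p * m' : 𝓞 L) : L) := by
    intro v h n hn
    have := (ordEq_zero_of_ne hp h).mul hn
    rwa [zero_add, ← map_mul] at this
  have bad : ∀ q : 𝓞 L, ∀ hq : Prime q, ofPrime hp = ofPrime hq →
      ∃ e : (𝓞 L)ˣ, p = q * (e : 𝓞 L) := by
    intro q hq h
    have : Ideal.span {p} = Ideal.span {q} := congrArg HeightOneSpectrum.asIdeal h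
    obtain ⟨e, he⟩ := (Ideal.span_singleton_eq_span_singleton.1 this).symm
    exact ⟨e, he.symm⟩
  by_cases h1 : ofPrime hp = vu L
  · obtain ⟨e, he⟩ := bad _ _ h1
    obtain ⟨e', i, j, k, w, h⟩ := ih m' hlt hm' fun v h2 h3 h4 n hn =>
      hev v h2 h3 h4 n (key v (h1 ▸ h2) n hn)
    exact ⟨e * e', i + 1, j, k, w, by rw [h, he]; push_cast; ring⟩
  by_cases h2 : ofPrime hp = vrho L
  · obtain ⟨e, he⟩ := bad _ _ h2
    obtain ⟨e', i, j, k, w, h⟩ := ih m' hlt hm' fun v h1 h3 h4 n hn =>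
      hev v h1 h3 h4 n (key v (h2 ▸ h3) n hn)
    exact ⟨e * e', i, j + 1, k, w, by rw [h, he]; push_cast; ring⟩
  by_cases h3 : ofPrime hp = vtheta L
  · obtain ⟨e, he⟩ := bad _ _ h3
    obtain ⟨e', i, j, k, w, h⟩ := ih m' hlt hm' fun v h1 h2 h4 n hn =>
      hev v h1 h2 h4 n (key v (h3 ▸ h4) n hn)
    exact ⟨e * e', i, j, k + 1, w, by rw [h, he]; push_cast; ring⟩
  have hmL : (m' : L) ≠ 0 := by simpa using hm'
  obtain ⟨n, hn0, hn⟩ := (ordGE_algebraMap (v := ofPrime hp) m').exists_ordEq hmL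
  have hpm : OrdEq (ofPrime hp) (1 + n) ((p * m' : 𝓞 L) : L) := by
    simp only [map_mul]; exact (ordEq_ofPrime hp).mul hn
  have heven := hev _ h1 h2 h3 _ hpm
  have hn1 : 1 ≤ n := by
    by_contra h
    obtain rfl : n = 0 := by omega
    exact absurd heven (by decide)
  obtain ⟨m'', rfl⟩ := dvd_of_ordGE hp (hn.ge_of_le hn1)
  have hm'' : m'' ≠ 0 := right_ne_zero_of_mul hm'
  have hlt' : DvdNotUnit m'' (p * (p * m'')) :=
    ⟨hm'', p * p, fun h => hpu (isUnit_of_mul_isUnit_left h), by ring⟩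
  obtain ⟨e', i, j, k, w, h⟩ := ih m'' hlt' hm'' fun v h1 h2 h3 n hn => by
    by_cases hv : v = ofPrime hp
    · subst hv
      have hh : OrdEq (ofPrime hp) (1 + (1 + n)) ((p * (p * m'') : 𝓞 L) : L) := by
        simp only [map_mul]; exact (ordEq_ofPrime hp).mul ((ordEq_ofPrime hp).mul hn)
      have := hev _ h1 h2 h3 _ hh
      rw [Int.even_iff] at *
      omega
    · refine hev v h1 h2 h3 n (key v hv n ?_)
      have := (ordEq_zero_of_ne hp hv).mul hn
      rwa [zero_add, ← map_mul] at this
  exact ⟨e', i, j, k, p * w, by rw [h]; ring⟩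

/-- The number `± eps₁ ^ b * eps₂ ^ c * u ^ i * rho ^ j * theta ^ k`. -/
noncomputable def rep (a b c i j k : ℕ) : L :=
  (-1) ^ a * eps₁ ^ b * eps₂ ^ c * u ^ i * rho ^ j * theta ^ k

theorem rho_ne_zero : (rho : L) ≠ 0 := ordEq_vrho_rho.ne_zero

theorem theta_ne_zero : (theta : L) ≠ 0 := ordEq_vtheta_theta.ne_zero

theorem eps₂_ne_zero : (eps₂ : L) ≠ 0 := (ordEq_eps₂ (v := vu L)).ne_zero

theorem ordEq_rep (v : HeightOneSpectrum (𝓞 L)) {n m l : ℤ} (hu : OrdEq v n (u : L))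
    (hr : OrdEq v m (rho : L)) (ht : OrdEq v l (theta : L)) (a b c i j k : ℕ) :
    OrdEq v (i * n + j * m + k * l) (rep a b c i j k : L) := by
  have h1 : OrdEq v 0 ((-1 : L) ^ a) := by simpa using (OrdEq.one (v := v) (L := L)).neg.pow a
  have h2 : OrdEq v 0 ((eps₁ : L) ^ b) := by simpa using ordEq_eps₁.pow b
  have h3 : OrdEq v 0 ((eps₂ : L) ^ c) := by simpa using ordEq_eps₂.pow c
  simpa [rep] using ((((h1.mul h2).mul h3).mul (hu.pow i)).mul (hr.pow j)).mul (ht.pow k)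

theorem σ_signs : (σ₁ (eps₁ : L) < 0 ∧ 0 < σ₂ (eps₁ : L) ∧ σ₃ (eps₁ : L) < 0) ∧
    (0 < σ₁ (eps₂ : L) ∧ 0 < σ₂ (eps₂ : L) ∧ σ₃ (eps₂ : L) < 0) ∧
    (0 < σ₁ (u : L) ∧ 0 < σ₂ (u : L) ∧ σ₃ (u : L) < 0) ∧
    (σ₁ (rho : L) < 0 ∧ 0 < σ₂ (rho : L) ∧ 0 < σ₃ (rho : L)) ∧
    (0 < σ₁ (theta : L) ∧ 0 < σ₂ (theta : L) ∧ σ₃ (theta : L) < 0) := by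
  have a1 := σ₁_gt (L := L)
  have a2 := σ₁_lt (L := L)
  have b1 := σ₂_gt (L := L)
  have b2 := σ₂_lt (L := L)
  have c1 := σ₃_gt (L := L)
  have c2 := σ₃_lt (L := L)
  simp only [eps₁, eps₂, rho, theta, map_sub, map_add, map_one, map_mul, map_ofNat, map_pow]
  refine ⟨⟨?_, ?_, ?_⟩, ⟨?_, ?_, ?_⟩, ⟨?_, ?_, ?_⟩, ⟨?_, ?_, ?_⟩, ?_, ?_, ?_⟩ <;> nlinarith

/-- Classes modulo squares of elements of even order away from `u`, `rho`, `theta`, with their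
signs and parities. -/
theorem exists_class (z : L) (hz : z ≠ 0)
    (hev : ∀ v, v ≠ vu L → v ≠ vrho L → v ≠ vtheta L → ∀ n, OrdEq v n z → Even n) :
    ∃ a b c i j k : ℕ, a < 2 ∧ b < 2 ∧ c < 2 ∧ i < 2 ∧ j < 2 ∧ k < 2 ∧
      ∃ w : L, w ≠ 0 ∧ z = rep a b c i j k * w ^ 2 := by
  obtain ⟨n, d, hd, hnd⟩ := IsFractionRing.div_surjective (A := 𝓞 L) z
  have hd0 : (d : L) ≠ 0 := by simpa using nonZeroDivisors.ne_zero hd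
  have hn0 : n ≠ 0 := by rintro rfl; simp at hnd; exact hz hnd.symm
  have hzd : z * (d : L) ^ 2 = ((n * d : 𝓞 L) : L) := by
    rw [← hnd]; simp only [map_mul]; field_simp
  obtain ⟨e, i, j, k, w, h⟩ := exists_int_class (n * d)
    (mul_ne_zero hn0 (nonZeroDivisors.ne_zero hd)) fun v h1 h2 h3 m hm => by
      obtain ⟨l, hl⟩ := exists_ordEq v hd0
      obtain ⟨r, hr⟩ := exists_ordEq v hz
      have he := hev v h1 h2 h3 r hr
      rw [← hzd] at hm
      have := hm.unique (hr.mul (hl.pow 2))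
      rw [Int.even_iff] at *
      push_cast at this
      omega
  obtain ⟨a, b, c, ha, hb, hc, x, hx⟩ : ∃ a b c : ℕ, a < 2 ∧ b < 2 ∧ c < 2 ∧
      ∃ x : (𝓞 L)ˣ, e = (-1) ^ a * epsUnit₁ ^ b * epsUnit₂ ^ c * x ^ 2 := by
    obtain ⟨⟨p1, p2, p3⟩, ⟨q1, q2, q3⟩, -⟩ := σ_signs (L := L)
    have r1 := mul_neg_of_neg_of_pos p1 q1
    have r2 := mul_pos p2 q2
    have r3 := mul_pos_of_neg_of_neg p3 q3
    have main : ∃ a b c : ℕ, a < 2 ∧ b < 2 ∧ c < 2 ∧ signs ((e : 𝓞 L) : L) =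
        signs ((((-1) ^ a * epsUnit₁ ^ b * epsUnit₂ ^ c : (𝓞 L)ˣ) : 𝓞 L) : L) := by
      obtain ⟨s1, s2, s3⟩ := signs ((e : 𝓞 L) : L)
      cases s1 <;> cases s2 <;> cases s3
      · exact ⟨1, 0, 0, by simp, by simp, by simp, by simp [signs]⟩
      · exact ⟨1, 0, 1, by simp, by simp, by simp, by
          simp [signs, coe_epsUnit₂, q1.le, q2.le, q3]⟩
      · exact ⟨0, 1, 0, by simp, by simp, by simp, by
          simp [signs, coe_epsUnit₁, p1.le, p2, p3.le]⟩
      · exact ⟨0, 1, 1, by simp, by simp, by simp, by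
          simp [signs, coe_epsUnit₁, coe_epsUnit₂, r1.le, r2, r3]⟩
      · exact ⟨1, 1, 1, by simp, by simp, by simp, by
          simp [signs, coe_epsUnit₁, coe_epsUnit₂, r1, r2.le, r3.le]⟩
      · exact ⟨1, 1, 0, by simp, by simp, by simp, by
          simp [signs, coe_epsUnit₁, p1, p2.le, p3]⟩
      · exact ⟨0, 0, 1, by simp, by simp, by simp, by
          simp [signs, coe_epsUnit₂, q1, q2, q3.le]⟩
      · exact ⟨0, 0, 0, by simp, by simp, by simp, by simp [signs]⟩
    obtain ⟨a, b, c, ha, hb, hc, h⟩ := main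
    exact ⟨a, b, c, ha, hb, hc, exists_unit_eq_mul_sq h⟩
  refine ⟨a, b, c, i % 2, j % 2, k % 2, ha, hb, hc, Nat.mod_lt _ (by simp),
    Nat.mod_lt _ (by simp), Nat.mod_lt _ (by simp), ?_⟩
  have hL : z * (d : L) ^ 2 = (-1) ^ a * eps₁ ^ b * eps₂ ^ c * ((x : 𝓞 L) : L) ^ 2 * u ^ i *
      rho ^ j * theta ^ k * (w : L) ^ 2 := by
    rw [hzd, h, hx]
    simp only [Units.val_mul, Units.val_pow_eq_pow_val, map_mul, map_pow, Units.val_neg,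
      Units.val_one, map_neg, map_one, coe_epsUnit₁, coe_epsUnit₂, coe_uInt, coe_rhoInt,
      coe_thetaInt]
  have hw : (w : L) ≠ 0 := by
    rintro h0
    rw [h0] at hL
    simp [hz, hd0] at hL
  refine ⟨(x : 𝓞 L) * u ^ (i / 2) * rho ^ (j / 2) * theta ^ (k / 2) * w / d, ?_, ?_⟩
  · exact div_ne_zero (mul_ne_zero (mul_ne_zero (mul_ne_zero (mul_ne_zero (unit_coe_ne_zero x)
      (pow_ne_zero _ u_ne_zero)) (pow_ne_zero _ rho_ne_zero)) (pow_ne_zero _ theta_ne_zero)) hw) hd0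
  · rw [eq_comm, ← mul_left_inj' (pow_ne_zero 2 hd0), hL, rep]
    have e1 (y : L) (n : ℕ) : y ^ n = y ^ (n % 2) * (y ^ (n / 2)) ^ 2 := by
      rw [← pow_mul, ← pow_add]
      congr 1
      omega
    have e2 : u ^ i * rho ^ j * theta ^ k = u ^ (i % 2) * rho ^ (j % 2) * theta ^ (k % 2) *
        (u ^ (i / 2) * rho ^ (j / 2) * theta ^ (k / 2) : L) ^ 2 := by
      linear_combination (rho ^ j * theta ^ k) * e1 u i +
        (u ^ (i % 2) * (u ^ (i / 2)) ^ 2 * theta ^ k) * e1 rho j +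
        (u ^ (i % 2) * (u ^ (i / 2)) ^ 2 * rho ^ (j % 2) * (rho ^ (j / 2)) ^ 2) * e1 theta k
    rw [div_pow, ← mul_div_assoc, div_mul_cancel₀ _ (pow_ne_zero 2 hd0)]
    linear_combination (-(-1) ^ a * eps₁ ^ b * eps₂ ^ c * ((x : 𝓞 L) : L) ^ 2 * (w : L) ^ 2) * e2

end TotallyRealCubic

namespace TotallyRealCubic

open Polynomial Module NumberField IsDedekindDomain

variable {L : Type} [Field L] [NumberField L] [TotallyRealCubic L]

section Rep

variable {a b c i j k : ℕ} {w z : L}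

theorem neg_one_pow_signType {n : ℕ} : (-1 : SignType) ^ n = 1 ↔ n % 2 = 0 := by
  rw [← Nat.even_iff]
  rcases Nat.even_or_odd n with h | h
  · simp [h.neg_one_pow, h]
  · simp only [h.neg_one_pow, ← Nat.not_odd_iff_even, h, not_true_eq_false, iff_false]
    decide

theorem sign_map_rep (σ : L →+* ℝ) (hw : w ≠ 0) :
    SignType.sign (σ (rep a b c i j k * w ^ 2)) =
      (-1) ^ a * SignType.sign (σ (eps₁ : L)) ^ b * SignType.sign (σ (eps₂ : L)) ^ c *
      SignType.sign (σ (u : L)) ^ i * SignType.sign (σ (rho : L)) ^ j *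
      SignType.sign (σ (theta : L)) ^ k := by
  have h : SignType.sign (σ w ^ 2) = 1 := sign_pos (by have := (map_ne_zero σ).2 hw; positivity)
  have h' : SignType.sign (-1 : ℝ) = -1 := sign_neg (by norm_num)
  rw [map_mul, sign_mul, map_pow, h, mul_one, rep]
  simp only [map_mul, map_pow, map_neg, map_one, sign_mul, sign_pow, h']

theorem σ₁_rep_pos (hw : w ≠ 0) (h : z = rep a b c i j k * w ^ 2) :
    0 < σ₁ z ↔ (a + b + j) % 2 = 0 := by
  obtain ⟨⟨p1, -, -⟩, ⟨q1, -, -⟩, ⟨r1, -, -⟩, ⟨s1, -, -⟩, ⟨t1, -, -⟩⟩ := σ_signs (L := L)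
  rw [← sign_eq_one_iff, h, sign_map_rep _ hw, sign_neg p1, sign_pos q1, sign_pos r1, sign_neg s1,
    sign_pos t1, ← neg_one_pow_signType]
  simp only [one_pow, mul_one, pow_add]

theorem σ₂_rep_pos (hw : w ≠ 0) (h : z = rep a b c i j k * w ^ 2) :
    0 < σ₂ z ↔ a % 2 = 0 := by
  obtain ⟨⟨-, p1, -⟩, ⟨-, q1, -⟩, ⟨-, r1, -⟩, ⟨-, s1, -⟩, ⟨-, t1, -⟩⟩ := σ_signs (L := L)
  rw [← sign_eq_one_iff, h, sign_map_rep _ hw, sign_pos p1, sign_pos q1, sign_pos r1, sign_pos s1,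
    sign_pos t1, ← neg_one_pow_signType]
  simp only [one_pow, mul_one]

theorem σ₃_rep_pos (hw : w ≠ 0) (h : z = rep a b c i j k * w ^ 2) :
    0 < σ₃ z ↔ (a + b + c + i + k) % 2 = 0 := by
  obtain ⟨⟨-, -, p1⟩, ⟨-, -, q1⟩, ⟨-, -, r1⟩, ⟨-, -, s1⟩, ⟨-, -, t1⟩⟩ := σ_signs (L := L)
  rw [← sign_eq_one_iff, h, sign_map_rep _ hw, sign_neg p1, sign_neg q1, sign_neg r1, sign_pos s1,
    sign_neg t1, ← neg_one_pow_signType]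
  simp only [one_pow, mul_one, pow_add]

theorem prime_two_norms : vu L ≠ vrho L ∧ vu L ≠ vtheta L ∧ vrho L ≠ vtheta L := by
  have one {v : HeightOneSpectrum (𝓞 L)} {x y r s : L} (hx : OrdEq v 1 x)
      (hy : OrdEq v 1 y) (hr : OrdGE v 0 r) (hs : OrdGE v 0 s) (h : r * x + s * y = 1) : False := by
    have h1 : OrdGE v 1 (1 : L) := by
      rw [← h]
      exact ((hr.mul hx.ge).mono (by norm_num)).add ((hs.mul hy.ge).mono (by norm_num))
    have := OrdEq.one.le_of_ge h1
    omega
  have hI (v : HeightOneSpectrum (𝓞 L)) (p q r : ℤ) : OrdGE v 0 (p + q * u + r * u ^ 2 : L) := by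
    rw [← coe_mkInt]
    exact ordGE_algebraMap _
  refine ⟨fun h => ?_, fun h => ?_, fun h => ?_⟩
  · refine one ordEq_vu_u (h ▸ ordEq_vrho_rho) (hI (vu L) (-22) 4 6) (hI (vu L) (-1) 0 0) ?_
    push_cast
    rw [rho]
    linear_combination 6 * u_cube (L := L)
  · refine one ordEq_vu_u (h ▸ ordEq_vtheta_theta) (hI (vu L) (-6) 0 1) (hI (vu L) 1 0 0) ?_
    push_cast
    rw [theta]
    linear_combination u_cube (L := L)
  · refine one ordEq_vrho_rho (h ▸ ordEq_vtheta_theta) (hI (vrho L) (-16) 0 0)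
      (hI (vrho L) (-53) 14 12) ?_
    push_cast
    rw [rho, theta]
    linear_combination 24 * u_cube (L := L)

theorem parity_u (hw : w ≠ 0) (h : z = rep a b c i j k * w ^ 2) {n : ℤ}
    (hn : OrdEq (vu L) n z) : n % 2 = i % 2 := by
  obtain ⟨m, hm⟩ := exists_ordEq (vu L) hw
  have h1 := (ordEq_rep (vu L) ordEq_vu_u (ordEq_rho prime_two_norms.1)
    (ordEq_theta prime_two_norms.2.1) a b c i j k).mul (hm.pow 2)
  rw [← h] at h1
  have := h1.unique hn
  push_cast at this
  omega

theorem parity_rho (hw : w ≠ 0) (h : z = rep a b c i j k * w ^ 2) {n : ℤ}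
    (hn : OrdEq (vrho L) n z) : n % 2 = j % 2 := by
  obtain ⟨m, hm⟩ := exists_ordEq (vrho L) hw
  have h1 := (ordEq_rep (vrho L) (ordEq_u prime_two_norms.1.symm) ordEq_vrho_rho
    (ordEq_theta prime_two_norms.2.2) a b c i j k).mul (hm.pow 2)
  rw [← h] at h1
  have := h1.unique hn
  push_cast at this
  omega

theorem parity_theta (hw : w ≠ 0) (h : z = rep a b c i j k * w ^ 2) {n : ℤ}
    (hn : OrdEq (vtheta L) n z) : n % 2 = k % 2 := by
  obtain ⟨m, hm⟩ := exists_ordEq (vtheta L) hw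
  have h1 := (ordEq_rep (vtheta L) (ordEq_u prime_two_norms.2.1.symm)
    (ordEq_rho prime_two_norms.2.2.symm) ordEq_vtheta_theta a b c i j k).mul (hm.pow 2)
  rw [← h] at h1
  have := h1.unique hn
  push_cast at this
  omega

theorem norm_rep (h : z = rep a b c i j k * w ^ 2) : Algebra.norm ℚ z =
    (-1) ^ (a + c + i + j + k) * 2 ^ i * 37 ^ (j + k) * (Algebra.norm ℚ w) ^ 2 := by
  have h1 : Algebra.norm ℚ (-1 : L) = -1 := by
    have := norm_coords (L := L) (-1) 0 0
    norm_num at this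
    exact this
  rw [h, rep]
  simp only [map_mul, map_pow, norm_u, norm_eps₁, norm_eps₂, norm_rho, norm_theta, h1, one_pow,
    mul_one]
  rw [neg_pow (2 : ℚ), neg_pow (37 : ℚ) j, neg_pow (37 : ℚ) k]
  ring

end Rep

/-- Elements integral at a prime of prime norm are congruent to natural numbers. -/
theorem exists_nat_cong {p : 𝓞 L} (hp : Prime p) {l : ℕ} (hl : l.Prime)
    (hN : Ideal.absNorm (Ideal.span {p}) = l) {x : L} (hx : OrdGE (ofPrime hp) 0 x) :
    ∃ m : ℕ, m < l ∧ OrdGE (ofPrime hp) 1 (x - m) := by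
  have hc : Nat.card (𝓞 L ⧸ Ideal.span {p}) = l := by
    rw [← hN, Ideal.absNorm_apply, Submodule.cardQuot_apply]
  have : Finite (𝓞 L ⧸ Ideal.span {p}) := Nat.finite_of_card_ne_zero (by rw [hc]; exact hl.ne_zero)
  have := Fintype.ofFinite (𝓞 L ⧸ Ideal.span {p})
  have : Fact l.Prime := ⟨hl⟩
  let e := ZMod.ringEquivOfPrime (𝓞 L ⧸ Ideal.span {p}) hl (by rw [← Nat.card_eq_fintype_card, hc])
  obtain ⟨n, d, hnd, hd⟩ := IsFractionRing.exists_reduced_fraction (A := 𝓞 L) x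
  have hd0 : ((d : 𝓞 L) : L) ≠ 0 := by simp
  have hxd : x * ((d : 𝓞 L) : L) = (n : L) := by
    rw [← hd, IsFractionRing.mk'_eq_div, div_mul_cancel₀ _ hd0]
  have ord_of_dvd {a : 𝓞 L} (h : p ∣ a) : OrdGE (ofPrime hp) 1 (a : L) := by
    obtain ⟨b, rfl⟩ := h
    simp only [map_mul]
    exact ((ordEq_ofPrime hp).ge.mul (ordGE_algebraMap b)).mono (by norm_num)
  have hpd : ¬ p ∣ (d : 𝓞 L) := by
    intro h
    have h1 : OrdGE (ofPrime hp) 1 (n : L) := by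
      rw [← hxd]
      exact (hx.mul (ord_of_dvd h)).mono (by norm_num)
    exact hp.not_isUnit (hnd (dvd_of_ordGE hp h1) h)
  have hdo : OrdEq (ofPrime hp) 0 ((d : 𝓞 L) : L) :=
    (ordGE_algebraMap _).eq_of_not fun h => hpd (dvd_of_ordGE hp h)
  obtain ⟨r, hr⟩ := e.surjective (Ideal.Quotient.mk _ n)
  obtain ⟨s, hs⟩ := e.surjective (Ideal.Quotient.mk _ (d : 𝓞 L))
  have hs0 : s ≠ 0 := by
    rintro rfl
    rw [map_zero, eq_comm, Ideal.Quotient.eq_zero_iff_mem, Ideal.mem_span_singleton] at hs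
    exact hpd hs
  refine ⟨(r / s).val, ZMod.val_lt _, ?_⟩
  have hdvd : p ∣ n - (((r / s).val : ℕ) : 𝓞 L) * (d : 𝓞 L) := by
    rw [← Ideal.mem_span_singleton, ← Ideal.Quotient.eq_zero_iff_mem, map_sub, map_mul, ← hr, ← hs,
      map_natCast, ← map_natCast e, ZMod.natCast_zmod_val, ← map_mul, div_mul_cancel₀ _ hs0, sub_self]
  have := (ord_of_dvd hdvd).div hdo
  have hx' : ((n - (((r / s).val : ℕ) : 𝓞 L) * (d : 𝓞 L) : 𝓞 L) : L) / ((d : 𝓞 L) : L) =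
      x - ((r / s).val : ℕ) := by
    simp only [map_sub, map_mul, map_natCast, ← hxd]
    field_simp
  rwa [hx'] at this

theorem absNorm_span_mkInt {a b c : ℤ} {l : ℕ} (h : (Algebra.norm ℤ (mkInt a b c : 𝓞 L)).natAbs = l) :
    Ideal.absNorm (Ideal.span {(mkInt a b c : 𝓞 L)}) = l := by
  rw [Ideal.absNorm_span_singleton, h]

/-- The residue field at `u` has two elements. -/
theorem residue_u {x : L} (hx : OrdGE (vu L) 0 x) :
    OrdGE (vu L) 1 x ∨ OrdGE (vu L) 1 (x - 1) := by
  obtain ⟨m, hm, h⟩ := exists_nat_cong (prime_uInt (L := L)) Nat.prime_two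
    (absNorm_span_mkInt (by rw [norm_mkInt]; norm_num)) hx
  interval_cases m
  · left; rw [Nat.cast_zero, sub_zero] at h; exact h
  · right; rw [Nat.cast_one] at h; exact h

theorem sub_one_of_unit {x : L} (hx : OrdEq (vu L) 0 x) : OrdGE (vu L) 1 (x - 1) :=
  (residue_u hx.ge).resolve_left (hx.not_ge (by norm_num))

theorem residue_rho {x : L} (hx : OrdGE (vrho L) 0 x) :
    ∃ m : ℕ, m < 37 ∧ OrdGE (vrho L) 1 (x - m) :=
  exists_nat_cong (prime_rhoInt (L := L)) (by norm_num)
    (absNorm_span_mkInt (by rw [norm_mkInt]; norm_num)) hx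

section LocalU

variable {x y q c z e : L} {n m : ℤ}

/-- The sum of two elements of the same order has larger order. -/
theorem ordGE_add_of_eq (hx : OrdEq (vu L) n x) (hy : OrdEq (vu L) n y) :
    OrdGE (vu L) (n + 1) (x + y) := by
  have h1 := sub_one_of_unit (x := -(y / x)) (by simpa using (hy.div hx).neg)
  have h2 := h1.mul hx.ge
  have hx0 := hx.ne_zero
  rw [show (-(y / x) - 1) * x = -(x + y) by field_simp; ring] at h2
  simpa [add_comm] using h2.neg

theorem ordGE_sub_of_eq (hx : OrdEq (vu L) n x) (hy : OrdEq (vu L) n y) :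
    OrdGE (vu L) (n + 1) (x - y) := by
  rw [sub_eq_add_neg]
  exact ordGE_add_of_eq hx hy.neg

theorem ordEq_two : OrdEq (vu L) 3 (2 : L) := by
  have h1 := (ordEq_vu_u (L := L).pow 3).mul (ordEq_eps₂ (v := vu L)).inv
  have h2 : (2 : L) = u ^ 3 * eps₂⁻¹ := by
    have := eps₂_ne_zero (L := L)
    field_simp
    rw [eps₂]
    linear_combination -u_cube (L := L)
  rw [h2]
  simpa using h1

/-- The possible orders of a difference of two unit squares. -/
theorem ord_sq_sub_sq (hq : OrdEq (vu L) 0 q) (hc : OrdEq (vu L) 0 c)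
    (h : OrdEq (vu L) n (q ^ 2 - c ^ 2)) : n = 2 ∨ n = 4 ∨ 7 ≤ n := by
  have h0 : q ^ 2 - c ^ 2 ≠ 0 := h.ne_zero
  have h1 : q - c ≠ 0 := fun h' => h0 (by linear_combination (q + c) * h')
  obtain ⟨m, hm, h2⟩ := (ordGE_sub_of_eq hq hc).exists_ordEq h1
  have h3 : OrdEq (vu L) 3 (2 * c) := by simpa using ordEq_two.mul hc
  rcases lt_trichotomy m 3 with hm3 | rfl | hm3
  · have h4 := h2.mul (h2.add_ge h3.ge hm3)
    have := h.unique (k := n) (m := m + m) (by convert h4 using 1; ring)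
    omega
  · have h4 := h2.ge.mul (ordGE_add_of_eq h2 h3)
    have := h.le_of_ge (m := 3 + (3 + 1)) (by convert h4 using 1; ring)
    omega
  · have h4 := h2.ge.mul (h3.ge_add h2.ge hm3).ge
    have := h.le_of_ge (m := m + 3) (by convert h4 using 1; ring)
    omega

omit [TotallyRealCubic L] in
theorem mul_sub_one {v : HeightOneSpectrum (𝓞 L)} (hn : 0 ≤ n) (hx : OrdGE v n (x - 1))
    (hy : OrdGE v n (y - 1)) : OrdGE v n (x * y - 1) := by
  rw [show x * y - 1 = (x - 1) * (y - 1) + (x - 1) + (y - 1) by ring]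
  exact (((hx.mul hy).mono (by omega)).add hx).add hy

omit [TotallyRealCubic L] in
theorem pow_sub_one {v : HeightOneSpectrum (𝓞 L)} (hn : 0 ≤ n) (hx : OrdGE v n (x - 1)) (k : ℕ) :
    OrdGE v n (x ^ k - 1) := by
  induction k with
  | zero => simpa using OrdGE.zero
  | succ k ih => rw [pow_succ]; exact mul_sub_one hn ih hx

theorem sq_sub_one (hq : OrdEq (vu L) 0 q) : OrdGE (vu L) 2 (q ^ 2 - 1) := by
  by_contra h
  obtain ⟨n, hn⟩ := exists_ordEq (vu L) (x := q ^ 2 - 1) fun h' => h (h' ▸ OrdGE.zero)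
  have h1 := ord_sq_sub_sq hq OrdEq.one (n := n) (by simpa using hn)
  exact h (hn.ge_of_le (by omega))

theorem local_cong : OrdGE (vu L) 2 ((-1 : L) - 1) ∧ OrdGE (vu L) 2 ((eps₂ : L) - 1) ∧
    OrdGE (vu L) 2 ((rho : L) - 1) ∧ OrdGE (vu L) 2 ((theta : L) - 1) := by
  have h2 := ordEq_two (L := L)
  have hu := ordEq_vu_u (L := L)
  refine ⟨?_, ?_, ?_, ?_⟩
  · rw [show (-1 : L) - 1 = -2 by norm_num]
    exact h2.neg.ge_of_le (by norm_num)
  · rw [show (eps₂ : L) - 1 = 2 * (u - 1) by rw [eps₂]; ring]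
    exact (h2.ge.mul (hu.ge_of_le (by norm_num : (0 : ℤ) ≤ 1) |>.sub OrdGE.one)).mono (by norm_num)
  · rw [show (rho : L) - 1 = 2 * (2 * u ^ 2 + u - 7) by rw [rho]; ring]
    refine (h2.ge.mul (m := 0) ?_).mono (by norm_num)
    exact ((((ordGE_ofNat 2).mul (hu.ge.pow 2)).mono (by norm_num)).add (hu.ge.mono (by norm_num))).sub
      (ordGE_ofNat 7)
  · rw [show (theta : L) - 1 = 2 * (u + 1) by rw [theta]; ring]
    exact (h2.ge.mul ((hu.ge_of_le (by norm_num : (0 : ℤ) ≤ 1)).add OrdGE.one)).mono (by norm_num)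

/-- A class containing an element congruent to a square modulo `u ^ 2` does not involve `eps₁`. -/
theorem eq_zero_of_cong {a b c j k : ℕ} {w : L} (hb : b < 2) (hw : w ≠ 0)
    (h : z = rep a b c 0 j k * w ^ 2) (hy : y ≠ 0) (he : OrdGE (vu L) 2 e)
    (hz : z = y ^ 2 * (1 + e)) : b = 0 := by
  have hr : (rep a b c 0 j k : L) = (y / w) ^ 2 * (1 + e) := by
    field_simp
    rw [← h, hz]
  have h0 := ordEq_rep (vu L) ordEq_vu_u (ordEq_rho prime_two_norms.1)
    (ordEq_theta prime_two_norms.2.1) a b c 0 j k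
  obtain ⟨m, hm⟩ := exists_ordEq (vu L) (div_ne_zero hy hw)
  have h1 := (hm.pow 2).mul (OrdEq.one.add_ge he (by norm_num))
  rw [← hr] at h1
  have hm0 := h0.unique h1
  obtain rfl : m = 0 := by push_cast at hm0; omega
  have h2 : OrdGE (vu L) 2 ((rep a b c 0 j k : L) - 1) := by
    rw [hr]
    exact mul_sub_one (by norm_num) (sq_sub_one hm) (by simpa using he)
  by_contra hb0
  obtain rfl : b = 1 := by omega
  obtain ⟨c1, c2, c3, c4⟩ := local_cong (L := L)
  have t2 : (0 : ℤ) ≤ 2 := by norm_num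
  have h3 := mul_sub_one t2 (mul_sub_one t2 (mul_sub_one t2 (pow_sub_one t2 c1 a)
    (pow_sub_one t2 c2 c)) (pow_sub_one t2 c3 j)) (pow_sub_one t2 c4 k)
  have h4 := h2.sub ((ordEq_eps₁.ge.mul h3).mono (by norm_num))
  have h5 : OrdEq (vu L) 1 ((u : L) - 2) := ordEq_vu_u.sub_ge ordEq_two.ge (by norm_num)
  have := h5.le_of_ge (m := 2) (by convert h4 using 1; rw [rep]; simp only [eps₁]; ring)
  omega

theorem ordEq_intCast_odd {k : ℤ} (hk : Odd k) : OrdEq (vu L) 0 (k : L) := by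
  obtain ⟨m, rfl⟩ := hk
  push_cast
  exact OrdEq.ge_add OrdEq.one (ordEq_two.ge.mul (ordGE_intCast m)) (by norm_num)

theorem exists_ordEq_intCast {k : ℤ} (hk : k ≠ 0) : ∃ n : ℤ, OrdEq (vu L) (3 * n) (k : L) := by
  have hf : FiniteMultiplicity 2 k := Int.finiteMultiplicity_iff.2 ⟨by norm_num, hk⟩
  obtain ⟨c, hc, h⟩ := hf.exists_eq_pow_mul_and_not_dvd
  refine ⟨multiplicity 2 k, ?_⟩
  rw [hc]
  push_cast
  have h1 := (ordEq_two (L := L).pow (multiplicity 2 k)).mul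
    (ordEq_intCast_odd (Int.not_even_iff_odd.1 fun h' => h h'.two_dvd))
  convert h1 using 1
  rw [← hc]; ring

/-- Nonzero rational numbers have order divisible by three at `u`. -/
theorem exists_ordEq_ratCast {r : ℚ} (hr : r ≠ 0) : ∃ n : ℤ, OrdEq (vu L) (3 * n) (r : L) := by
  obtain ⟨n, hn⟩ := exists_ordEq_intCast (L := L) (Rat.num_ne_zero.2 hr)
  obtain ⟨m, hm⟩ := exists_ordEq_intCast (L := L) (k := (r.den : ℤ)) (by exact_mod_cast r.den_ne_zero)
  refine ⟨n - m, ?_⟩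
  have := hn.div hm
  rw [show 3 * (n - m) = 3 * n - 3 * m by ring, Rat.cast_def]
  exact_mod_cast this

theorem ordGE_ratCast {r : ℚ} {n : ℤ} (h : OrdGE (vu L) (3 * n + 1) (r : L)) :
    OrdGE (vu L) (3 * n + 3) (r : L) := by
  by_cases hr : r = 0
  · subst hr; simpa using OrdGE.zero
  obtain ⟨m, hm⟩ := exists_ordEq_ratCast (L := L) hr
  have := hm.le_of_ge h
  exact hm.ge_of_le (by omega)

theorem ratCast_sub_one {r : ℚ} (h : OrdEq (vu L) 0 (r : L)) : OrdGE (vu L) 3 ((r : L) - 1) := by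
  have h1 := sub_one_of_unit h
  have := ordGE_ratCast (L := L) (r := r - 1) (n := 0) (by push_cast; exact h1)
  simpa using this

theorem ratCast_sq_sub_one {r : ℚ} (h : OrdEq (vu L) 0 (r : L)) :
    OrdGE (vu L) 9 ((r : L) ^ 2 - 1) := by
  have h1 := ratCast_sub_one h
  rw [show (r : L) ^ 2 - 1 = (r - 1) * (r - 1 + 2) by ring]
  by_cases h2 : OrdGE (vu L) 4 ((r : L) - 1)
  · have h3 := ordGE_ratCast (L := L) (r := r - 1) (n := 1) (by push_cast; exact h2)
    push_cast at h3
    exact (h3.mul ((h3.mono (by norm_num)).add ordEq_two.ge)).mono (by norm_num)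
  · have h3 := ordGE_add_of_eq (h1.eq_of_not h2) ordEq_two
    have h4 := ordGE_ratCast (L := L) (r := r - 1 + 2) (n := 1) (by push_cast; exact h3)
    push_cast at h4
    exact (h1.mul h4).mono (by norm_num)

end LocalU

end TotallyRealCubic

namespace TotallyRealCubic

open Polynomial Module NumberField IsDedekindDomain

/-- Parities in an equation between a square and a square class supported at `2` and `37`. -/
theorem parity_of_sq {r q : ℚ} {s i j : ℕ} (hq : q ≠ 0)
    (h : r ^ 2 = (-1) ^ s * 2 ^ i * 37 ^ j * q ^ 2) : s % 2 = 0 ∧ i % 2 = 0 ∧ j % 2 = 0 := by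
  have hr : r ≠ 0 := by
    rintro rfl
    have : ((-1) ^ s * 2 ^ i * 37 ^ j * q ^ 2 : ℚ) ≠ 0 := by positivity
    exact this (by rw [← h]; norm_num)
  have hs : s % 2 = 0 := by
    by_contra hs
    have : (-1 : ℚ) ^ s = -1 := Odd.neg_one_pow (Nat.odd_iff.2 (by omega))
    rw [this] at h
    have h1 : 0 < r ^ 2 := by positivity
    have h2 : 0 < (2 ^ i * 37 ^ j * q ^ 2 : ℚ) := by positivity
    linarith
  have h1 : (-1 : ℚ) ^ s = 1 := Even.neg_one_pow (Nat.even_iff.2 hs)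
  rw [h1, one_mul] at h
  have key (p : ℕ) [Fact p.Prime] : 2 * padicValRat p r =
      i * padicValRat p 2 + j * padicValRat p 37 + 2 * padicValRat p q := by
    have := congrArg (padicValRat p) h
    rw [padicValRat.mul (by positivity) (by positivity), padicValRat.mul (by positivity)
      (by positivity), padicValRat.pow, padicValRat.pow, padicValRat.pow, padicValRat.pow] at this
    exact_mod_cast this
  have : Fact (Nat.Prime 37) := ⟨by norm_num⟩
  have a1 : padicValRat 2 2 = 1 := by
    exact_mod_cast padicValRat.self (p := 2) (by norm_num)
  have a2 : padicValRat 37 37 = 1 := by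
    exact_mod_cast padicValRat.self (p := 37) (by norm_num)
  have a3 : padicValRat 2 37 = 0 := by
    have : padicValRat 2 ((37 : ℕ) : ℚ) = 0 := by
      rw [padicValRat.of_nat, padicValNat.eq_zero_of_not_dvd (by norm_num)]; rfl
    exact_mod_cast this
  have a4 : padicValRat 37 2 = 0 := by
    have : padicValRat 37 ((2 : ℕ) : ℚ) = 0 := by
      rw [padicValRat.of_nat, padicValNat.eq_zero_of_not_dvd (by norm_num)]; rfl
    exact_mod_cast this
  have k2 := key 2
  have k37 := key 37
  rw [a1, a3] at k2
  rw [a2, a4] at k37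
  omega

variable {L : Type} [Field L] [NumberField L] [TotallyRealCubic L]

theorem coords_eq_zero {a b c : ℚ} (h : (a + b * u + c * u ^ 2 : L) = 0) :
    a = 0 ∧ b = 0 ∧ c = 0 := by
  have := Fintype.linearIndependent_iff.1 (basis (L := L)).linearIndependent ![a, b, c] (by
    simp only [Fin.sum_univ_three, basis_apply, Algebra.smul_def]
    simp
    linear_combination h)
  exact ⟨this 0, this 1, this 2⟩

theorem ordEq_two_of_ne {v : HeightOneSpectrum (𝓞 L)} (h : v ≠ vu L) : OrdEq v 0 (2 : L) := by
  have h1 := ((ordEq_u h).pow 3).mul (ordEq_eps₂ (v := v)).inv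
  have h2 : (2 : L) = u ^ 3 * eps₂⁻¹ := by
    have := eps₂_ne_zero (L := L)
    field_simp
    rw [eps₂]
    linear_combination -u_cube (L := L)
  rw [h2]
  simpa using h1

theorem ordGE_u (v : HeightOneSpectrum (𝓞 L)) : OrdGE v 0 (u : L) := by
  rw [← coe_uInt]; exact ordGE_algebraMap _

/-- The order at `u` of the abscissa of a rational point. -/
theorem order_of_first {x Y : ℚ} (h : Y ^ 2 = 4 * x ^ 3 - 4 * x - 1) :
    ∃ n m : ℤ, n ≤ -2 ∧ OrdEq (vu L) (3 * n) (x : L) ∧ OrdEq (vu L) (3 * m) (Y : L) ∧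
      2 * m = 2 + 3 * n := by
  have hL : (Y : L) ^ 2 = 4 * x ^ 3 - 4 * x - 1 := by exact_mod_cast congrArg (Rat.cast (K := L)) h
  have h4 : OrdEq (vu L) 6 (4 : L) := by
    rw [show (4 : L) = 2 ^ 2 by norm_num]; simpa using ordEq_two.pow 2
  have bad : ¬ OrdGE (vu L) 0 (x : L) := by
    intro hx
    have h1 : OrdGE (vu L) 6 ((Y : L) ^ 2 + 1) := by
      rw [hL, show (4 * x ^ 3 - 4 * x - 1 + 1 : L) = 4 * (x ^ 3 - x) by ring]
      exact (h4.ge.mul (m := 0) (by simpa using (hx.pow 3).sub hx)).mono (by norm_num)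
    have h2 : OrdEq (vu L) 0 ((Y : L) ^ 2) := by
      rw [show (Y : L) ^ 2 = -1 + (Y ^ 2 + 1) by ring]
      exact OrdEq.one.neg.add_ge h1 (by norm_num)
    obtain ⟨k, hk⟩ := exists_ordEq (vu L) (x := (Y : L)) fun h0 => h2.ne_zero (by rw [h0]; ring)
    have := (hk.pow 2).unique h2
    obtain rfl : k = 0 := by push_cast at this; omega
    have h3 := h1.sub ((ratCast_sq_sub_one hk).mono (by norm_num))
    rw [show (Y : L) ^ 2 + 1 - (Y ^ 2 - 1) = 2 by ring] at h3
    have := ordEq_two.le_of_ge h3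
    omega
  have hx0 : x ≠ 0 := by rintro rfl; exact bad (by simpa using OrdGE.zero)
  obtain ⟨n, hn⟩ := exists_ordEq_ratCast (L := L) hx0
  have hn0 : n < 0 := by
    by_contra hh
    exact bad (hn.ge_of_le (by omega))
  have h1 : OrdEq (vu L) (6 + 9 * n) ((Y : L) ^ 2) := by
    rw [hL, sub_sub]
    refine OrdEq.sub_ge ?_ (m := 6 + 9 * n + 1) (((h4.mul hn).ge_of_le (by omega)).add
      (OrdGE.one.mono (by omega))) (by omega)
    convert h4.mul (hn.pow 3) using 1
    push_cast; ring
  have hY0 : Y ≠ 0 := by rintro rfl; exact h1.ne_zero (by simp)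
  obtain ⟨m, hm⟩ := exists_ordEq_ratCast (L := L) hY0
  have := (hm.pow 2).unique h1
  push_cast at this
  exact ⟨n, m, by omega, hn, hm, by omega⟩

/-- One step of the descent on `Y ^ 2 = 4 * x ^ 3 - 4 * x - 1`. -/
theorem sq_of_first {x Y : ℚ} (h : Y ^ 2 = 4 * x ^ 3 - 4 * x - 1) :
    ∃ w : L, (4 * x + 2 * u : L) = w ^ 2 := by
  obtain ⟨n, m, hn2, hn, hm, hmn⟩ := order_of_first (L := L) h
  have hL : (Y : L) ^ 2 = 4 * x ^ 3 - 4 * x - 1 := by exact_mod_cast congrArg (Rat.cast (K := L)) h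
  have h4 : OrdEq (vu L) 6 (4 : L) := by
    rw [show (4 : L) = 2 ^ 2 by norm_num]; simpa using ordEq_two.pow 2
  set z : L := 4 * x + 2 * u with hzdef
  have hnorm : Algebra.norm ℚ z = (4 * Y) ^ 2 := by
    have := norm_coords (L := L) (4 * x) 2 0
    rw [show (((4 * x : ℚ) : L) + ((2 : ℚ) : L) * u + ((0 : ℚ) : L) * u ^ 2) = z by
      push_cast; ring] at this
    rw [this]
    linear_combination -16 * h
  have hY0 : Y ≠ 0 := by rintro rfl; exact hm.ne_zero (by simp)
  have hx0 : x ≠ 0 := by rintro rfl; exact hn.ne_zero (by simp)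
  have hz0 : z ≠ 0 := by
    intro h0
    rw [h0, Algebra.norm_zero] at hnorm
    have : (4 * Y) ^ 2 ≠ 0 := by positivity
    exact this hnorm.symm
  have hcubic : z * (z ^ 2 + (-6 * u) * z + 2 ^ 2 * u ^ 2 * rho) = (4 * Y) ^ 2 := by
    rw [mul_pow, hL, rho, hzdef]
    linear_combination ((4 * x + 2 * u) * (16 * u + 8) + 8) * u_cube (L := L)
  have hev : ∀ v, v ≠ vu L → v ≠ vrho L → ∀ n, OrdEq v n z → Even n := by
    intro v h1 h2 n hn
    refine hn.even_of_cubic (A := -6 * u) (B := 2 ^ 2 * u ^ 2 * rho) ?_ ?_ hcubic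
    · exact ((ordGE_ofNat 6).neg.mul (ordGE_u v)).mono (by norm_num)
    · simpa using ((((ordEq_two_of_ne h1).pow 2).mul ((ordEq_u h1).pow 2)).mul (ordEq_rho h2))
  obtain ⟨a, b, c, i, j, k, ha, hb, hc, hi, hj, hk, w, hw, hzw⟩ :=
    exists_class z hz0 fun v h1 h2 _ => hev v h1 h2
  have hk0 : k % 2 = 0 := by
    obtain ⟨l, hl⟩ := exists_ordEq (vtheta L) hz0
    have h1 := parity_theta hw hzw hl
    have h2 := hev _ prime_two_norms.2.1.symm prime_two_norms.2.2.symm l hl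
    rw [Int.even_iff] at h2
    omega
  have hN := norm_rep hzw
  rw [hnorm] at hN
  obtain ⟨p1, p2, p3⟩ := parity_of_sq (by simpa using hw) hN
  have hσ2 : 0 < σ₂ z := by
    have hR : (0 : ℝ) < 4 * x ^ 3 - 4 * x - 1 := by
      have : (0 : ℚ) < 4 * x ^ 3 - 4 * x - 1 := by rw [← h]; positivity
      exact_mod_cast this
    have b1 := σ₂_gt (L := L)
    have b2 := σ₂_lt (L := L)
    have b3 : σ₂ (u : L) ^ 3 = 4 * σ₂ (u : L) - 2 := by
      rw [← map_pow, u_cube]; simp only [map_sub, map_mul, map_ofNat]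
    rw [hzdef]
    simp only [map_add, map_mul, map_ofNat, map_ratCast]
    by_contra hneg
    push Not at hneg
    have hQ : 0 < (4 * x : ℝ) ^ 2 - 2 * σ₂ (u : L) * (4 * x) + 4 * σ₂ (u : L) ^ 2 - 16 := by
      nlinarith
    nlinarith [mul_nonneg (neg_nonneg.2 hneg) hQ.le]
  have e1 := (σ₂_rep_pos hw hzw).1 hσ2
  obtain rfl : i = 0 := by omega
  have hb0 := eq_zero_of_cong (y := (Y / x : L)) (e := (4 / x + 1 / x ^ 2 + 2 * u) * (x / Y) ^ 2) hb hw hzw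
    (div_ne_zero hm.ne_zero hn.ne_zero) ?_ ?_
  · obtain rfl : a = 0 := by omega
    obtain rfl : k = 0 := by omega
    obtain rfl : j = 0 := by omega
    obtain rfl : c = 0 := by omega
    subst hb0
    exact ⟨w, by rw [hzw, rep]; ring⟩
  · have o1 : OrdGE (vu L) 4 (4 / x + 1 / x ^ 2 + 2 * u : L) := by
      refine (((h4.div hn).ge_of_le (by omega)).add
        ((OrdEq.one.div (hn.pow 2)).ge_of_le (by push_cast; omega))).add
        ((ordEq_two.mul ordEq_vu_u).ge_of_le (by norm_num))
    have o2 := o1.mul ((hn.div hm).pow 2).ge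
    exact o2.mono (by push_cast; omega)
  · have hxL := hn.ne_zero
    have hYL := hm.ne_zero
    rw [hzdef]
    field_simp
    linear_combination -hL

theorem descent_first {x : ℚ} (w : L)
    (hw : (4 * x + 2 * u : L) = w ^ 2) : ∃ x' Y' : ℚ, Y' ≠ 0 ∧
      Y' ^ 2 = 4 * x' ^ 3 - 4 * x' - 1 ∧ x * Y' ^ 2 = x' ^ 4 + 2 * x' ^ 2 + 1 + 2 * x' := by
  obtain ⟨p, q, r, rfl⟩ := exists_coords w
  have h0 : ((4 * x - (p ^ 2 - 4 * q * r) : ℚ) + ((2 - (2 * p * q + 8 * q * r - 2 * r ^ 2) : ℚ) : L)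
      * u + ((-(q ^ 2 + 2 * p * r + 4 * r ^ 2) : ℚ) : L) * u ^ 2 : L) = 0 := by
    push_cast
    linear_combination hw + (2 * q * r + r ^ 2 * u) * u_cube (L := L)
  obtain ⟨h1, h2, h3⟩ := coords_eq_zero h0
  have hr : r ≠ 0 := by
    rintro rfl
    have hq : q = 0 := by simpa using h3
    subst hq
    norm_num at h2
  have hp : p = -(q ^ 2 + 4 * r ^ 2) / (2 * r) := by
    field_simp
    linear_combination -h3
  refine ⟨-q / (2 * r), 1 / r, by positivity, ?_, ?_⟩
  · subst hp
    field_simp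
    field_simp at h2
    linear_combination 4 * h2
  · have hx : x = (p ^ 2 - 4 * q * r) / 4 := by linear_combination h1 / 4
    rw [hx, hp]
    field_simp
    ring

theorem no_first (x Y : ℚ) : Y ^ 2 ≠ 4 * x ^ 3 - 4 * x - 1 := by
  obtain ⟨L, hF, hN, ⟨hT⟩⟩ := exists_model
  intro h
  obtain ⟨n, m, -, hn, -, -⟩ := order_of_first (L := L) h
  obtain ⟨N, hN⟩ : ∃ N : ℕ, -n ≤ N := ⟨n.natAbs, by omega⟩
  induction N using Nat.strong_induction_on generalizing x Y n with
  | _ N ih =>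
  obtain ⟨n₁, m₁, hn1, hx, -, -⟩ := order_of_first (L := L) h
  have hn' := hx.unique hn
  obtain ⟨w, hw⟩ := sq_of_first (L := L) h
  obtain ⟨x', Y', hY', h', hxx⟩ := descent_first w hw
  obtain ⟨n₂, m₂, hn2, hx', hY2, hnm⟩ := order_of_first (L := L) h'
  have hL : (x : L) * Y' ^ 2 = x' ^ 4 + 2 * x' ^ 2 + 1 + 2 * x' := by
    exact_mod_cast congrArg (Rat.cast (K := L)) hxx
  have h1 : OrdEq (vu L) (4 * (3 * n₂)) ((x : L) * Y' ^ 2) := by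
    rw [hL, show (x' ^ 4 + 2 * x' ^ 2 + 1 + 2 * x' : L) = x' ^ 4 + (2 * x' ^ 2 + 1 + 2 * x') by ring]
    refine (hx'.pow 4).add_ge (m := 4 * (3 * n₂) + 1) ?_ (by push_cast; omega)
    exact (((ordEq_two.mul (hx'.pow 2)).ge_of_le (by push_cast; omega)).add
      (OrdGE.one.mono (by omega))).add ((ordEq_two.mul hx').ge_of_le (by omega))
  have h2 := (hx.mul (hY2.pow 2)).unique h1
  push_cast at h2
  exact ih (N - 2) (by omega) x' Y' h' n₂ hx' (by omega)

end TotallyRealCubic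

namespace TotallyRealCubic

open Polynomial Module NumberField IsDedekindDomain

variable {L : Type} [Field L] [NumberField L] [TotallyRealCubic L]

theorem ordGE_coords (v : HeightOneSpectrum (𝓞 L)) (a b c : ℤ) :
    OrdGE v 0 (a + b * u + c * u ^ 2 : L) := by
  rw [← coe_mkInt]; exact ordGE_algebraMap _

omit [NumberField L] [TotallyRealCubic L] in
theorem pos_of_cubic {σ : L →+* ℝ} {z A B y : L} (h : z * (z ^ 2 + A * z + B) = y ^ 2) (hz : z ≠ 0)
    (hA : σ A ≤ 0) (hB : 0 < σ B) : 0 < σ z := by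
  have h1 := congrArg σ h
  simp only [map_mul, map_add, map_pow] at h1
  have h2 : σ z ≠ 0 := (map_ne_zero σ).2 hz
  by_contra h3
  have h4 : σ z < 0 := lt_of_le_of_ne (not_lt.1 h3) h2
  have h5 : 0 < σ z ^ 2 + σ A * σ z + σ B := by nlinarith
  nlinarith [mul_neg_of_neg_of_pos h4 h5, sq_nonneg (σ y)]

theorem ordEq_four : OrdEq (vu L) 6 (4 : L) := by
  rw [show (4 : L) = 2 ^ 2 by norm_num]; simpa using ordEq_two.pow 2

/-- The order at `u` of the abscissa of a rational point. -/
theorem order_of_second {x Y : ℚ} (h : Y ^ 2 = 4 * x ^ 3 + 4 * x ^ 2 - 92 * x - 199) :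
    (∃ n m : ℤ, n ≤ -2 ∧ OrdEq (vu L) (3 * n) (x : L) ∧ OrdEq (vu L) (3 * m) (Y : L) ∧
      2 * m = 2 + 3 * n) ∨ (OrdGE (vu L) 3 (x : L) ∧ OrdEq (vu L) 0 (Y : L)) := by
  have hL : (Y : L) ^ 2 = 4 * x ^ 3 + 4 * x ^ 2 - 92 * x - 199 := by
    exact_mod_cast congrArg (Rat.cast (K := L)) h
  have h4 := ordEq_four (L := L)
  have h199 : OrdEq (vu L) 0 (199 : L) := by
    exact_mod_cast ordEq_intCast_odd (L := L) (k := 199) (by decide)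
  have h8 : OrdEq (vu L) 9 (8 : L) := by
    rw [show (8 : L) = 2 ^ 3 by norm_num]; simpa using ordEq_two.pow 3
  by_cases hx : OrdGE (vu L) 0 (x : L)
  · right
    have h1 : OrdEq (vu L) 0 ((Y : L) ^ 2) := by
      rw [hL, show (4 * x ^ 3 + 4 * x ^ 2 - 92 * x - 199 : L) =
        -199 + 4 * (x ^ 3 + x ^ 2 - 23 * x) by ring]
      refine h199.neg.add_ge (h4.ge.mul (m := 0) ?_) (by norm_num)
      exact ((by simpa using hx.pow 3 : OrdGE _ _ _).add (by simpa using hx.pow 2)).sub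
        (by simpa using (ordGE_ofNat 23).mul hx)
    obtain ⟨k, hk⟩ := exists_ordEq (vu L) (x := (Y : L)) fun h0 => h1.ne_zero (by rw [h0]; ring)
    have := (hk.pow 2).unique h1
    obtain rfl : k = 0 := by push_cast at this; omega
    refine ⟨?_, hk⟩
    have h2 := ratCast_sq_sub_one hk
    by_contra h3
    have hx0 : OrdEq (vu L) 0 (x : L) := by
      obtain ⟨n, hn⟩ := exists_ordEq_ratCast (L := L) (r := x) (by
        rintro rfl; exact h3 (by simpa using OrdGE.zero))
      have h5 := hn.le_of_ge hx
      obtain rfl : n = 0 := by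
        by_contra h6
        exact h3 (hn.ge_of_le (by omega))
      exact hn
    have hx2 := ratCast_sq_sub_one hx0
    have hx1 := ratCast_sub_one hx0
    have h6 : OrdGE (vu L) 9 (4 : L) := by
      rw [show (4 : L) = ((Y : L) ^ 2 - 1) - 4 * (x + 1) * (x ^ 2 - 1) + 8 * (11 * x + 25) by
        rw [hL]; ring]
      refine (h2.sub ?_).add ?_
      · exact ((h4.ge.mul (hx.add OrdGE.one)).mul hx2).mono (by norm_num)
      · exact (h8.ge.mul (m := 0) (((ordGE_ofNat 11).mul hx |>.mono (by norm_num)).add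
          (ordGE_ofNat 25))).mono (by norm_num)
    have := h4.le_of_ge h6
    omega
  · left
    have hx0 : x ≠ 0 := by rintro rfl; exact hx (by simpa using OrdGE.zero)
    obtain ⟨n, hn⟩ := exists_ordEq_ratCast (L := L) hx0
    have hn0 : n < 0 := by
      by_contra hh
      exact hx (hn.ge_of_le (by omega))
    have h1 : OrdEq (vu L) (6 + 9 * n) ((Y : L) ^ 2) := by
      rw [hL, show (4 * x ^ 3 + 4 * x ^ 2 - 92 * x - 199 : L) =
        4 * x ^ 3 + (4 * x ^ 2 - 23 * (4 * x) - 199) by ring]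
      refine OrdEq.add_ge (m := 6 + 9 * n + 1) ?_ ?_ (by omega)
      · convert h4.mul (hn.pow 3) using 1
        push_cast; ring
      · exact (((h4.mul (hn.pow 2)).ge_of_le (by push_cast; omega)).sub
          (((ordGE_ofNat 23).mul (h4.mul hn).ge).mono (by omega))).sub (h199.ge_of_le (by omega))
    have hY0 : Y ≠ 0 := by rintro rfl; exact h1.ne_zero (by simp)
    obtain ⟨m, hm⟩ := exists_ordEq_ratCast (L := L) hY0
    have := (hm.pow 2).unique h1
    push_cast at this
    exact ⟨n, m, by omega, hn, hm, by omega⟩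

theorem sq_of_second {x Y : ℚ} (h : Y ^ 2 = 4 * x ^ 3 + 4 * x ^ 2 - 92 * x - 199) :
    ∃ w : L, (4 * x + 12 + 6 * u - 4 * u ^ 2 : L) = w ^ 2 := by
  have hL : (Y : L) ^ 2 = 4 * x ^ 3 + 4 * x ^ 2 - 92 * x - 199 := by
    exact_mod_cast congrArg (Rat.cast (K := L)) h
  have h4 := ordEq_four (L := L)
  have hu := ordEq_vu_u (L := L)
  set z : L := 4 * x + 12 + 6 * u - 4 * u ^ 2 with hzdef
  have hnorm : Algebra.norm ℚ z = (4 * Y) ^ 2 := by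
    have := norm_coords (L := L) (4 * x + 12) 6 (-4)
    rw [show (((4 * x + 12 : ℚ) : L) + ((6 : ℚ) : L) * u + ((-4 : ℚ) : L) * u ^ 2) = z by
      push_cast; ring] at this
    rw [this]
    linear_combination -16 * h
  have hY0 : (Y : L) ≠ 0 := by
    rcases order_of_second (L := L) h with ⟨n, m, -, -, hm, -⟩ | ⟨-, hm⟩ <;> exact hm.ne_zero
  have hz0 : z ≠ 0 := by
    intro h0
    rw [h0, Algebra.norm_zero] at hnorm
    have : Y ≠ 0 := by simpa using hY0
    have : (4 * Y) ^ 2 ≠ 0 := by positivity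
    exact this hnorm.symm
  have hcubic : z * (z ^ 2 + ((-32 : ℤ) + (-18 : ℤ) * u + (12 : ℤ) * u ^ 2) * z +
      -(2 ^ 2 * u ^ 2 * eps₂ * rho ^ 3)) = (4 * Y) ^ 2 := by
    have := u_cube (L := L)
    rw [rho, eps₂]
    push_cast
    grind
  have hev : ∀ v, v ≠ vu L → v ≠ vrho L → ∀ n, OrdEq v n z → Even n := by
    intro v h1 h2 n hn
    refine hn.even_of_cubic (ordGE_coords v _ _ _) (OrdEq.neg ?_) hcubic
    simpa using ((((ordEq_two_of_ne h1).pow 2).mul ((ordEq_u h1).pow 2)).mul ordEq_eps₂).mul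
      ((ordEq_rho h2).pow 3)
  obtain ⟨a, b, c, i, j, k, ha, hb, hc, hi, hj, hk, w, hw, hzw⟩ :=
    exists_class z hz0 fun v h1 h2 _ => hev v h1 h2
  have hk0 : k % 2 = 0 := by
    obtain ⟨l, hl⟩ := exists_ordEq (vtheta L) hz0
    have h1 := parity_theta hw hzw hl
    have h2 := hev _ prime_two_norms.2.1.symm prime_two_norms.2.2.symm l hl
    rw [Int.even_iff] at h2
    omega
  have hN := norm_rep hzw
  rw [hnorm] at hN
  obtain ⟨p1, p2, p3⟩ := parity_of_sq (by simpa using hw) hN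
  have hσ1 : 0 < σ₁ z := by
    obtain ⟨-, ⟨q1, -, -⟩, ⟨r1, -, -⟩, ⟨s1, -, -⟩, -⟩ := σ_signs (L := L)
    refine pos_of_cubic hcubic hz0 ?_ ?_
    · have a1 := σ₁_gt (L := L)
      have a2 := σ₁_lt (L := L)
      simp only [map_add, map_mul, map_pow, map_intCast]
      push_cast
      nlinarith
    · have s2 : 0 < σ₁ (rho : L) ^ 2 := sq_pos_of_neg s1
      have h1 : 0 < 2 ^ 2 * σ₁ (u : L) ^ 2 * σ₁ (eps₂ : L) * σ₁ (rho : L) ^ 2 := by positivity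
      simp only [map_neg, map_mul, map_pow, map_ofNat]
      linarith [mul_neg_of_pos_of_neg h1 s1]
  have e1 := (σ₁_rep_pos hw hzw).1 hσ1
  obtain rfl : i = 0 := by omega
  have hb0 : b = 0 := by
    rcases order_of_second (L := L) h with ⟨n, m, hn2, hn, hm, hnm⟩ | ⟨hx, -⟩
    · have hxL := hn.ne_zero
      refine eq_zero_of_cong (y := (Y / x : L))
        (e := (4 * 2 + 3 * (2 * u) - 4 * u ^ 2 + 92 / x + 199 / x ^ 2) * (x / Y) ^ 2) hb hw hzw
        (div_ne_zero hY0 hxL) ?_ ?_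
      · have o1 : OrdGE (vu L) 4 (4 * 2 + 3 * (2 * u) - 4 * u ^ 2 + 92 / x + 199 / x ^ 2 : L) := by
          refine (((OrdGE.add ?_ ?_).sub ?_).add ?_).add ?_
          · exact (h4.mul ordEq_two).ge_of_le (by norm_num)
          · exact ((ordGE_ofNat 3).mul (ordEq_two.mul hu).ge).mono (by norm_num)
          · exact (h4.mul (hu.pow 2)).ge_of_le (by norm_num)
          · exact ((ordGE_ofNat 92).div hn).mono (by omega)
          · exact ((ordGE_ofNat 199).div (hn.pow 2)).mono (by push_cast; omega)
        exact (o1.mul ((hn.div hm).pow 2).ge).mono (by push_cast; omega)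
      · rw [hzdef]
        field_simp
        linear_combination -hL
    · refine eq_zero_of_cong (y := (u ^ 2 : L)) (e := (4 * x + 4 * 3 + 4 * (2 * u) - 4 * (2 * u ^ 2)) / u ^ 4)
        hb hw hzw (pow_ne_zero 2 u_ne_zero) ?_ ?_
      · have o1 : OrdGE (vu L) 6 (4 * x + 4 * 3 + 4 * (2 * u) - 4 * (2 * u ^ 2) : L) := by
          refine (((h4.ge.mul hx).mono (by norm_num)).add ?_).add ?_ |>.sub ?_
          · exact (h4.ge.mul (ordGE_ofNat 3)).mono (by norm_num)
          · exact (h4.mul (ordEq_two.mul hu)).ge_of_le (by norm_num)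
          · exact (h4.mul (ordEq_two.mul (hu.pow 2))).ge_of_le (by norm_num)
        exact (o1.div (hu.pow 4)).mono (by norm_num)
      · have := u_ne_zero (L := L)
        rw [hzdef]
        field_simp
        linear_combination (-u : L) * u_cube (L := L)
  obtain rfl : a = 0 := by omega
  obtain rfl : k = 0 := by omega
  obtain rfl : j = 0 := by omega
  obtain rfl : c = 0 := by omega
  subst hb0
  exact ⟨w, by rw [hzw, rep]; ring⟩

theorem descent_second {x : ℚ} (w : L) (hw : (4 * x + 12 + 6 * u - 4 * u ^ 2 : L) = w ^ 2) :
    ∃ x' Y' : ℚ, Y' ≠ 0 ∧ Y' ^ 2 = 4 * x' ^ 3 + 4 * x' ^ 2 - 92 * x' - 199 ∧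
      x * Y' ^ 2 = x' ^ 4 + 46 * x' ^ 2 + 398 * x' + 728 := by
  obtain ⟨p, q, r, rfl⟩ := exists_coords w
  have h0 : ((4 * x + 12 - (p ^ 2 - 4 * q * r) : ℚ) +
      ((6 - (2 * p * q + 8 * q * r - 2 * r ^ 2) : ℚ) : L) * u +
      ((-4 - (q ^ 2 + 2 * p * r + 4 * r ^ 2) : ℚ) : L) * u ^ 2 : L) = 0 := by
    push_cast
    linear_combination hw + (2 * q * r + r ^ 2 * u) * u_cube (L := L)
  obtain ⟨h1, h2, h3⟩ := coords_eq_zero h0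
  have hr : r ≠ 0 := by
    rintro rfl
    nlinarith [sq_nonneg q]
  have hp : p = -(q ^ 2 + 4 * r ^ 2 + 4) / (2 * r) := by
    field_simp
    linear_combination -h3
  have hF : q ^ 3 - 4 * q * r ^ 2 + 2 * r ^ 3 + 4 * q + 6 * r = 0 := by
    rw [hp] at h2
    field_simp at h2
    linear_combination h2
  have hd : 2 * q + 3 * r ≠ 0 := by
    intro hd
    have hq : q = -3 / 2 * r := by linear_combination hd / 2
    rw [hq] at hF
    have : r ^ 3 = 0 := by linear_combination 8 / 37 * hF
    exact hr (pow_eq_zero_iff (by norm_num) |>.1 this)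
  refine ⟨-(5 * q + 26 * r) / (2 * (2 * q + 3 * r)), 37 / (2 * q + 3 * r), by positivity, ?_, ?_⟩
  · rw [← sub_eq_zero]
    field_simp
    linear_combination 5476 * hF
  · have hx : x = (p ^ 2 - 4 * q * r) / 4 - 3 := by linear_combination h1 / 4
    have hp' : p = -((q ^ 2 + 4 * r ^ 2) * (2 * q + 3 * r) -
        2 * (q ^ 3 - 4 * q * r ^ 2 + 2 * r ^ 3)) / (2 * r * (2 * q + 3 * r)) := by
      rw [hp, div_eq_div_iff (by positivity) (by positivity)]
      linear_combination -4 * r * hF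
    have hx' : x = p ^ 2 / 4 - q * r +
        3 * (q ^ 3 - 4 * q * r ^ 2 + 2 * r ^ 3) / (2 * (2 * q + 3 * r)) := by
      have h3' : 3 * (q ^ 3 - 4 * q * r ^ 2 + 2 * r ^ 3) / (2 * (2 * q + 3 * r)) = -3 := by
        rw [div_eq_iff (by positivity)]
        linear_combination 3 * hF
      rw [hx, h3']
      ring
    rw [hx', hp']
    clear * - hr hd
    obtain ⟨d, rfl⟩ : ∃ d, q = (d - 3 * r) / 2 := ⟨2 * q + 3 * r, by ring⟩
    rw [show 2 * ((d - 3 * r) / 2) + 3 * r = d by ring] at *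
    field_simp
    ring

theorem second_eq (x Y : ℚ) (h : Y ^ 2 = 4 * x ^ 3 + 4 * x ^ 2 - 92 * x - 199) : x = 8 := by
  obtain ⟨L, hF, hN, ⟨hT⟩⟩ := exists_model
  have step (x Y : ℚ) (h : Y ^ 2 = 4 * x ^ 3 + 4 * x ^ 2 - 92 * x - 199) :
      ∃ x' Y' : ℚ, Y' ^ 2 = 4 * x' ^ 3 + 4 * x' ^ 2 - 92 * x' - 199 ∧
        (x : L) * Y' ^ 2 = x' ^ 4 + 46 * x' ^ 2 + 398 * x' + 728 := by
    obtain ⟨w, hw⟩ := sq_of_second (L := L) h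
    obtain ⟨x', Y', -, h', hxx⟩ := descent_second w hw
    exact ⟨x', Y', h', by exact_mod_cast congrArg (Rat.cast (K := L)) hxx⟩
  have hord_int : ∀ (N : ℕ) (x Y : ℚ), Y ^ 2 = 4 * x ^ 3 + 4 * x ^ 2 - 92 * x - 199 →
      ∀ n : ℤ, OrdEq (vu L) (3 * n) (x : L) → -n ≤ N → OrdGE (vu L) 3 (x : L) := by
    intro N
    induction N using Nat.strong_induction_on with
    | _ N ih =>
    intro x Y h n hn hnN
    rcases order_of_second (L := L) h with ⟨n₁, m₁, hn1, hx, -, -⟩ | ⟨hx, -⟩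
    swap
    · exact hx
    exfalso
    have hn' := hx.unique hn
    obtain ⟨x', Y', h', hL⟩ := step x Y h
    rcases order_of_second (L := L) h' with ⟨n₂, m₂, hn2, hx', hY2, hnm⟩ | ⟨hx', hY2⟩
    · have h1 : OrdEq (vu L) (4 * (3 * n₂)) ((x : L) * Y' ^ 2) := by
        rw [hL, add_assoc, add_assoc]
        refine (hx'.pow 4).add_ge (m := 4 * (3 * n₂) + 1) ?_ (by push_cast; omega)
        exact (((ordGE_ofNat 46).mul (hx'.pow 2).ge).mono (by push_cast; omega)).add
          ((((ordGE_ofNat 398).mul hx'.ge).mono (by omega)).add ((ordGE_ofNat 728).mono (by omega)))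
      have h2 := (hx.mul (hY2.pow 2)).unique h1
      push_cast at h2
      have h3 := ih (N - 2) (by omega) x' Y' h' n₂ hx' (by omega)
      have := hx'.le_of_ge h3
      omega
    · have h1 : OrdGE (vu L) 0 ((x : L) * Y' ^ 2) := by
        rw [hL]
        have hx0 := hx'.mono (by norm_num : (0 : ℤ) ≤ 3)
        refine ((OrdGE.add ?_ ?_).add ?_).add (ordGE_ofNat 728)
        · simpa using hx0.pow 4
        · simpa using (ordGE_ofNat 46).mul (hx0.pow 2)
        · simpa using (ordGE_ofNat 398).mul hx0
      have := (hx.mul (hY2.pow 2)).le_of_ge h1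
      push_cast at this
      omega
  have hord_int' (x Y : ℚ) (h : Y ^ 2 = 4 * x ^ 3 + 4 * x ^ 2 - 92 * x - 199) :
      OrdGE (vu L) 3 (x : L) := by
    by_cases hx : x = 0
    · subst hx; simpa using OrdGE.zero
    obtain ⟨n, hn⟩ := exists_ordEq_ratCast (L := L) hx
    exact hord_int n.natAbs x Y h n hn (by omega)
  have hdiv : ∀ (N : ℕ) (x Y : ℚ), Y ^ 2 = 4 * x ^ 3 + 4 * x ^ 2 - 92 * x - 199 →
      OrdGE (vu L) N ((x : L) - 8) := by
    intro N
    induction N with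
    | zero =>
      intro x Y h
      exact ((hord_int' x Y h).mono (by norm_num)).sub (ordGE_ofNat 8)
    | succ N ih =>
      intro x Y h
      obtain ⟨x', Y', h', hL⟩ := step x Y h
      have hx' := hord_int' x' Y' h'
      have hY' : OrdEq (vu L) 0 (Y' : L) := by
        rcases order_of_second (L := L) h' with ⟨n, m, hn2, hn, -, -⟩ | ⟨-, h⟩
        · have := hn.le_of_ge hx'
          omega
        · exact h
      have hL' : (Y' : L) ^ 2 = 4 * x' ^ 3 + 4 * x' ^ 2 - 92 * x' - 199 := by
        exact_mod_cast congrArg (Rat.cast (K := L)) h'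
      have hY0 := hY'.ne_zero
      have h1 : (x : L) - 8 = (x' - 8) * (x' * (x' ^ 2 - 24 * x' - 178) - 2 * 145) / Y' ^ 2 := by
        field_simp
        linear_combination hL - 8 * hL'
      rw [h1]
      have hx0 := hx'.mono (by norm_num : (0 : ℤ) ≤ 3)
      have h2 : OrdGE (vu L) 0 ((x' : L) ^ 2 - 24 * x' - 178) :=
        ((by simpa using hx0.pow 2 : OrdGE _ _ _).sub (by simpa using (ordGE_ofNat 24).mul hx0)).sub
          (ordGE_ofNat 178)
      have h3 : OrdGE (vu L) 3 ((x' : L) * (x' ^ 2 - 24 * x' - 178) - 2 * 145) :=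
        ((hx'.mul h2).mono (by norm_num)).sub ((ordEq_two.ge.mul (ordGE_ofNat 145)).mono (by norm_num))
      exact (((ih x' Y' h').mul h3).div (hY'.pow 2)).mono (by push_cast; omega)
  by_contra h8
  have h8' : (x : L) - 8 ≠ 0 := by
    intro h0
    apply h8
    have : (x : L) = ((8 : ℚ) : L) := by push_cast; linear_combination h0
    exact_mod_cast this
  obtain ⟨n, hn⟩ := exists_ordEq (vu L) h8'
  have := hn.le_of_ge (hdiv (n.natAbs + 1) x Y h)
  omega

/-- The rational points of `y ^ 2 = -x ^ 6 - 9 * x ^ 4 - 11 * x ^ 2 + 37`. -/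
theorem rat_points {x y : ℚ} (h : y ^ 2 = -x ^ 6 - 9 * x ^ 4 - 11 * x ^ 2 + 37) : x ^ 2 = 1 := by
  have hx : x ≠ 0 := by
    rintro rfl
    have : y ^ 2 = (-1) ^ 0 * 2 ^ 0 * 37 ^ 1 * 1 ^ 2 := by linear_combination h
    have := (parity_of_sq one_ne_zero this).2.2
    omega
  have h1 := second_eq ((37 / x ^ 2 - 5) / 4) (37 * y / (4 * x ^ 3)) (by
    field_simp
    linear_combination 1369 * h)
  field_simp at h1
  linear_combination -h1 / 37

end TotallyRealCubic

namespace TotallyRealCubic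

open Polynomial Module NumberField IsDedekindDomain

variable {L : Type} [Field L] [NumberField L] [TotallyRealCubic L]

omit [TotallyRealCubic L] in
theorem OrdEq.congr {v : HeightOneSpectrum (𝓞 L)} {m n : ℤ} {x y : L} (h : OrdEq v m x)
    (hm : m = n) (hx : y = x) : OrdEq v n y := by
  rwa [hx, ← hm]

omit [TotallyRealCubic L] in
theorem OrdGE.congr {v : HeightOneSpectrum (𝓞 L)} {m n : ℤ} {x y : L} (h : OrdGE v m x)
    (hm : n ≤ m) (hx : y = x) : OrdGE v n y := by
  rw [hx]; exact h.mono hm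

omit [TotallyRealCubic L] in
theorem OrdEq.of_sq {v : HeightOneSpectrum (𝓞 L)} {q : L} {n : ℤ} (h : OrdEq v (2 * n) (q ^ 2)) :
    OrdEq v n q := by
  obtain ⟨k, hk⟩ := exists_ordEq v (x := q) fun h0 => h.ne_zero (by rw [h0]; ring)
  have := (hk.pow 2).unique h
  obtain rfl : k = n := by push_cast at this; omega
  exact hk

theorem ordEq_coords_odd {a : ℤ} (ha : Odd a) (b c : ℤ) :
    OrdEq (vu L) 0 (a + b * u + c * u ^ 2 : L) := by
  have hu := ordEq_vu_u (L := L)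
  rw [add_assoc]
  refine (ordEq_intCast_odd ha).add_ge (m := 1) ?_ one_pos
  exact (((ordGE_intCast b).mul hu.ge).mono (by norm_num)).add
    (((ordGE_intCast c).mul (hu.pow 2).ge).mono (by norm_num))

theorem false_of_sq_eq {q c d : L} {n : ℤ} (hc : OrdEq (vu L) 0 c) (hd : OrdEq (vu L) n d)
    (h : q ^ 2 = c ^ 2 + d) (h0 : 0 < n) (h7 : n < 7) (h2 : n ≠ 2) (h4 : n ≠ 4) : False := by
  have hq : OrdEq (vu L) 0 q := by
    refine OrdEq.of_sq ?_
    rw [h]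
    exact (by simpa using hc.pow 2 : OrdEq (vu L) 0 (c ^ 2)).add_ge hd.ge h0
  rcases ord_sq_sub_sq hq hc (n := n) (by rw [h]; simpa using hd) with h | h | h <;> omega

theorem ordEq_eps₂_sub_one : OrdEq (vu L) 3 ((eps₂ : L) - 1) :=
  (ordEq_two.mul (ordEq_coords_odd (a := -1) (by decide) 1 0)).congr (by norm_num) (by
    rw [eps₂]; push_cast; ring)

theorem ordEq_theta_sub_one : OrdEq (vu L) 3 ((theta : L) - 1) :=
  (ordEq_two.mul (ordEq_coords_odd (a := 1) (by decide) 1 0)).congr (by norm_num) (by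
    rw [theta]; push_cast; ring)

theorem ordEq_rho_sub_one : OrdEq (vu L) 3 ((rho : L) - 1) :=
  (ordEq_two.mul (ordEq_coords_odd (a := -7) (by decide) 1 2)).congr (by norm_num) (by
    rw [rho]; push_cast; ring)

theorem ordEq_theta_mul_eps₂_sub_one : OrdEq (vu L) 6 ((theta * eps₂ : L) - 1) :=
  (ordEq_four.mul (ordEq_coords_odd (a := -1) (by decide) 1 1)).congr (by norm_num) (by
    rw [theta, eps₂]; push_cast; ring)

theorem ordEq_neg_eps₂_mul_rho_sub_one : OrdEq (vu L) 3 ((-eps₂ * rho : L) - 1) :=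
  (ordEq_two.mul (ordEq_coords_odd (a := 1) (by decide) (-2) 0)).congr (by norm_num) (by
    have := u_cube (L := L)
    rw [rho, eps₂]; push_cast
    grind)

theorem false_of_sq_eq_neg_eps₂ {q e : L} (he : OrdGE (vu L) 6 e) (h : q ^ 2 = -eps₂ + e) :
    False := by
  have hu := ordEq_vu_u (L := L)
  refine false_of_sq_eq (q := q) (n := 5) (c := 1 + u ^ 2) (d := e + -3 * 2 * u ^ 2) ?_ ?_ ?_
    (by norm_num) (by norm_num) (by norm_num) (by norm_num)
  · exact (ordEq_coords_odd (L := L) (a := 1) (by decide) 0 1).congr rfl (by push_cast; ring)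
  · refine OrdEq.ge_add ?_ he (by norm_num)
    exact ((ordEq_intCast_odd (L := L) (k := -3) (by decide)).mul ordEq_two |>.mul
      (hu.pow 2)).congr (by norm_num) (by push_cast; ring)
  · rw [h, eps₂]
    linear_combination (-u : L) * u_cube (L := L)

theorem ordEq_unit_of_sq_mul {z q e : L} (hz : OrdEq (vu L) 0 z) (he : OrdGE (vu L) 1 e)
    (h : z = q ^ 2 * (1 + e)) : OrdEq (vu L) 0 q := by
  have h1 : OrdEq (vu L) 0 (1 + e) := OrdEq.one.add_ge he one_pos
  refine OrdEq.of_sq ?_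
  exact (hz.div h1).congr (by norm_num) (by rw [h]; have := h1.ne_zero; field_simp)

/-- The order at `u` of a rational `X` with `X ^ 6 - 9 * X ^ 4 + 11 * X ^ 2 + 37` a square. -/
theorem order_of_third {X y : ℚ} (h : y ^ 2 = X ^ 6 - 9 * X ^ 4 + 11 * X ^ 2 + 37) :
    (∃ n : ℕ, 1 ≤ n ∧ OrdEq (vu L) (-(3 * n)) (X : L)) ∨ OrdEq (vu L) 3 (X : L) := by
  have hX : X ≠ 0 := by
    rintro rfl
    have : y ^ 2 = (-1) ^ 0 * 2 ^ 0 * 37 ^ 1 * 1 ^ 2 := by linear_combination h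
    have := (parity_of_sq one_ne_zero this).2.2
    omega
  have hL : (y : L) ^ 2 = X ^ 6 - 9 * X ^ 4 + 11 * X ^ 2 + 37 := by
    exact_mod_cast congrArg (Rat.cast (K := L)) h
  obtain ⟨n, hn⟩ := exists_ordEq_ratCast (L := L) hX
  rcases lt_or_ge n 0 with h0 | h0
  · exact Or.inl ⟨n.natAbs, by omega, hn.congr (by omega) rfl⟩
  rcases eq_or_ne n 1 with rfl | h1
  · exact Or.inr hn
  exfalso
  have h4 := ordEq_four (L := L)
  rcases eq_or_ne n 0 with rfl | h2
  · have ht := ratCast_sq_sub_one (hn.congr (by norm_num) rfl)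
    have h40 : OrdEq (vu L) 9 (2 ^ 3 * 5 : L) :=
      ((ordEq_two.pow 3).mul (ordEq_intCast_odd (k := 5) (by decide))).congr (by norm_num)
        (by push_cast; ring)
    have h5 : OrdEq (vu L) 9 ((y : L) ^ 2) := by
      refine ((h40.add_ge (m := 10) ?_ (by norm_num))).congr rfl
        (y := (y : L) ^ 2) (x := 2 ^ 3 * 5 + (((X : L) ^ 2 - 1) ^ 3 - 6 * ((X : L) ^ 2 - 1) ^ 2 -
          4 * ((X : L) ^ 2 - 1))) ?_
      · refine (OrdGE.sub ?_ ?_).sub ?_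
        · exact (ht.pow 3).mono (by norm_num)
        · exact ((ordGE_ofNat 6).mul (ht.pow 2)).mono (by norm_num)
        · exact (h4.ge.mul ht).mono (by norm_num)
      · rw [hL]; ring
    have hy0 : y ≠ 0 := by rintro rfl; exact h5.ne_zero (by simp)
    obtain ⟨m, hm⟩ := exists_ordEq_ratCast (L := L) hy0
    have := (hm.pow 2).unique h5
    push_cast at this
    omega
  · have hX2 : OrdGE (vu L) 12 ((X : L) ^ 2) := (hn.pow 2).ge_of_le (by push_cast; omega)
    have hX0 : OrdGE (vu L) 0 (X : L) := hn.ge_of_le (by omega)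
    have h5 : OrdEq (vu L) 6 ((y : L) ^ 2 - 1) := by
      have h6 : OrdEq (vu L) 6 (4 * 9 : L) :=
        (h4.mul (ordEq_intCast_odd (k := 9) (by decide))).congr (by norm_num) (by push_cast; ring)
      have h7 : OrdGE (vu L) 12 ((X : L) ^ 2 * (X ^ 4 - 9 * X ^ 2 + 11)) := by
        refine (hX2.mul (m := 0) ?_).mono (by norm_num)
        exact ((hX0.pow 4).congr (by norm_num) rfl).sub (((ordGE_ofNat 9).mul (hX0.pow 2)).congr
          (by norm_num) rfl) |>.add (ordGE_ofNat 11)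
      refine (h6.add_ge h7 (by norm_num)).congr rfl ?_
      rw [hL]; ring
    have hy : OrdEq (vu L) 0 (y : L) := by
      refine OrdEq.of_sq ((OrdEq.one.add_ge h5.ge (by norm_num)).congr rfl (by ring))
    have := h5.le_of_ge (ratCast_sq_sub_one hy)
    omega

theorem norm_sub_theta (X : ℚ) :
    Algebra.norm ℚ ((X : L) ^ 2 - theta) = X ^ 6 - 9 * X ^ 4 + 11 * X ^ 2 + 37 := by
  have := norm_coords (L := L) (X ^ 2 - 3) (-2) 0
  rw [show (((X ^ 2 - 3 : ℚ) : L) + ((-2 : ℚ) : L) * u + ((0 : ℚ) : L) * u ^ 2) = X ^ 2 - theta by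
    rw [theta]; push_cast; ring] at this
  rw [this]
  ring

theorem sub_theta_mul (X : ℚ) : ((X : L) ^ 2 - theta) * (X ^ 4 + (2 * u - 6) * X ^ 2 +
    rho ^ 2 * (1 - 2 * u)) = ((X ^ 6 - 9 * X ^ 4 + 11 * X ^ 2 + 37 : ℚ) : L) := by
  have := u_cube (L := L)
  rw [theta, rho]
  push_cast
  grind

theorem class_of_third {X y : ℚ} (h : y ^ 2 = X ^ 6 - 9 * X ^ 4 + 11 * X ^ 2 + 37) :
    ∃ w : L, w ≠ 0 ∧ ((X : L) ^ 2 - theta = w ^ 2 ∨ (X : L) ^ 2 - theta = -eps₂ * w ^ 2) := by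
  have hL : (y : L) ^ 2 = X ^ 6 - 9 * X ^ 4 + 11 * X ^ 2 + 37 := by
    exact_mod_cast congrArg (Rat.cast (K := L)) h
  set z : L := (X : L) ^ 2 - theta with hzdef
  have hz0 : z ≠ 0 := by
    intro h0
    have h1 := coords_eq_zero (L := L) (a := X ^ 2 - 3) (b := -2) (c := 0) (by
      rw [hzdef, theta] at h0; push_cast; linear_combination h0)
    exact absurd h1.2.1 (by norm_num)
  have hnorm : Algebra.norm ℚ z = y ^ 2 := by rw [norm_sub_theta, h]
  have hcubic : z * (z ^ 2 + ((0 : ℤ) + (6 : ℤ) * u + (0 : ℤ) * u ^ 2) * z + 2 ^ 2 * u ^ 2 * rho) =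
      y ^ 2 := by
    have := u_cube (L := L)
    rw [hL, hzdef, theta, rho]
    push_cast
    grind
  have hev : ∀ v, v ≠ vu L → v ≠ vrho L → ∀ n, OrdEq v n z → Even n := by
    intro v h1 h2 n hn
    refine hn.even_of_cubic (ordGE_coords v _ _ _) ?_ hcubic
    simpa using (((ordEq_two_of_ne h1).pow 2).mul ((ordEq_u h1).pow 2)).mul (ordEq_rho h2)
  obtain ⟨a, b, c, i, j, k, ha, hb, hc, hi, hj, hk, w, hw, hzw⟩ :=
    exists_class z hz0 fun v h1 h2 _ => hev v h1 h2
  have hk0 : k % 2 = 0 := by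
    obtain ⟨l, hl⟩ := exists_ordEq (vtheta L) hz0
    have h1 := parity_theta hw hzw hl
    have h2 := hev _ prime_two_norms.2.1.symm prime_two_norms.2.2.symm l hl
    rw [Int.even_iff] at h2
    omega
  have hN := norm_rep hzw
  rw [hnorm] at hN
  obtain ⟨p1, p2, p3⟩ := parity_of_sq (by simpa using hw) hN
  have hσ3 : 0 < σ₃ z := by
    have a1 := σ₃_lt (L := L)
    rw [hzdef, theta]
    simp only [map_sub, map_add, map_mul, map_pow, map_ofNat, map_ratCast]
    nlinarith [sq_nonneg (X : ℝ)]
  have e1 := (σ₃_rep_pos hw hzw).1 hσ3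
  obtain rfl : i = 0 := by omega
  obtain rfl : k = 0 := by omega
  obtain rfl : j = 0 := by omega
  obtain rfl : b = 0 := by omega
  refine ⟨w, hw, ?_⟩
  rw [hzw, rep]
  interval_cases a <;> interval_cases c <;> first | omega | simp

/-- The two cases to which the rational points with `y ^ 2 = X ^ 6 - 9 * X ^ 4 + 11 * X ^ 2 + 37`
give rise over `L`. -/
theorem third_cases {X y : ℚ} (h : y ^ 2 = X ^ 6 - 9 * X ^ 4 + 11 * X ^ 2 + 37) :
    (∃ (n : ℕ) (Y : L), 1 ≤ n ∧ OrdEq (vu L) (-(3 * n)) (X : L) ∧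
      (X : L) ^ 4 + (2 * u - 6) * X ^ 2 + rho ^ 2 * (1 - 2 * u) = Y ^ 2) ∨
    (∃ Y : L, OrdEq (vu L) 3 (X : L) ∧
      -eps₂ * ((X : L) ^ 4 + (2 * u - 6) * X ^ 2 + rho ^ 2 * (1 - 2 * u)) = Y ^ 2) := by
  obtain ⟨w, hw, hz⟩ := class_of_third (L := L) h
  have hm := sub_theta_mul (L := L) X
  rw [← h] at hm
  push_cast at hm
  have he := eps₂_ne_zero (L := L)
  rcases order_of_third (L := L) h with ⟨n, hn, hX⟩ | hX <;> rcases hz with hz | hz <;>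
    rw [hz] at hm
  · exact Or.inl ⟨n, y / w, hn, hX, by field_simp; linear_combination hm⟩
  · exfalso
    have hX0 := hX.ne_zero
    have h1 : OrdGE (vu L) 6 (theta / (X : L) ^ 2) :=
      ((ordEq_coords_odd (L := L) (a := 3) (by decide) 2 0).ge.div (hX.pow 2)).congr
        (by push_cast; omega) (by rw [theta]; push_cast; ring)
    have hw2 : -eps₂ = (X / w : L) ^ 2 * (1 + -(theta / (X : L) ^ 2)) := by
      field_simp; linear_combination -hz
    have hq := ordEq_unit_of_sq_mul (ordEq_eps₂.neg) (h1.neg.mono (by norm_num)) hw2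
    refine false_of_sq_eq_neg_eps₂ (q := X / w) (((hq.pow 2).ge.mul h1).congr
      (by norm_num) rfl) ?_
    rw [hw2]; ring
  · exfalso
    have h1 := ((hX.div ordEq_two).congr (by norm_num) rfl : OrdEq (vu L) 0 ((X : L) / 2))
    have h2 := ratCast_sq_sub_one (L := L) (r := X / 2) (h1.congr rfl (by push_cast; rfl))
    refine false_of_sq_eq_neg_eps₂ (q := w)
      ((ordEq_four.ge.mul h2).mono (by norm_num : (6 : ℤ) ≤ 6 + 9)) ?_
    rw [← hz, theta, eps₂]
    push_cast
    ring
  · exact Or.inr ⟨y / w, hX, by field_simp; linear_combination hm⟩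

end TotallyRealCubic

namespace TotallyRealCubic

open Polynomial Module NumberField IsDedekindDomain

variable {L : Type} [Field L] [NumberField L] [TotallyRealCubic L]

omit [NumberField L] [TotallyRealCubic L] in
theorem pos_of_cubic_of_disc {σ : L →+* ℝ} {z A B y : L} (h : z * (z ^ 2 + A * z + B) = y ^ 2)
    (hz : z ≠ 0) (hAB : σ A ^ 2 < 4 * σ B) : 0 < σ z := by
  have h1 := congrArg σ h
  simp only [map_mul, map_add, map_pow] at h1
  have h2 : σ z ≠ 0 := (map_ne_zero σ).2 hz
  by_contra h3
  have h4 : σ z < 0 := lt_of_le_of_ne (not_lt.1 h3) h2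
  have h5 : 0 < σ z ^ 2 + σ A * σ z + σ B := by nlinarith [sq_nonneg (2 * σ z + σ A)]
  nlinarith [mul_neg_of_neg_of_pos h4 h5, sq_nonneg (σ y)]

/-- If `g` and `Y` have almost the same square, then `g` is close to `Y` or to `-Y`. -/
theorem exists_sign {g Y D : L} {m k : ℤ} (hg : OrdEq (vu L) m g) (h : g ^ 2 - Y ^ 2 = D)
    (hD : OrdGE (vu L) k D) (hk : 7 ≤ k - 2 * m) :
    ∃ Y' : L, Y' ^ 2 = Y ^ 2 ∧ OrdGE (vu L) (k - 2 * m - 3) (Y' / g - 1) := by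
  have hg0 := hg.ne_zero
  have h1 : OrdGE (vu L) (k - 2 * m) ((Y / g - 1) * (Y / g + 1)) := by
    refine (hD.neg.div (hg.pow 2)).congr (by push_cast; omega) ?_
    field_simp
    linear_combination -h
  have key (r : L) (hr : OrdGE (vu L) (k - 2 * m) ((r - 1) * (r + 1)))
      (hr4 : OrdGE (vu L) 4 (r - 1)) : OrdGE (vu L) (k - 2 * m - 3) (r - 1) := by
    have h2 : OrdEq (vu L) 3 (r + 1) :=
      (ordEq_two.add_ge hr4 (by norm_num)).congr rfl (by ring)
    refine (hr.div h2).congr le_rfl ?_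
    rw [mul_div_cancel_right₀ _ h2.ne_zero]
  by_cases h2 : OrdGE (vu L) 4 (Y / g - 1)
  · exact ⟨Y, rfl, key _ h1 h2⟩
  by_cases h3 : OrdGE (vu L) 4 (Y / g + 1)
  · refine ⟨-Y, by ring, key _ (h1.congr le_rfl (by ring)) (h3.neg.congr le_rfl (by ring))⟩
  exfalso
  obtain ⟨l, hl⟩ := exists_ordEq (vu L) (x := Y / g - 1) fun h0 => h2 (h0 ▸ OrdGE.zero)
  obtain ⟨l', hl'⟩ := exists_ordEq (vu L) (x := Y / g + 1) fun h0 => h3 (h0 ▸ OrdGE.zero)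
  have h4 := (hl.mul hl').le_of_ge h1
  have h5 : l < 4 := not_le.1 fun h => h2 (hl.ge_of_le h)
  have h6 : l' < 4 := not_le.1 fun h => h3 (hl'.ge_of_le h)
  omega

theorem u_sq_mul_theta : (u ^ 2 * theta : L) = eps₂ * (16 - 3 * u ^ 2) := by
  have := u_cube (L := L)
  rw [theta, eps₂]
  grind

theorem ordEq_disc (v : HeightOneSpectrum (𝓞 L)) {m l : ℤ} (hu : OrdEq v m (u : L))
    (ht : OrdEq v l (theta : L)) : OrdEq v (2 * m + l) (16 - 3 * u ^ 2 : L) := by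
  refine (((hu.pow 2).mul ht).div ordEq_eps₂).congr (by push_cast; ring) ?_
  rw [u_sq_mul_theta, mul_div_cancel_left₀ _ eps₂_ne_zero]

theorem false_of_eq_mul_sq {q e z : L} {n m : ℤ} (hq : z = q ^ 2 * (1 + e))
    (hz : OrdEq (vu L) n (z - 1)) (he : OrdGE (vu L) m e) (hnm : n < m) (h0 : 0 < n) (h7 : n < 7)
    (h2 : n ≠ 2) (h4 : n ≠ 4) : False := by
  have hz1 : OrdEq (vu L) 0 z := (OrdEq.one.add_ge hz.ge h0).congr rfl (by ring)
  have hq0 := ordEq_unit_of_sq_mul hz1 (he.mono (by omega)) hq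
  refine false_of_sq_eq (q := q) OrdEq.one
    (hz.add_ge (((hq0.pow 2).ge.mul he).neg) (by push_cast; omega)) ?_ h0 h7 h2 h4
  rw [hq]; ring

theorem exists_first_root {X Y : L} {n : ℕ} (hn : 1 ≤ n) (hX : OrdEq (vu L) (-(3 * n)) X)
    (h : X ^ 4 + (2 * u - 6) * X ^ 2 + rho ^ 2 * (1 - 2 * u) = Y ^ 2) :
    ∃ Z : L, Z ^ 4 + 4 * (16 - 3 * u ^ 2) = (4 * X ^ 2 + 2 * (2 * u - 6)) * Z ^ 2 ∧
      (2 ≤ n → OrdEq (vu L) (3 - 3 * n) Z) ∧ (n = 1 → OrdEq (vu L) 4 Z) := by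
  have hu := ordEq_vu_u (L := L)
  have hX0 := hX.ne_zero
  have hd := ordEq_disc (vu L) hu (ordEq_theta prime_two_norms.2.1)
  have ha : OrdEq (vu L) (6 * n) ((u - 3 : L) / X ^ 2) :=
    ((ordEq_coords_odd (L := L) (a := -3) (by decide) 1 0).div (hX.pow 2)).congr
      (by push_cast; ring) (by push_cast; ring)
  have hg : OrdEq (vu L) (-(6 * n)) (X ^ 2 + (u - 3)) :=
    ((hX.pow 2).mul (OrdEq.one.add_ge ha.ge (by omega))).congr (by push_cast; ring)
      (by field_simp)
  have hg0 := hg.ne_zero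
  obtain ⟨Y', hY', hr⟩ := exists_sign hg (Y := Y) (D := 16 - 3 * u ^ 2)
    (by have := u_cube (L := L); rw [← h, rho]; grind) hd.ge (by omega)
  have he1 : OrdGE (vu L) 7 ((Y' / (X ^ 2 + (u - 3)) - 1) / 2) :=
    (hr.div ordEq_two).mono (by omega)
  set a : L := (u - 3) / X ^ 2 with hadef
  set e₁ : L := (Y' / (X ^ 2 + (u - 3)) - 1) / 2 with he1def
  have hzX : 2 * (X ^ 2 + (u - 3) + Y') = (2 * X) ^ 2 * (1 + (a + (e₁ + a * e₁))) := by
    rw [hadef, he1def]; field_simp; ring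
  have hae : OrdGE (vu L) 7 (e₁ + a * e₁) :=
    he1.add ((ha.ge.mul he1).mono (by omega))
  set z : L := 2 * (X ^ 2 + (u - 3) + Y') with hzdef
  have hzord : OrdEq (vu L) (6 - 6 * n) z := by
    rw [hzX]
    exact (((ordEq_two.mul hX).pow 2).mul (OrdEq.one.add_ge
      ((ha.ge_of_le (by omega)).add (hae.mono (by norm_num)) : OrdGE (vu L) 6 _)
      (by norm_num))).congr (by push_cast; ring) rfl
  have hz0 := hzord.ne_zero
  have hquad : z ^ 2 + 4 * (16 - 3 * u ^ 2) = (4 * X ^ 2 + 2 * (2 * u - 6)) * z := by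
    have := u_cube (L := L)
    rw [← h, rho] at hY'
    rw [hzdef]
    grind
  have hcubic : z * (z ^ 2 + ((12 : ℤ) + (-4 : ℤ) * u + (0 : ℤ) * u ^ 2) * z +
      2 ^ 2 * (16 - 3 * u ^ 2)) = (2 * X * z) ^ 2 := by
    push_cast
    linear_combination z * hquad
  have hev : ∀ v, v ≠ vu L → v ≠ vtheta L → ∀ n, OrdEq v n z → Even n := by
    intro v h1 h2 n hn
    refine hn.even_of_cubic (ordGE_coords v _ _ _) ?_ hcubic
    exact (((ordEq_two_of_ne h1).pow 2).mul (ordEq_disc v (ordEq_u h1) (ordEq_theta h2))).congr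
      (by norm_num) rfl
  obtain ⟨p, b, c, i, j, k, hp, hb, hc, hi, hj, hk, w, hw, hzw⟩ :=
    exists_class z hz0 fun v h1 _ h3 => hev v h1 h3
  have hj0 : j % 2 = 0 := by
    obtain ⟨l, hl⟩ := exists_ordEq (vrho L) hz0
    have h1 := parity_rho hw hzw hl
    have h2 := hev _ prime_two_norms.1.symm prime_two_norms.2.2 l hl
    rw [Int.even_iff] at h2
    omega
  have hi0 := parity_u hw hzw hzord
  have hσ1 : 0 < σ₁ z := by
    refine pos_of_cubic_of_disc hcubic hz0 ?_
    have a1 := σ₁_gt (L := L)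
    have a2 := σ₁_lt (L := L)
    simp only [map_add, map_sub, map_mul, map_pow, map_intCast, map_ofNat]
    push_cast
    nlinarith
  have hσ2 : 0 < σ₂ z := by
    refine pos_of_cubic_of_disc hcubic hz0 ?_
    have a1 := σ₂_gt (L := L)
    have a2 := σ₂_lt (L := L)
    simp only [map_add, map_sub, map_mul, map_pow, map_intCast, map_ofNat]
    push_cast
    nlinarith
  have e1 := (σ₁_rep_pos hw hzw).1 hσ1
  have e2 := (σ₂_rep_pos hw hzw).1 hσ2
  obtain rfl : i = 0 := by omega
  obtain rfl : j = 0 := by omega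
  obtain rfl : p = 0 := by omega
  obtain rfl : b = 0 := by omega
  have hq : eps₂ ^ c * theta ^ k = (2 * X / w) ^ 2 * (1 + (a + (e₁ + a * e₁))) := by
    have : rep 0 0 c 0 0 k = z / w ^ 2 := by rw [hzw]; field_simp
    rw [rep] at this
    rw [show (2 * X / w) ^ 2 * (1 + (a + (e₁ + a * e₁))) = z / w ^ 2 by rw [hzX]; field_simp,
      ← this]
    ring
  have he6 : OrdGE (vu L) 6 (a + (e₁ + a * e₁)) :=
    (ha.ge_of_le (by omega)).add (hae.mono (by norm_num))
  rw [rep] at hzw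
  interval_cases c <;> interval_cases k
  · have hn2 : 2 ≤ n := by
      by_contra hn2
      obtain rfl : n = 1 := by omega
      have he : OrdEq (vu L) 6 (a + (e₁ + a * e₁)) :=
        (ha.add_ge hae (by norm_num)).congr (by norm_num) rfl
      have hw0 := ordEq_unit_of_sq_mul OrdEq.one (he6.mono (by norm_num)) (by simpa using hq)
      exact false_of_sq_eq (q := 2 * X / w) OrdEq.one ((hw0.pow 2).mul he).neg
        (by linear_combination -hq) (by norm_num) (by norm_num) (by norm_num) (by norm_num)
    have hzw' : w ^ 2 = z := by rw [hzw]; ring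
    refine ⟨w, ?_, fun _ => OrdEq.of_sq (hzord.congr (by ring) hzw'), fun _ => by omega⟩
    linear_combination hquad + (w ^ 2 + z - (4 * X ^ 2 + 2 * (2 * u - 6))) * hzw'
  · exact (false_of_eq_mul_sq hq (ordEq_theta_sub_one.congr rfl (by ring)) he6 (by norm_num)
      (by norm_num) (by norm_num) (by norm_num) (by norm_num)).elim
  · exact (false_of_eq_mul_sq hq (ordEq_eps₂_sub_one.congr rfl (by ring)) he6 (by norm_num)
      (by norm_num) (by norm_num) (by norm_num) (by norm_num)).elim
  · have hn1 : n = 1 := by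
      by_contra hn1
      exact false_of_eq_mul_sq hq (ordEq_theta_mul_eps₂_sub_one.congr rfl (by ring))
        ((ha.ge_of_le (by omega)).add hae : OrdGE (vu L) 7 _) (by norm_num)
        (by norm_num) (by norm_num) (by norm_num) (by norm_num)
    have he := eps₂_ne_zero (L := L)
    have ht := theta_ne_zero (L := L)
    have hw0 : OrdEq (vu L) 0 w := by
      refine OrdEq.of_sq ((hzord.div (ordEq_eps₂.mul (ordEq_theta prime_two_norms.2.1))).congr
        (by subst hn1; norm_num) ?_)
      rw [hzw]; field_simp
    have hZ : (2 * u / (eps₂ * w)) ^ 2 * z = 4 * (16 - 3 * u ^ 2) := by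
      rw [hzw]; field_simp
      linear_combination 4 * u_sq_mul_theta (L := L)
    refine ⟨2 * u / (eps₂ * w), ?_, fun _ => by omega, fun _ =>
      ((ordEq_two.mul hu).div (ordEq_eps₂.mul hw0)).congr (by norm_num) rfl⟩
    set Z := 2 * u / (eps₂ * w)
    apply mul_right_cancel₀ (pow_ne_zero 2 hz0)
    linear_combination (Z ^ 2 * z) * hquad + (Z ^ 2 * z - z ^ 2) * hZ

end TotallyRealCubic

namespace TotallyRealCubic

open Polynomial Module NumberField IsDedekindDomain

variable {L : Type} [Field L] [NumberField L] [TotallyRealCubic L]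

theorem exists_class_dual {x y e Z : L}
    (hx : x ^ 2 + rho ^ 2 * (1 - 2 * u) = (Z ^ 2 - (2 * u - 6)) * x) (hy : y ≠ 0)
    (he : OrdGE (vu L) 2 e) (hxy : x = y ^ 2 * (1 + e)) :
    ∃ a j : ℕ, a < 2 ∧ j < 2 ∧ ∃ w : L, w ≠ 0 ∧ x = (-eps₂) ^ a * rho ^ j * w ^ 2 := by
  have h0 : x ≠ 0 := by
    rw [hxy]
    exact mul_ne_zero (pow_ne_zero 2 hy) (OrdEq.one.add_ge he (by norm_num)).ne_zero
  have hcubic : x * (x ^ 2 + ((-6 : ℤ) + (2 : ℤ) * u + (0 : ℤ) * u ^ 2) * x +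
      rho ^ 2 * (-eps₂)) = (Z * x) ^ 2 := by
    rw [eps₂]
    push_cast
    linear_combination x * hx
  have hev : ∀ v, v ≠ vrho L → ∀ n, OrdEq v n x → Even n := by
    intro v h1 n hn
    exact hn.even_of_cubic (ordGE_coords v _ _ _)
      ((((ordEq_rho h1).pow 2).mul ordEq_eps₂.neg).congr (by norm_num) rfl) hcubic
  obtain ⟨a, b, c, i, j, k, ha, hb, hc, hi, hj, hk, w, hw, hxw⟩ :=
    exists_class x h0 fun v _ h2 _ => hev v h2
  have hi0 : i % 2 = 0 := by
    obtain ⟨l, hl⟩ := exists_ordEq (vu L) h0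
    have h1 := parity_u hw hxw hl
    have h2 := hev _ prime_two_norms.1 l hl
    rw [Int.even_iff] at h2
    omega
  have hk0 : k % 2 = 0 := by
    obtain ⟨l, hl⟩ := exists_ordEq (vtheta L) h0
    have h1 := parity_theta hw hxw hl
    have h2 := hev _ prime_two_norms.2.2.symm l hl
    rw [Int.even_iff] at h2
    omega
  have hσ3 : 0 < σ₃ x := by
    obtain ⟨-, ⟨-, -, q3⟩, -, ⟨-, -, s3⟩, -⟩ := σ_signs (L := L)
    have a1 := σ₃_lt (L := L)
    refine pos_of_cubic hcubic h0 ?_ ?_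
    · simp only [map_add, map_mul, map_pow, map_intCast]
      push_cast
      nlinarith
    · simp only [map_mul, map_pow, map_neg]
      exact mul_pos (pow_pos s3 2) (neg_pos.2 q3)
  have e3 := (σ₃_rep_pos hw hxw).1 hσ3
  obtain rfl : i = 0 := by omega
  obtain rfl : k = 0 := by omega
  obtain rfl := eq_zero_of_cong hb hw hxw hy he hxy
  obtain rfl : c = a := by omega
  refine ⟨c, j, ha, hj, w, hw, ?_⟩
  rw [hxw, rep, neg_eq_neg_one_mul, mul_pow]
  ring

theorem ordEq_alpha : OrdEq (vu L) 3 (2 * u - 6 : L) :=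
  (ordEq_two.mul (ordEq_coords_odd (L := L) (a := -3) (by decide) 1 0)).congr (by norm_num)
    (by push_cast; ring)

theorem rho_sq_mul : (rho ^ 2 * (1 - 2 * u) : L) = (u - 3) ^ 2 - (16 - 3 * u ^ 2) := by
  have := u_cube (L := L)
  rw [rho]
  grind

theorem descent_third {X Z : L} {n : ℕ} (hn : 2 ≤ n)
    (hZ : OrdEq (vu L) (3 - 3 * n) Z)
    (h : Z ^ 4 + 4 * (16 - 3 * u ^ 2) = (4 * X ^ 2 + 2 * (2 * u - 6)) * Z ^ 2) :
    ∃ X' Y' : L, OrdEq (vu L) (3 - 3 * n) X' ∧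
      X' ^ 4 + (2 * u - 6) * X' ^ 2 + rho ^ 2 * (1 - 2 * u) = Y' ^ 2 := by
  have hZ0 := hZ.ne_zero
  have ha : OrdGE (vu L) 7 ((2 * u - 6 : L) / Z ^ 2) :=
    (ordEq_alpha.div (hZ.pow 2)).ge_of_le (by push_cast; omega)
  set a : L := (2 * u - 6) / Z ^ 2 with hadef
  set g : L := (Z ^ 2 - (2 * u - 6)) / 2 with hgdef
  have hga : g = Z ^ 2 * (1 - a) / 2 := by rw [hadef, hgdef]; field_simp
  have hg : OrdEq (vu L) (3 - 6 * n) g := by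
    rw [hga]
    exact (((hZ.pow 2).mul (OrdEq.one.sub_ge ha (by norm_num))).div ordEq_two).congr
      (by push_cast; ring) rfl
  have hg0 := hg.ne_zero
  have hbeta : OrdGE (vu L) 0 (rho ^ 2 * (1 - 2 * u) : L) := by
    refine (((ordEq_rho prime_two_norms.1).pow 2).mul ordEq_eps₂.neg).ge.congr (by norm_num) ?_
    rw [eps₂]; ring
  obtain ⟨Y', hY', hr⟩ := exists_sign hg (Y := X * Z) (D := rho ^ 2 * (1 - 2 * u))
    (by rw [hgdef, rho_sq_mul]; linear_combination h / 4) hbeta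
    (by omega)
  have he : OrdGE (vu L) 7 ((Y' / g - 1) / 2) := (hr.div ordEq_two).mono (by omega)
  set e : L := (Y' / g - 1) / 2 with hedef
  have hxZ : g + Y' = Z ^ 2 * (1 + (-a + (e - a * e))) := by
    have h1 : g + Y' = 2 * g * (1 + e) := by rw [hedef]; field_simp; ring
    rw [h1, hga]; ring
  have hae : OrdGE (vu L) 7 (-a + (e - a * e)) :=
    ha.neg.add (he.sub ((ha.mul he).mono (by norm_num)))
  have hx : (g + Y') ^ 2 + rho ^ 2 * (1 - 2 * u) = (Z ^ 2 - (2 * u - 6)) * (g + Y') := by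
    rw [hgdef, rho_sq_mul]
    linear_combination hY' - h / 4
  obtain ⟨p, j, hp, hj, w, hw, hxw⟩ := exists_class_dual hx hZ0 (hae.mono (by norm_num)) hxZ
  have hq : (-eps₂) ^ p * rho ^ j = (Z / w) ^ 2 * (1 + (-a + (e - a * e))) := by
    rw [div_pow, div_mul_eq_mul_div, ← hxZ, hxw]
    field_simp
  interval_cases p <;> interval_cases j
  · have hw2 : w ^ 2 = g + Y' := by rw [hxw]; ring
    refine ⟨w, w * Z, ?_, ?_⟩
    · refine OrdEq.of_sq (((hZ.pow 2).mul (OrdEq.one.add_ge hae (by norm_num))).congr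
        (by push_cast; ring) (by rw [hw2, hxZ]))
    · linear_combination hx + (w ^ 2 + g + Y' + (2 * u - 6) - Z ^ 2) * hw2
  · exact (false_of_eq_mul_sq hq (ordEq_rho_sub_one.congr rfl (by ring)) hae (by norm_num)
      (by norm_num) (by norm_num) (by norm_num) (by norm_num)).elim
  · exfalso
    have hw0 := ordEq_unit_of_sq_mul (ordEq_eps₂.neg.congr rfl (by ring)) (hae.mono (by norm_num)) hq
    refine false_of_sq_eq_neg_eps₂ (q := Z / w) (((hw0.pow 2).ge.mul hae).neg.mono (by norm_num)) ?_
    linear_combination -hq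
  · exact (false_of_eq_mul_sq hq (ordEq_neg_eps₂_mul_rho_sub_one.congr rfl (by ring)) hae
      (by norm_num) (by norm_num) (by norm_num) (by norm_num) (by norm_num)).elim

theorem dvd_of_ordGE_rho {k : ℤ} (h : OrdGE (vrho L) 1 (k : L)) : (37 : ℤ) ∣ k := by
  by_contra hk
  have h1 : IsCoprime (37 : ℤ) k := by
    rw [(by norm_num : Prime (37 : ℤ)).coprime_iff_not_dvd]; exact hk
  obtain ⟨a, b, hab⟩ := h1
  have h37 : OrdGE (vrho L) 1 (37 : L) := by
    refine (ordEq_vrho_rho.ge.mul (ordGE_coords (vrho L) (-9) 6 8)).congr (by norm_num) ?_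
    have := u_cube (L := L)
    rw [rho]; push_cast; grind
  have h2 : OrdGE (vrho L) 1 (1 : L) := by
    have h3 := ((ordGE_intCast a).mul h37).congr (n := 1) (by norm_num) rfl |>.add
      (((ordGE_intCast b).mul h).congr (n := 1) (by norm_num) rfl)
    have h4 : (a * 37 + b * k : L) = 1 := by exact_mod_cast congrArg (Int.cast (R := L)) hab
    rwa [h4] at h3
  have := OrdEq.one.le_of_ge h2
  omega

/-- The residue of `2 * u - 6` at `rho` is not a square. -/
theorem false_of_sq_sub {Z : L} (h : OrdGE (vrho L) 1 (Z ^ 2 - (2 * u - 6))) : False := by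
  have ha : OrdGE (vrho L) 1 (2 * u - 6 - 14 : L) := by
    refine (ordEq_vrho_rho.ge.mul (ordGE_coords (vrho L) 4 (-2) (-4))).congr (by norm_num) ?_
    have := u_cube (L := L)
    rw [rho]; push_cast; grind
  have h14 : OrdGE (vrho L) 1 (Z ^ 2 - 14) := (h.add ha).congr le_rfl (by ring)
  have hZ : OrdGE (vrho L) 0 Z := by
    rcases eq_or_ne Z 0 with rfl | hZ0
    · exact OrdGE.zero
    obtain ⟨l, hl⟩ := exists_ordEq (vrho L) hZ0
    have h1 : OrdGE (vrho L) 0 (Z ^ 2) :=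
      ((h14.mono (by norm_num)).add (ordGE_ofNat 14)).congr le_rfl (by ring)
    have := (hl.pow 2).le_of_ge h1
    exact hl.ge_of_le (by push_cast at this; omega)
  obtain ⟨m, hm, hZm⟩ := residue_rho hZ
  have h2 : OrdGE (vrho L) 1 (((m ^ 2 - 14 : ℤ)) : L) := by
    refine (h14.sub ((hZm.mul (hZ.add (ordGE_natCast m))).congr (n := 1) (by norm_num) rfl)).congr
      le_rfl ?_
    push_cast; ring
  have h3 := dvd_of_ordGE_rho h2
  clear * - hm h3
  interval_cases m <;> revert h3 <;> decide

theorem no_third_of_order {X Z : L} (hX : OrdEq (vu L) (-3) X) (hZ : OrdEq (vu L) 4 Z)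
    (h : Z ^ 4 + 4 * (16 - 3 * u ^ 2) = (4 * X ^ 2 + 2 * (2 * u - 6)) * Z ^ 2) : False := by
  have hu := ordEq_vu_u (L := L)
  have hu0 := u_ne_zero (L := L)
  have he0 := eps₂_ne_zero (L := L)
  set k : L := X * Z / u with hk
  have hkuZ : X * Z = u * k := by rw [hk]; field_simp
  have hk0 : OrdEq (vu L) 0 k := ((hX.mul hZ).div hu).congr (by norm_num) rfl
  have hksq : OrdGE (vu L) 6 ((k - 1) * (k + 1)) := by
    have h1 : OrdGE (vu L) 6 ((4 / eps₂ : L) + (Z ^ 4 / 4 - Z ^ 2 * (u - 3)) / u ^ 2) := by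
      refine ((ordEq_four.div ordEq_eps₂).ge_of_le (by norm_num)).add ?_
      refine (OrdGE.div (k := 8) (OrdGE.sub ?_ ?_) (hu.pow 2)).mono (by norm_num)
      · exact ((hZ.pow 4).div ordEq_four).ge_of_le (by norm_num)
      · exact ((hZ.pow 2).ge.mul (ordGE_coords (vu L) (-3) 1 0)).congr (by norm_num)
          (by push_cast; ring)
    refine h1.congr le_rfl ?_
    have h2 : (k - 1) * (k + 1) = (X * Z) ^ 2 / u ^ 2 - 1 := by rw [hkuZ]; field_simp; ring
    have h3 : (theta : L) = eps₂ + 4 := by rw [theta, eps₂]; ring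
    have h4 := u_sq_mul_theta (L := L)
    rw [h2]
    field_simp
    rw [h3] at h4
    linear_combination -eps₂ * h - 4 * h4
  have hk3 : OrdGE (vu L) 3 (k - 1) := by
    by_contra hk3
    obtain ⟨l, hl⟩ := exists_ordEq (vu L) (x := k - 1) fun h0 => hk3 (h0 ▸ OrdGE.zero)
    have h1 : l < 3 := not_le.1 fun h => hk3 (hl.ge_of_le h)
    have h2 := (hl.mul ((hl.add_ge ordEq_two.ge h1).congr rfl
      (by ring : k + 1 = k - 1 + 2))).le_of_ge hksq
    omega
  have hd : OrdEq (vu L) 3 (2 + (Z ^ 2 / 2 + u * (k - 1))) := by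
    refine ordEq_two.add_ge (m := 4) (OrdGE.add ?_ ?_) (by norm_num)
    · exact ((hZ.pow 2).div ordEq_two).ge_of_le (by norm_num)
    · exact (hu.ge.mul hk3).mono (by norm_num)
  set d : L := 2 + (Z ^ 2 / 2 + u * (k - 1)) with hddef
  have hx : (1 + d) ^ 2 + rho ^ 2 * (1 - 2 * u) = (Z ^ 2 - (2 * u - 6)) * (1 + d) := by
    have h1 : 1 + d = Z ^ 2 / 2 - (u - 3) + X * Z := by rw [hddef, hkuZ]; ring
    rw [h1, rho_sq_mul]
    linear_combination -h / 4
  have hx0 : OrdEq (vu L) 0 (1 + d) := OrdEq.one.add_ge hd.ge (by norm_num)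
  obtain ⟨p, j, hp, hj, w, hw, hxw⟩ :=
    exists_class_dual hx one_ne_zero (hd.ge_of_le (by norm_num)) (by ring)
  interval_cases j
  · have hw0 : OrdEq (vu L) 0 w := by
      refine OrdEq.of_sq ((hx0.div (ordEq_eps₂.neg.pow p)).congr (by simp) ?_)
      rw [hxw, pow_zero, mul_one, mul_div_cancel_left₀ _ (pow_ne_zero p (neg_ne_zero.2 he0))]
    interval_cases p
    · exact false_of_sq_eq (q := w) OrdEq.one hd (by linear_combination -hxw) (by norm_num)
        (by norm_num) (by norm_num) (by norm_num)
    · refine false_of_sq_eq (q := w) (d := d + 2 * u * w ^ 2) OrdEq.one (hd.add_ge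
        ((ordEq_two.mul hu).mul (hw0.pow 2)).ge (by norm_num)) ?_ (by norm_num)
        (by norm_num) (by norm_num) (by norm_num)
      rw [eps₂] at hxw
      linear_combination -hxw
  · obtain ⟨l, hl⟩ := exists_ordEq (vrho L) hw
    have hc := (ordEq_eps₂ (L := L) (v := vrho L)).neg.pow p
    set c : L := (-eps₂) ^ p with hcdef
    have hc0 := hc.ne_zero
    have hr0 := rho_ne_zero (L := L)
    have hZa : Z ^ 2 - (2 * u - 6) = rho * (c * w ^ 2) + rho * (-eps₂ / (c * w ^ 2)) := by
      have h1 := hx0.ne_zero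
      apply mul_right_cancel₀ h1
      rw [← hx, hxw, eps₂]
      field_simp
      ring
    have o1 : OrdEq (vrho L) (1 + 2 * l) (rho * (c * w ^ 2) : L) :=
      (ordEq_vrho_rho.mul (hc.mul (hl.pow 2))).congr (by push_cast; ring) rfl
    have o2 : OrdEq (vrho L) (1 - 2 * l) (rho * (-eps₂ / (c * w ^ 2)) : L) :=
      (ordEq_vrho_rho.mul (ordEq_eps₂.neg.div (hc.mul (hl.pow 2)))).congr (by push_cast; ring) rfl
    have hα : OrdGE (vrho L) 0 (2 * u - 6 : L) :=
      (ordGE_coords (vrho L) (-6) 2 0).congr le_rfl (by push_cast; ring)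
    have hodd (m : ℤ) (hm : m < 0) (h2 : ¬ Even m)
        (h1 : OrdEq (vrho L) m (Z ^ 2 - (2 * u - 6))) : False := by
      have h3 : OrdEq (vrho L) m (Z ^ 2) := (h1.add_ge hα hm).congr rfl (by ring)
      obtain ⟨r, hr⟩ := exists_ordEq (vrho L) (x := Z) hZ.ne_zero
      exact h2 ⟨r, by have := (hr.pow 2).unique h3; push_cast at this; omega⟩
    rcases lt_trichotomy l 0 with h0 | rfl | h0
    · refine hodd (1 + 2 * l) (by omega) (by rw [Int.even_iff]; omega) ?_
      rw [hZa]; exact o1.add_ge o2.ge (by omega)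
    · refine false_of_sq_sub (Z := Z) ?_
      rw [hZa]; exact (o1.ge.mono (by norm_num)).add (o2.ge.mono (by norm_num))
    · refine hodd (1 - 2 * l) (by omega) (by rw [Int.even_iff]; omega) ?_
      rw [hZa]; exact o2.ge_add o1.ge (by omega)

theorem no_third_of_neg (n : ℕ) : ∀ X Y : L, OrdEq (vu L) (-(3 * (n + 1))) X →
    X ^ 4 + (2 * u - 6) * X ^ 2 + rho ^ 2 * (1 - 2 * u) ≠ Y ^ 2 := by
  induction n with
  | zero =>
    intro X Y hX h
    obtain ⟨Z, hZ, -, h1⟩ := exists_first_root (n := 1) le_rfl (hX.congr (by norm_num) rfl) h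
    exact no_third_of_order (hX.congr (by norm_num) rfl) (h1 rfl) hZ
  | succ n ih =>
    intro X Y hX h
    have hX' := hX.congr (n := -(3 * ((n + 2 : ℕ) : ℤ))) (by push_cast; ring) rfl
    obtain ⟨Z, hZ, h2, -⟩ := exists_first_root (n := n + 2) (by omega) hX' h
    obtain ⟨X', Y', h3, h4⟩ := descent_third (by omega) (h2 (by omega)) hZ
    exact ih X' Y' (h3.congr (by push_cast; ring) rfl) h4

end TotallyRealCubic

namespace TotallyRealCubic

open Polynomial Module NumberField IsDedekindDomain

variable {L : Type} [Field L] [NumberField L] [TotallyRealCubic L]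

/-- The coefficient of `x ^ 2` in the elliptic curve covered by the third sextic twist. -/
def coeffA : L := 74 - 10 * u - 20 * u ^ 2

/-- The coefficient of `x` in the elliptic curve covered by the third sextic twist. -/
def coeffB : L := -1751 + 254 * u + 472 * u ^ 2

theorem eps₂_mul_coeffA : (eps₂ * coeffA : L) = 6 - 2 * u := by
  have := u_cube (L := L)
  rw [eps₂, coeffA]
  grind

theorem eps₂_mul_coeffB : (eps₂ * coeffB : L) = -rho ^ 2 := by
  have := u_cube (L := L)
  rw [eps₂, coeffB, rho]
  grind

theorem eps₂_sq_mul_disc : (eps₂ ^ 2 * (coeffA ^ 2 - 4 * coeffB) : L) = 4 * (16 - 3 * u ^ 2) := by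
  have := u_cube (L := L)
  rw [show (eps₂ ^ 2 * (coeffA ^ 2 - 4 * coeffB) : L) =
    (eps₂ * coeffA) ^ 2 - 4 * eps₂ * (eps₂ * coeffB) by ring, eps₂_mul_coeffA, eps₂_mul_coeffB,
    eps₂, rho]
  grind

theorem ordEq_coeffA : OrdEq (vu L) 3 (coeffA : L) :=
  (ordEq_two.mul (ordEq_coords_odd (L := L) (a := 37) (by decide) (-5) (-10))).congr (by norm_num)
    (by rw [coeffA]; push_cast; ring)

theorem ordGE_coeffA (v : HeightOneSpectrum (𝓞 L)) : OrdGE v 0 (coeffA : L) :=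
  (ordGE_coords v 74 (-10) (-20)).congr le_rfl (by rw [coeffA]; push_cast; ring)

theorem ordEq_coeffB {v : HeightOneSpectrum (𝓞 L)} (h : v ≠ vrho L) :
    OrdEq v 0 (coeffB : L) :=
  ((((ordEq_rho h).pow 2).neg).div ordEq_eps₂).congr (by norm_num)
    (by rw [← eps₂_mul_coeffB, mul_div_cancel_left₀ _ eps₂_ne_zero])

theorem ordEq_coeffB_sub_one : OrdEq (vu L) 4 (coeffB - 1 : L) := by
  have h1 := (ordEq_two.mul (ordEq_vu_u (L := L))).mul
    (ordEq_coords_odd (L := L) (a := 127) (by decide) 236 0)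
  have h2 := (ordEq_four (L := L).ge.mul (ordGE_intCast (v := vu L) (-438)))
  refine (h1.add_ge h2 (by norm_num)).congr (by norm_num) ?_
  rw [coeffB]
  push_cast
  ring

theorem ordEq_vu_coeffB : OrdEq (vu L) 0 (coeffB : L) := ordEq_coeffB prime_two_norms.1

theorem ordGE_two_add_coeffA : OrdGE (vu L) 4 (2 + coeffA : L) :=
  ordGE_add_of_eq ordEq_two ordEq_coeffA

theorem quadratic_ne_zero (x : L) : x ^ 2 + coeffA * x + coeffB ≠ 0 := by
  intro h
  have hne := prime_two_norms (L := L)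
  have h1 : (eps₂ * (2 * x + coeffA)) ^ 2 = 4 * (16 - 3 * u ^ 2) := by
    rw [← eps₂_sq_mul_disc]
    linear_combination 4 * eps₂ ^ 2 * h
  have h2 := ((ordEq_two_of_ne hne.2.1.symm).pow 2).mul
    (ordEq_disc (vtheta L) (ordEq_u hne.2.1.symm) ordEq_vtheta_theta)
  have h3 := h2.congr (n := 1) (y := (eps₂ * (2 * x + coeffA)) ^ 2) (by norm_num)
    (by rw [h1]; ring)
  obtain ⟨m, hm⟩ := exists_ordEq (vtheta L) (x := eps₂ * (2 * x + coeffA)) fun h0 =>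
    h3.ne_zero (by rw [h0]; ring)
  have := (hm.pow 2).unique h3
  push_cast at this
  omega

theorem exists_local_root {x y : L} (hx : x ≠ 0)
    (h : y ^ 2 = x * (x ^ 2 + coeffA * x + coeffB)) :
    ∃ q e : L, q ≠ 0 ∧ OrdGE (vu L) 2 e ∧ x = q ^ 2 * (1 + e) := by
  have hA := ordEq_coeffA (L := L)
  have hB := ordEq_vu_coeffB (L := L)
  have hy : y ≠ 0 := by
    rintro rfl
    exact mul_ne_zero hx (quadratic_ne_zero x) (by rw [← h]; ring)
  obtain ⟨q, e, hq, he, hqe⟩ : ∃ q e : L, q ≠ 0 ∧ OrdGE (vu L) 2 e ∧ q ^ 2 = x * (1 + e) := by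
    obtain ⟨n, hn⟩ := exists_ordEq (vu L) hx
    rcases lt_trichotomy n 0 with h0 | rfl | h0
    · refine ⟨y / x, coeffA / x + coeffB / x ^ 2, div_ne_zero hy hx,
        ((hA.div hn).ge_of_le (by omega)).add
          ((hB.div (hn.pow 2)).ge_of_le (by push_cast; omega)), ?_⟩
      field_simp
      rw [h]
      ring
    · obtain h1 | h1 := Classical.em (OrdGE (vu L) 2 (x - 1))
      · refine ⟨x, x - 1, hx, h1, by ring⟩
      · have h2 := (sub_one_of_unit hn).eq_of_not h1
        have h3 := h2.ne_zero
        refine ⟨y / (x - 1), (x * (2 + coeffA) + (coeffB - 1)) / (x - 1) ^ 2, div_ne_zero hy h3,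
          ((((hn.ge.mul ordGE_two_add_coeffA).mono (by norm_num)).add
            ordEq_coeffB_sub_one.ge).div (h2.pow 2)).mono (by norm_num), ?_⟩
        field_simp
        rw [h]
        ring
    · refine ⟨y, (coeffB - 1) + (x ^ 2 + coeffA * x), hy,
        (ordEq_coeffB_sub_one.ge_of_le (by norm_num)).add
          (((hn.pow 2).ge_of_le (by push_cast; omega)).add
            ((hA.mul hn).ge_of_le (by omega))), ?_⟩
      rw [h]
      ring
  have h1 := OrdEq.one.add_ge he (by norm_num)
  refine ⟨q / (1 + e), e, div_ne_zero hq h1.ne_zero, he, ?_⟩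
  have := h1.ne_zero
  field_simp
  rw [hqe]

theorem class_of_point {x y : L} (hx : x ≠ 0)
    (h : y ^ 2 = x * (x ^ 2 + coeffA * x + coeffB)) :
    ∃ a j : ℕ, a < 2 ∧ j < 2 ∧ ∃ w : L, w ≠ 0 ∧ x = (-eps₂) ^ a * rho ^ j * w ^ 2 := by
  obtain ⟨q, e, hq, he, hxq⟩ := exists_local_root hx h
  have hev : ∀ v, v ≠ vrho L → ∀ n, OrdEq v n x → Even n := fun v h1 n hn =>
    hn.even_of_cubic (ordGE_coeffA v) (ordEq_coeffB h1) h.symm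
  obtain ⟨a, b, c, i, j, k, ha, hb, hc, hi, hj, hk, w, hw, hxw⟩ :=
    exists_class x hx fun v _ h2 _ => hev v h2
  have hi0 : i % 2 = 0 := by
    obtain ⟨l, hl⟩ := exists_ordEq (vu L) hx
    have h1 := parity_u hw hxw hl
    have h2 := hev _ prime_two_norms.1 l hl
    rw [Int.even_iff] at h2
    omega
  have hk0 : k % 2 = 0 := by
    obtain ⟨l, hl⟩ := exists_ordEq (vtheta L) hx
    have h1 := parity_theta hw hxw hl
    have h2 := hev _ prime_two_norms.2.2.symm l hl
    rw [Int.even_iff] at h2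
    omega
  have hσ3 : 0 < σ₃ x := by
    have a1 := σ₃_lt (L := L)
    have a2 := σ₃_gt (L := L)
    refine pos_of_cubic h.symm hx ?_ ?_
    · rw [coeffA]
      simp only [map_sub, map_mul, map_pow, map_ofNat]
      nlinarith
    · obtain ⟨-, ⟨-, -, q3⟩, -, ⟨-, -, s3⟩, -⟩ := σ_signs (L := L)
      have h1 := congrArg σ₃ (eps₂_mul_coeffB (L := L))
      simp only [map_mul, map_neg, map_pow] at h1
      have h2 := pow_pos s3 2
      exact pos_of_mul_neg_right (by rw [h1]; linarith) q3.le
  have e3 := (σ₃_rep_pos hw hxw).1 hσ3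
  obtain rfl : i = 0 := by omega
  obtain rfl : k = 0 := by omega
  obtain rfl := eq_zero_of_cong hb hw hxw hq he hxq
  obtain rfl : c = a := by omega
  refine ⟨c, j, ha, hj, w, hw, ?_⟩
  rw [hxw, rep, neg_eq_neg_one_mul, mul_pow]
  ring

/-- A unit abscissa is congruent to `1` modulo `u ^ 2`. -/
theorem sub_one_of_point {x y : L} (hx : OrdEq (vu L) 0 x)
    (h : y ^ 2 = x * (x ^ 2 + coeffA * x + coeffB)) : OrdGE (vu L) 2 (x - 1) := by
  obtain ⟨q, e, -, he, hxq⟩ := exists_local_root hx.ne_zero h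
  have h1 := ordEq_unit_of_sq_mul hx (he.mono (by norm_num)) hxq
  rw [hxq]
  exact mul_sub_one (by norm_num) (sq_sub_one h1) (he.congr le_rfl (by ring))

end TotallyRealCubic

namespace TotallyRealCubic

open Polynomial Module NumberField IsDedekindDomain

variable {L : Type} [Field L] [NumberField L] [TotallyRealCubic L] {w n : L}

theorem resolvent_mul (h : n ^ 2 = w ^ 4 + coeffA * w ^ 2 + coeffB) :
    (2 * w ^ 2 + coeffA + 2 * n) * (2 * w ^ 2 + coeffA - 2 * n) =
      (2 * u / eps₂) ^ 2 * (theta / eps₂) := by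
  have h0 := eps₂_ne_zero (L := L)
  have h1 : (2 * w ^ 2 + coeffA + 2 * n) * (2 * w ^ 2 + coeffA - 2 * n) =
      coeffA ^ 2 - 4 * coeffB := by linear_combination -4 * h
  rw [h1]
  field_simp
  have h2 := eps₂_sq_mul_disc (L := L)
  have h3 := u_sq_mul_theta (L := L)
  linear_combination eps₂ * h2 - 4 * h3

theorem resolvent_cubic (h : n ^ 2 = w ^ 4 + coeffA * w ^ 2 + coeffB) {x : L}
    (hx : x = 2 * w ^ 2 + coeffA + 2 * n) :
    x * (x ^ 2 + (-2 * coeffA) * x + (2 * u / eps₂) ^ 2 * (theta / eps₂)) = (2 * w * x) ^ 2 := by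
  rw [← resolvent_mul h, hx]
  ring

theorem resolvent_ne_zero (h : n ^ 2 = w ^ 4 + coeffA * w ^ 2 + coeffB) :
    2 * w ^ 2 + coeffA + 2 * n ≠ 0 := by
  intro h0
  have h1 := resolvent_mul h
  rw [h0, zero_mul] at h1
  refine mul_ne_zero (pow_ne_zero 2 (div_ne_zero (mul_ne_zero two_ne_zero u_ne_zero)
    eps₂_ne_zero)) (div_ne_zero theta_ne_zero eps₂_ne_zero) h1.symm

theorem ordEq_dual_coeff : OrdEq (vu L) 8 ((2 * u / eps₂) ^ 2 * (theta / eps₂) : L) :=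
  ((((ordEq_two.mul ordEq_vu_u).div ordEq_eps₂).pow 2).mul
    ((ordEq_theta prime_two_norms.2.1).div ordEq_eps₂)).congr (by norm_num) rfl

theorem resolvent_even (h : n ^ 2 = w ^ 4 + coeffA * w ^ 2 + coeffB) {m : ℤ}
    (hm : OrdEq (vu L) m (2 * w ^ 2 + coeffA + 2 * n)) (hw : w ≠ 0) : Even m := by
  have hB := ordEq_dual_coeff (L := L)
  have hA := (ordEq_two.mul (ordEq_coeffA (L := L))).neg.congr (y := -2 * coeffA) rfl (by ring)
  have hc := resolvent_cubic h rfl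
  set x : L := 2 * w ^ 2 + coeffA + 2 * n
  obtain ⟨r, hr⟩ := exists_ordEq (vu L)
    (mul_ne_zero (mul_ne_zero two_ne_zero hw) hm.ne_zero)
  have hr2 := hr.pow 2
  by_contra hodd
  rw [Int.not_even_iff] at hodd
  have h1 : OrdEq (vu L) (2 * m) (x ^ 2 + (-2 * coeffA) * x + (2 * u / eps₂) ^ 2 * (theta / eps₂)) ∨
      OrdEq (vu L) 8 (x ^ 2 + (-2 * coeffA) * x + (2 * u / eps₂) ^ 2 * (theta / eps₂)) := by
    rcases le_or_gt m 3 with h2 | h2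
    · left
      exact (((hm.pow 2).add_ge (hA.mul hm).ge (by push_cast; omega)).add_ge hB.ge
        (by push_cast; omega)).congr (by push_cast; ring) rfl
    · right
      exact hB.ge_add (((hm.pow 2).ge_of_le (m := 9) (by push_cast; omega)).add
        ((hA.mul hm).ge_of_le (by omega))) (by norm_num)
  rcases h1 with h1 | h1
  · have h3 := hm.mul h1
    rw [hc] at h3
    have := h3.unique hr2
    push_cast at this
    omega
  · have h3 := hm.mul h1
    rw [hc] at h3
    have := h3.unique hr2
    push_cast at this
    omega

theorem class_of_resolvent (hw : w ≠ 0) (h : n ^ 2 = w ^ 4 + coeffA * w ^ 2 + coeffB) :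
    ∃ c k : ℕ, c < 2 ∧ k < 2 ∧ ∃ z : L, z ≠ 0 ∧
      2 * w ^ 2 + coeffA + 2 * n = eps₂ ^ c * theta ^ k * z ^ 2 := by
  have hc := resolvent_cubic h rfl
  have hx := resolvent_ne_zero h
  have heven : ∀ m, OrdEq (vu L) m (2 * w ^ 2 + coeffA + 2 * n) → Even m :=
    fun m hm => resolvent_even h hm hw
  set x : L := 2 * w ^ 2 + coeffA + 2 * n
  have hev : ∀ v, v ≠ vu L → v ≠ vtheta L → ∀ n, OrdEq v n x → Even n := by
    intro v h1 h2 n hn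
    refine hn.even_of_cubic
      (((ordGE_intCast (-2)).mul (ordGE_coeffA v)).congr le_rfl (by push_cast; ring)) ?_ hc
    exact (((((ordEq_two_of_ne h1).mul (ordEq_u h1)).div ordEq_eps₂).pow 2).mul
      ((ordEq_theta h2).div ordEq_eps₂)).congr (by norm_num) rfl
  obtain ⟨p, b, c, i, j, k, hp, hb, hc', hi, hj, hk, z, hz, hxz⟩ :=
    exists_class x hx fun v h1 _ h3 => hev v h1 h3
  have hj0 : j % 2 = 0 := by
    obtain ⟨l, hl⟩ := exists_ordEq (vrho L) hx
    have h1 := parity_rho hz hxz hl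
    have h2 := hev _ prime_two_norms.1.symm prime_two_norms.2.2 l hl
    rw [Int.even_iff] at h2
    omega
  have hi0 : i % 2 = 0 := by
    obtain ⟨l, hl⟩ := exists_ordEq (vu L) hx
    have h1 := parity_u hz hxz hl
    have h2 := heven l hl
    rw [Int.even_iff] at h2
    omega
  have hpos (σ : L →+* ℝ) (h1 : 0 < σ (eps₂ : L)) : 0 < σ x := by
    refine pos_of_cubic_of_disc hc hx ?_
    have hB : σ (coeffB : L) < 0 := by
      have h2 := congrArg σ (eps₂_mul_coeffB (L := L))
      simp only [map_mul, map_neg, map_pow] at h2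
      have h3 : 0 < σ (rho : L) ^ 2 := by
        have := (map_ne_zero σ).2 (rho_ne_zero (L := L)); positivity
      exact neg_of_mul_neg_right (by rw [h2]; linarith) h1.le
    have hD : (2 * u / eps₂) ^ 2 * (theta / eps₂) = (coeffA ^ 2 - 4 * coeffB : L) := by
      rw [← resolvent_mul h]; linear_combination -4 * h
    rw [hD]
    simp only [map_sub, map_mul, map_pow, map_neg, map_ofNat]
    linarith
  have e1 := (σ₁_rep_pos hz hxz).1 (hpos _ σ_signs.2.1.1)
  have e2 := (σ₂_rep_pos hz hxz).1 (hpos _ σ_signs.2.1.2.1)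
  obtain rfl : i = 0 := by omega
  obtain rfl : j = 0 := by omega
  obtain rfl : p = 0 := by omega
  obtain rfl : b = 0 := by omega
  exact ⟨c, k, hc', hk, z, hz, by rw [hxz, rep]; ring⟩

theorem eps₂_sq_sub_one : OrdGE (vu L) 6 (eps₂ ^ 2 - 1 : L) :=
  (ordEq_eps₂_sub_one.ge.mul (ordEq_eps₂_sub_one.ge.add ordEq_two.ge)).congr (by norm_num) (by ring)

/-- The contribution of a unit `k` to the difference `h ^ 2 - coeffB` is negligible. -/
theorem ordGE_halving_error {k p : L} (hk : OrdEq (vu L) 0 k)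
    (hp : p = eps₂ ^ 2 * k ^ 2 - (4 * u ^ 2 + 2 * u - 15)) :
    OrdGE (vu L) 8 (u * p * (6 * (4 * u ^ 2 + 2 * u - 15) + u * p)) := by
  have hu := ordEq_vu_u (L := L)
  have h2 := ordEq_two (L := L)
  have h4 := ordEq_four (L := L)
  have i1 : OrdGE (vu L) 4 (1 - (4 * u ^ 2 + 2 * u - 15) : L) :=
    ((h4.ge.mul (ordGE_coords (vu L) 4 0 (-1))).mono (by norm_num)).sub
      (h2.mul hu).ge |>.congr (by norm_num) (by push_cast; ring)
  have i2 : OrdGE (vu L) 6 (6 * (4 * u ^ 2 + 2 * u - 15) + u ^ 3 : L) :=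
    (h4.ge.mul (ordGE_coords (vu L) (-23) 4 6)).congr (by norm_num)
      (by have := u_cube (L := L); push_cast; linear_combination this)
  have i3 := eps₂_sq_sub_one.mul (hk.pow 2).ge
  have ht := sub_one_of_unit hk
  by_cases h : OrdGE (vu L) 2 (k - 1)
  · have hp4 : OrdGE (vu L) 4 p := by
      have j1 : OrdGE (vu L) 4 ((k - 1) * ((k - 1) + 2)) :=
        (h.mul (h.add (h2.ge_of_le (by norm_num)))).mono (by norm_num)
      exact ((j1.add (i3.mono (by norm_num))).add i1).congr le_rfl (by rw [hp]; ring)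
    have h6 : OrdGE (vu L) 3 (6 * (4 * u ^ 2 + 2 * u - 15) + u * p) :=
      ((i2.mono (by norm_num)).add (((hu.ge.mul hp4).mono (by norm_num)).sub
        (hu.pow 3).ge)).congr (by norm_num) (by ring)
    exact ((hu.ge.mul hp4).mul h6).mono (by norm_num)
  · have h1 := ht.eq_of_not h
    have j1 : OrdGE (vu L) 4 ((k - 1) ^ 2 - u ^ 2) := by
      have := (sq_sub_one ((h1.div hu).congr (by norm_num) rfl)).mul (hu.pow 2).ge
      refine this.congr (by norm_num) ?_
      have := u_ne_zero (L := L)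
      field_simp
    have hp4 : OrdGE (vu L) 4 (p - u ^ 2) :=
      (((j1.add ((h2.mul h1).ge_of_le (by norm_num))).add (i3.mono (by norm_num))).add
        i1).congr le_rfl (by rw [hp]; ring)
    have hp2 : OrdGE (vu L) 2 p :=
      ((hp4.mono (by norm_num)).add (hu.pow 2).ge).congr (by norm_num) (by ring)
    have h6 : OrdGE (vu L) 5 (6 * (4 * u ^ 2 + 2 * u - 15) + u * p) :=
      ((i2.mono (by norm_num)).add ((hu.ge.mul hp4).mono (by norm_num))).congr le_rfl (by ring)
    exact ((hu.ge.mul hp2).mul h6).mono (by norm_num)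

theorem halving_identity (k : L) : eps₂ * (u ^ 2 * k) ^ 2 - coeffA =
    2 * (3 * (4 * u ^ 2 + 2 * u - 15) +
      u * (eps₂ ^ 2 * k ^ 2 - (4 * u ^ 2 + 2 * u - 15))) := by
  rw [coeffA, eps₂]
  linear_combination ((2 * u - 1) * u * k ^ 2 + 8) * u_cube (L := L)

theorem eps₂_mul_nine : (eps₂ * (9 * (4 * u ^ 2 + 2 * u - 15) ^ 2 - coeffB) : L) =
    -72 * u ^ 2 - 38 * u + 272 := by
  have := u_cube (L := L)
  rw [coeffB, eps₂]
  grind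

theorem resolvent_ne_eps₂_mul_sq (h : n ^ 2 = w ^ 4 + coeffA * w ^ 2 + coeffB)
    {z : L} (hz : 2 * w ^ 2 + coeffA + 2 * n = eps₂ * z ^ 2) : False := by
  have hu := ordEq_vu_u (L := L)
  have he := eps₂_ne_zero (L := L)
  have hA := (ordEq_two.mul (ordEq_coeffA (L := L))).neg.congr (y := -2 * coeffA) rfl (by ring)
  have hB := ordEq_dual_coeff (L := L)
  have hcub := resolvent_cubic h rfl
  have hx := resolvent_ne_zero h
  have hz0 : z ≠ 0 := by rintro rfl; exact hx (by rw [hz]; ring)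
  obtain ⟨m, hm⟩ := exists_ordEq (vu L) hz0
  have hxm : OrdEq (vu L) (2 * m) (2 * w ^ 2 + coeffA + 2 * n) :=
    (ordEq_eps₂.mul (hm.pow 2)).congr (by push_cast; ring) hz
  rcases lt_trichotomy m 2 with h2 | rfl | h2
  · set x : L := 2 * w ^ 2 + coeffA + 2 * n
    have e1 : OrdGE (vu L) 4 (-2 * coeffA / x + (2 * u / eps₂) ^ 2 * (theta / eps₂) / x ^ 2) :=
      ((hA.div hxm).ge_of_le (by omega)).add ((hB.div (hxm.pow 2)).ge_of_le (by push_cast; omega))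
    set e : L := -2 * coeffA / x + (2 * u / eps₂) ^ 2 * (theta / eps₂) / x ^ 2 with hedef
    have e0 := (OrdEq.one.add_ge e1 (by norm_num)).ne_zero
    refine false_of_eq_mul_sq (q := 2 * w / (z * (1 + e))) (z := eps₂) (e := e) (m := 4) (n := 3)
      ?_ ordEq_eps₂_sub_one e1 (by norm_num) (by norm_num) (by norm_num) (by norm_num) (by norm_num)
    have h3 : x * (1 + e) = (2 * w) ^ 2 := by
      have : x * x ^ 2 * (1 + e) = (2 * w * x) ^ 2 := by
        rw [← hcub, hedef]; field_simp; ring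
      refine mul_right_cancel₀ (pow_ne_zero 2 hx) ?_
      linear_combination this
    rw [hz] at h3
    field_simp
    linear_combination h3
  · have hk : OrdEq (vu L) 0 (z / u ^ 2) := (hm.div (hu.pow 2)).congr (by norm_num) rfl
    set k : L := z / u ^ 2 with hkdef
    have hu0 := u_ne_zero (L := L)
    have hzk : z = u ^ 2 * k := by rw [hkdef]; field_simp
    have herr := ordGE_halving_error hk rfl
    set p : L := eps₂ ^ 2 * k ^ 2 - (4 * u ^ 2 + 2 * u - 15) with hpdef
    have hh : w ^ 2 + n = 3 * (4 * u ^ 2 + 2 * u - 15) + u * p := by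
      have h3 : 2 * (w ^ 2 + n) = 2 * (3 * (4 * u ^ 2 + 2 * u - 15) + u * p) := by
        have h4 : 2 * (w ^ 2 + n) = eps₂ * z ^ 2 - coeffA := by rw [← hz]; ring
        rw [h4, hzk, hpdef, halving_identity]
      exact mul_left_cancel₀ two_ne_zero h3
    have hsq : (eps₂ * (w * z)) ^ 2 = eps₂ * ((w ^ 2 + n) ^ 2 - coeffB) := by
      have h3 : (w ^ 2 + n) ^ 2 - coeffB = w ^ 2 * (eps₂ * z ^ 2) := by
        rw [← hz]; linear_combination h
      rw [h3]; ring
    have h4 : (eps₂ * (w * z)) ^ 2 = -72 * u ^ 2 - 38 * u + 272 +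
        eps₂ * (u * p * (6 * (4 * u ^ 2 + 2 * u - 15) + u * p)) := by
      rw [hsq, hh]
      linear_combination eps₂_mul_nine (L := L)
    refine false_of_sq_eq (q := eps₂ * (w * z) / u ^ 2) (c := 1) (n := 3)
      (d := (-72 * u ^ 2 - 38 * u + 272 - u ^ 4 +
        eps₂ * (u * p * (6 * (4 * u ^ 2 + 2 * u - 15) + u * p))) / u ^ 4) OrdEq.one ?_ ?_
      (by norm_num) (by norm_num) (by norm_num) (by norm_num)
    · have i1 : OrdEq (vu L) 7 (-72 * u ^ 2 - 38 * u + 272 - u ^ 4 : L) :=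
        (((ordEq_four (L := L)).mul hu).mul
          (ordEq_coords_odd (L := L) (a := -9) (by decide) (-19) 0)).add_ge
          (m := 12) ((((ordEq_four (L := L)).mul ordEq_four).ge.mul
            (ordGE_intCast 17)).mono (by norm_num)) (by norm_num) |>.congr (by norm_num)
            (by have := u_cube (L := L); push_cast; linear_combination (-u) * this)
      exact ((i1.add_ge ((ordEq_eps₂.ge.mul herr).mono (by norm_num : (8 : ℤ) ≤ _))
        (by norm_num)).div (hu.pow 4)).congr (by norm_num) rfl
    · rw [div_pow, h4]
      field_simp
      ring
  · set x : L := 2 * w ^ 2 + coeffA + 2 * n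
    set D : L := (2 * u / eps₂) ^ 2 * (theta / eps₂) with hDdef
    have e1 : OrdGE (vu L) 4 (x ^ 2 / D + -2 * coeffA * x / D) :=
      (((hxm.pow 2).div hB).ge_of_le (by push_cast; omega)).add
        (((hA.mul hxm).div hB).ge_of_le (by omega))
    set e : L := x ^ 2 / D + -2 * coeffA * x / D with hedef
    have hD0 := hB.ne_zero
    have e0 := (OrdEq.one.add_ge e1 (by norm_num)).ne_zero
    have ht0 := theta_ne_zero (L := L)
    have hu0 := u_ne_zero (L := L)
    refine false_of_eq_mul_sq (q := 2 * w * x * eps₂ / (z * (2 * u) * (1 + e))) (z := theta) (e := e)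
      (m := 4) (n := 3) ?_ ordEq_theta_sub_one e1 (by norm_num) (by norm_num) (by norm_num)
      (by norm_num) (by norm_num)
    have h3 : x * D * (1 + e) = (2 * w * x) ^ 2 := by
      rw [← hcub, hedef]; field_simp; ring
    have h5 : theta = x * D * eps₂ ^ 2 / (z * (2 * u)) ^ 2 := by
      rw [hz, hDdef]; field_simp
    rw [div_pow, mul_pow _ eps₂, ← h3, h5]
    field_simp

theorem exists_square_resolvent (hw : w ≠ 0) (h : n ^ 2 = w ^ 4 + coeffA * w ^ 2 + coeffB) :
    ∃ n' Z : L, n' ^ 2 = n ^ 2 ∧ Z ≠ 0 ∧ 2 * w ^ 2 + coeffA + 2 * n' = Z ^ 2 := by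
  obtain ⟨c, k, hc, hk, z, hz, hx⟩ := class_of_resolvent hw h
  have he := eps₂_ne_zero (L := L)
  have ht := theta_ne_zero (L := L)
  have hmul := resolvent_mul h
  rw [hx] at hmul
  interval_cases c <;> interval_cases k
  · exact ⟨n, z, rfl, hz, by rw [hx]; ring⟩
  · refine (resolvent_ne_eps₂_mul_sq (n := -n) (z := 2 * u / (eps₂ ^ 2 * z))
      (by rw [← h]; ring) ?_).elim
    have h1 : (theta * z ^ 2) * (2 * w ^ 2 + coeffA + 2 * -n) =
        (theta * z ^ 2) * (eps₂ * (2 * u / (eps₂ ^ 2 * z)) ^ 2) := by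
      rw [show 2 * w ^ 2 + coeffA + 2 * -n = 2 * w ^ 2 + coeffA - 2 * n by ring]
      rw [show theta * z ^ 2 = eps₂ ^ 0 * theta ^ 1 * z ^ 2 by ring, hmul]
      field_simp
    exact mul_left_cancel₀ (mul_ne_zero ht (pow_ne_zero 2 hz)) h1
  · exact (resolvent_ne_eps₂_mul_sq (z := z) h (by rw [hx]; ring)).elim
  · refine ⟨-n, 2 * u / (eps₂ ^ 2 * z), by ring, div_ne_zero (mul_ne_zero two_ne_zero u_ne_zero)
      (mul_ne_zero (pow_ne_zero 2 he) hz), ?_⟩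
    have h1 : (eps₂ * theta * z ^ 2) * (2 * w ^ 2 + coeffA + 2 * -n) =
        (eps₂ * theta * z ^ 2) * (2 * u / (eps₂ ^ 2 * z)) ^ 2 := by
      rw [show 2 * w ^ 2 + coeffA + 2 * -n = 2 * w ^ 2 + coeffA - 2 * n by ring]
      rw [show eps₂ * theta * z ^ 2 = eps₂ ^ 1 * theta ^ 1 * z ^ 2 by ring, hmul]
      field_simp
    exact mul_left_cancel₀ (mul_ne_zero (mul_ne_zero he ht) (pow_ne_zero 2 hz)) h1

end TotallyRealCubic

namespace TotallyRealCubic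

open Polynomial Module NumberField IsDedekindDomain

variable {L : Type} [Field L] [NumberField L] [TotallyRealCubic L]

variable (L) in
/-- The elliptic curve `y ^ 2 = x * (x ^ 2 + coeffA * x + coeffB)`. -/
def curve : WeierstrassCurve.Affine L := ⟨0, coeffA, 0, coeffB, 0⟩

theorem equation_curve {x y : L} :
    (curve L).Equation x y ↔ y ^ 2 = x * (x ^ 2 + coeffA * x + coeffB) := by
  rw [WeierstrassCurve.Affine.equation_iff]
  simp only [curve]
  constructor <;> intro h <;> linear_combination h

instance : (curve L).IsElliptic where
  isUnit := by
    rw [isUnit_iff_ne_zero]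
    have h : (curve L).Δ = 16 * coeffB ^ 2 * (coeffA ^ 2 - 4 * coeffB) := by
      simp only [curve, WeierstrassCurve.Δ, WeierstrassCurve.b₂, WeierstrassCurve.b₄,
        WeierstrassCurve.b₆, WeierstrassCurve.b₈]
      ring
    rw [h]
    refine mul_ne_zero (mul_ne_zero (by norm_num) (pow_ne_zero 2 ordEq_vu_coeffB.ne_zero)) ?_
    intro h0
    have h1 := eps₂_sq_mul_disc (L := L)
    rw [h0, mul_zero] at h1
    exact mul_ne_zero (by norm_num)
      (ordEq_disc (vu L) ordEq_vu_u (ordEq_theta prime_two_norms.2.1)).ne_zero h1.symm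

variable (L) in
/-- The group of points of `curve L`. -/
def Pt : Type := (curve L).Point

noncomputable instance : AddCommGroup (Pt L) :=
  letI := Classical.decEq L
  inferInstanceAs (AddCommGroup (curve L).Point)

/-- The point `P` has affine coordinates `x` and `y`. -/
def IsPt (P : Pt L) (x y : L) : Prop := ∃ h, P = WeierstrassCurve.Affine.Point.some x y h

variable {P Q : Pt L} {x y x₁ x₂ y₁ y₂ : L}

theorem IsPt.eqn (h : IsPt P x y) : y ^ 2 = x * (x ^ 2 + coeffA * x + coeffB) := by
  obtain ⟨h, -⟩ := h
  exact equation_curve.1 h.1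

theorem exists_isPt (h : y ^ 2 = x * (x ^ 2 + coeffA * x + coeffB)) : ∃ P : Pt L, IsPt P x y :=
  ⟨_, WeierstrassCurve.Affine.equation_iff_nonsingular.1 (equation_curve.2 h), rfl⟩

theorem eq_zero_or_isPt (P : Pt L) : P = 0 ∨ ∃ x y, IsPt P x y := by
  rcases P with _ | ⟨x, y, h⟩
  · exact Or.inl rfl
  · exact Or.inr ⟨x, y, h, rfl⟩

theorem IsPt.ne_zero (h : IsPt P x y) : P ≠ 0 := by
  obtain ⟨h, rfl⟩ := h
  exact WeierstrassCurve.Affine.Point.some_ne_zero h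

theorem IsPt.ext (h₁ : IsPt P x y) (h₂ : IsPt Q x y) : P = Q := by
  obtain ⟨h₁, rfl⟩ := h₁
  obtain ⟨h₂, rfl⟩ := h₂
  rfl

theorem IsPt.inj (h₁ : IsPt P x₁ y₁) (h₂ : IsPt P x₂ y₂) : x₁ = x₂ ∧ y₁ = y₂ := by
  obtain ⟨h₁, rfl⟩ := h₁
  obtain ⟨h₂, h⟩ := h₂
  exact (WeierstrassCurve.Affine.Point.some.injEq ..).mp h

theorem IsPt.congr (h : IsPt P x₁ y₁) (hx : x₁ = x₂) (hy : y₁ = y₂) : IsPt P x₂ y₂ :=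
  hx ▸ hy ▸ h

theorem IsPt.neg (h : IsPt P x y) : IsPt (-P) x (-y) := by
  obtain ⟨h, rfl⟩ := h
  have hY : (curve L).negY x y = -y := by simp [WeierstrassCurve.Affine.negY, curve]
  rw [← hY]
  exact ⟨_, WeierstrassCurve.Affine.Point.neg_some h⟩

theorem IsPt.eq_or_eq_neg (h₁ : IsPt P x y₁) (h₂ : IsPt Q x y₂) : P = Q ∨ P = -Q := by
  have h : (y₁ - y₂) * (y₁ + y₂) = 0 := by linear_combination h₁.eqn - h₂.eqn
  rcases mul_eq_zero.1 h with h | h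
  · exact Or.inl (h₁.ext (h₂.congr rfl (by linear_combination -h)))
  · exact Or.inr (h₁.ext (h₂.neg.congr rfl (by linear_combination -h)))

/-- The chord and tangent construction. -/
theorem IsPt.add (h₁ : IsPt P x₁ y₁) (h₂ : IsPt Q x₂ y₂) (h : x₁ ≠ x₂ ∨ y₁ + y₂ ≠ 0) :
    ∃ l : L, l * (x₁ - x₂) = y₁ - y₂ ∧
      l * (y₁ + y₂) = x₁ ^ 2 + x₁ * x₂ + x₂ ^ 2 + coeffA * (x₁ + x₂) + coeffB ∧
      IsPt (P + Q) (l ^ 2 - coeffA - x₁ - x₂)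
        (l * (x₁ - (l ^ 2 - coeffA - x₁ - x₂)) - y₁) := by
  classical
  have e₁ := h₁.eqn
  have e₂ := h₂.eqn
  obtain ⟨h₁, rfl⟩ := h₁
  obtain ⟨h₂, rfl⟩ := h₂
  have hY (x y : L) : (curve L).negY x y = -y := by
    simp [WeierstrassCurve.Affine.negY, curve]
  have hxy : ¬(x₁ = x₂ ∧ y₁ = (curve L).negY x₂ y₂) := by
    rw [hY]
    rintro ⟨ha, hb⟩
    rcases h with h | h
    · exact h ha
    · exact h (by rw [hb]; ring)
  have hsum := WeierstrassCurve.Affine.Point.add_some hxy (h₁ := h₁) (h₂ := h₂)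
  set l := (curve L).slope x₁ x₂ y₁ y₂ with hl
  have hX : (curve L).addX x₁ x₂ l = l ^ 2 - coeffA - x₁ - x₂ := by
    simp [WeierstrassCurve.Affine.addX, curve]
  refine ⟨l, ?_, ?_, ?_⟩
  · by_cases hx : x₁ = x₂
    · have h3 : (y₁ - y₂) * (y₁ + y₂) = 0 := by rw [hx] at e₁; linear_combination e₁ - e₂
      rcases mul_eq_zero.1 h3 with h4 | h4
      · rw [h4, hx]; ring
      · exact absurd ⟨hx, by rw [hY]; linear_combination h4⟩ hxy
    · rw [hl, WeierstrassCurve.Affine.slope_of_X_ne hx]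
      field_simp [sub_ne_zero.2 hx]
  · by_cases hx : x₁ = x₂
    · have hy : y₁ ≠ (curve L).negY x₂ y₂ := fun h' => hxy ⟨hx, h'⟩
      have h3 : (y₁ - y₂) * (y₁ + y₂) = 0 := by rw [hx] at e₁; linear_combination e₁ - e₂
      have h5 : y₁ + y₂ ≠ 0 := fun h' => hy (by rw [hY]; linear_combination h')
      have h4 := (mul_eq_zero.1 h3).resolve_right h5
      rw [hl, WeierstrassCurve.Affine.slope_of_Y_ne hx hy, hY, ← hx,
        show y₂ = y₁ by linear_combination -h4]
      rw [show y₂ = y₁ by linear_combination -h4] at h5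
      rw [show y₁ - -y₁ = y₁ + y₁ by ring, div_mul_cancel₀ _ h5]
      simp only [curve]
      ring
    · rw [hl, WeierstrassCurve.Affine.slope_of_X_ne hx]
      have h0 := sub_ne_zero.2 hx
      field_simp
      linear_combination e₁ - e₂
  · have hYY : (curve L).addY x₁ x₂ y₁ l = l * (x₁ - (l ^ 2 - coeffA - x₁ - x₂)) - y₁ := by
      rw [WeierstrassCurve.Affine.addY, WeierstrassCurve.Affine.negAddY, hY, hX]
      ring
    rw [← hYY, ← hX]
    exact ⟨_, hsum⟩

theorem IsPt.add_eq_zero (h₁ : IsPt P x y) (h₂ : IsPt Q x (-y)) : P + Q = 0 := by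
  rw [h₂.ext h₁.neg, add_neg_cancel]

variable (L) in
/-- The rational point of order two. -/
noncomputable def torsionPt : Pt L :=
  (exists_isPt (x := (0 : L)) (y := 0) (by ring)).choose

theorem isPt_torsionPt : IsPt (torsionPt L) 0 0 :=
  (exists_isPt (x := (0 : L)) (y := 0) (by ring)).choose_spec

theorem torsionPt_add_self : torsionPt L + torsionPt L = 0 :=
  isPt_torsionPt.add_eq_zero (by simpa using isPt_torsionPt)

theorem IsPt.add_torsionPt (h : IsPt P x y) (hx : x ≠ 0) :
    IsPt (P + torsionPt L) (coeffB / x) (-(coeffB * y / x ^ 2)) := by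
  obtain ⟨l, h1, -, h2⟩ := h.add isPt_torsionPt (Or.inl hx)
  have hl : l = y / x := by field_simp; linear_combination h1
  have e := h.eqn
  have h3 : l ^ 2 - coeffA - x - 0 = coeffB / x := by
    rw [hl]
    field_simp
    rw [e]
    ring
  rw [h3] at h2
  refine h2.congr rfl ?_
  rw [hl]
  field_simp
  ring

theorem IsPt.eq_torsionPt (h : IsPt P 0 y) : P = torsionPt L := by
  have := h.eqn
  rw [zero_mul, sq_eq_zero_iff] at this
  subst this
  exact h.ext isPt_torsionPt

end TotallyRealCubic

namespace TotallyRealCubic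

open Polynomial Module NumberField IsDedekindDomain

variable {L : Type} [Field L] [NumberField L] [TotallyRealCubic L]

variable {P Q : Pt L} {x y x₁ x₂ y₁ y₂ : L}

theorem coeffB_ne_zero : (coeffB : L) ≠ 0 := ordEq_vu_coeffB.ne_zero

theorem IsPt.double (h : IsPt P x y) (hy : y ≠ 0) :
    ∃ y', IsPt (P + P) (((x ^ 2 - coeffB) / (2 * y)) ^ 2) y' := by
  have h2 : y + y ≠ 0 := by simpa [← two_mul] using hy
  obtain ⟨l, -, hl, hs⟩ := h.add h (Or.inr h2)
  refine ⟨_, hs.congr ?_ rfl⟩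
  have hl' : l = (3 * x ^ 2 + 2 * coeffA * x + coeffB) / (2 * y) := by
    field_simp
    linear_combination hl
  have e := h.eqn
  rw [hl', div_pow, div_pow]
  field_simp
  linear_combination (-(coeffA + 2 * x) * 4) * e

theorem IsPt.mul_mul_add (h₁ : IsPt P x₁ y₁) {l : L} (e₁ : l * (x₁ - x₂) = y₁ - y₂)
    (e₂ : l * (y₁ + y₂) = x₁ ^ 2 + x₁ * x₂ + x₂ ^ 2 + coeffA * (x₁ + x₂) + coeffB) :
    x₁ * x₂ * (l ^ 2 - coeffA - x₁ - x₂) = (y₁ - l * x₁) ^ 2 := by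
  linear_combination x₁ * e₂ - h₁.eqn - l * x₁ * e₁

/-- A point whose `x`-coordinate is a nonzero square is divisible by two. -/
theorem IsPt.exists_half {w : L} (h : IsPt P (w ^ 2) y) (hw : w ≠ 0) : ∃ Q, P = Q + Q := by
  have e : (y / w) ^ 2 = w ^ 4 + coeffA * w ^ 2 + coeffB := by
    rw [div_pow, h.eqn]
    field_simp
  obtain ⟨n, Z, hn, hZ, hZn⟩ := exists_square_resolvent hw e
  rw [e] at hn
  have hB := coeffB_ne_zero (L := L)
  set x := w ^ 2 + n + w * Z with hx
  have hq : x ^ 2 + coeffA * x + coeffB = x * Z ^ 2 := by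
    rw [hx]
    linear_combination -hn + (n + w * Z) * hZn
  have hx0 : x ≠ 0 := by
    intro h0
    rw [h0] at hq
    exact hB (by linear_combination hq)
  obtain ⟨Q, hQ⟩ := exists_isPt (x := x) (y := x * Z) (by rw [hq]; ring)
  obtain ⟨y', hd⟩ := hQ.double (mul_ne_zero hx0 hZ)
  have hxx : ((x ^ 2 - coeffB) / (2 * (x * Z))) ^ 2 = w ^ 2 := by
    congr 1
    field_simp
    rw [hx] at hq ⊢
    linear_combination -hq + (w ^ 2 + n + w * Z) * hZn
  rcases h.eq_or_eq_neg (hd.congr hxx rfl) with h' | h'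
  · exact ⟨Q, h'⟩
  · exact ⟨-Q, by rw [h']; abel⟩

theorem rho_eqn : (176 - 26 * u - 48 * u ^ 2 : L) ^ 2 =
    rho * (rho ^ 2 + coeffA * rho + coeffB) := by
  have := u_cube (L := L)
  rw [rho, coeffA, coeffB]
  grind

variable (L) in
/-- A point of infinite order. -/
noncomputable def gen : Pt L := (exists_isPt (rho_eqn (L := L))).choose

theorem isPt_gen : IsPt (gen L) rho (176 - 26 * u - 48 * u ^ 2) :=
  (exists_isPt (rho_eqn (L := L))).choose_spec

theorem IsPt.exists_sub_gen {w : L} (h : IsPt P (rho * w ^ 2) y) (hw : w ≠ 0) :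
    ∃ (k : ℕ) (Q : Pt L), P = gen L + k • torsionPt L + (Q + Q) := by
  by_cases hx : rho * w ^ 2 = rho
  · rcases (h.congr hx rfl).eq_or_eq_neg isPt_gen with h' | h'
    · exact ⟨0, 0, by rw [h']; simp⟩
    · exact ⟨0, -gen L, by rw [h']; simp⟩
  obtain ⟨l, h1, h2, h3⟩ := h.add isPt_gen.neg (Or.inl hx)
  have h4 := h.mul_mul_add h1 h2
  set z := l ^ 2 - coeffA - rho * w ^ 2 - rho
  have hr := rho_ne_zero (L := L)
  by_cases hz : z = 0
  · have h5 := (h3.congr hz rfl).eq_torsionPt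
    exact ⟨1, 0, by rw [one_smul, ← h5]; abel⟩
  · have h5 : z = ((y - l * (rho * w ^ 2)) / (rho * w)) ^ 2 := by
      rw [div_pow, ← h4]
      field_simp
    obtain ⟨Q, hQ⟩ := (h3.congr h5 rfl).exists_half (fun h0 => hz (by rw [h5, h0]; ring))
    exact ⟨0, Q, by rw [← hQ, zero_smul]; abel⟩

/-- The point `gen` and the torsion point generate all points modulo doubles. -/
theorem exists_sub_double (P : Pt L) :
    ∃ (m k : ℕ) (Q : Pt L), m < 2 ∧ P = m • gen L + k • torsionPt L + (Q + Q) := by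
  have key (P : Pt L) {x y : L} (h : IsPt P x y) {j : ℕ} {w : L} (hj : j < 2) (hw : w ≠ 0)
      (hx : x = rho ^ j * w ^ 2) :
      ∃ (m k : ℕ) (Q : Pt L), m < 2 ∧ P = m • gen L + k • torsionPt L + (Q + Q) := by
    interval_cases j
    · obtain ⟨Q, hQ⟩ := (h.congr (hx.trans (by ring)) rfl).exists_half hw
      exact ⟨0, 0, Q, by norm_num, by rw [hQ]; simp⟩
    · obtain ⟨k, Q, hQ⟩ := (h.congr (hx.trans (by ring)) rfl).exists_sub_gen hw
      exact ⟨1, k, Q, by norm_num, by rw [hQ, one_smul]⟩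
  rcases eq_zero_or_isPt P with rfl | ⟨x, y, h⟩
  · exact ⟨0, 0, 0, by norm_num, by simp⟩
  by_cases hx : x = 0
  · subst hx
    exact ⟨0, 1, 0, by norm_num, by rw [h.eq_torsionPt]; simp⟩
  obtain ⟨a, j, ha, hj, w, hw, e⟩ := class_of_point hx h.eqn
  have hr := rho_ne_zero (L := L)
  have he := eps₂_ne_zero (L := L)
  interval_cases a
  · exact key P h hj hw (by rw [e]; ring)
  · have hB : (coeffB : L) = -rho ^ 2 / eps₂ := by
      rw [← eps₂_mul_coeffB]
      field_simp
    obtain ⟨m, k, Q, hm, hQ⟩ := key _ (h.add_torsionPt hx) hj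
      (w := rho / (eps₂ * rho ^ j * w)) (by simp [hr, he, hw]) (by
        rw [e, hB]
        field_simp)
    refine ⟨m, k + 1, Q, hm, ?_⟩
    have h2 := torsionPt_add_self (L := L)
    have : P = (P + torsionPt L) + torsionPt L := by rw [add_assoc, h2, add_zero]
    rw [this, hQ, add_smul, one_smul]
    abel

theorem exists_sub_two_pow (N : ℕ) (P : Pt L) :
    ∃ (m k : ℕ) (Q : Pt L), P = m • gen L + k • torsionPt L + 2 ^ N • Q := by
  induction N generalizing P with
  | zero => exact ⟨0, 0, P, by simp⟩
  | succ N ih =>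
    obtain ⟨m, k, Q, -, hQ⟩ := exists_sub_double P
    obtain ⟨m', k', Q', hQ'⟩ := ih Q
    have h2 := torsionPt_add_self (L := L)
    refine ⟨m + 2 * m', k, Q', ?_⟩
    have h3 : k' • torsionPt L + k' • torsionPt L = 0 := by rw [← smul_add, h2, smul_zero]
    rw [hQ, hQ', pow_succ, mul_comm, mul_smul, add_smul, mul_smul, two_smul, two_smul]
    calc _ = m • gen L + (m' • gen L + m' • gen L) + k • torsionPt L +
          (2 ^ N • Q' + 2 ^ N • Q') + (k' • torsionPt L + k' • torsionPt L) := by abel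
      _ = _ := by rw [h3, add_zero, smul_add, smul_add]

end TotallyRealCubic

namespace TotallyRealCubic

open Polynomial Module NumberField IsDedekindDomain

variable {L : Type} [Field L] [NumberField L] [TotallyRealCubic L]

variable {P Q : Pt L} {x y t t₁ t₂ e f : L} {n m k : ℤ}

omit [TotallyRealCubic L] in
theorem OrdGE.of_sq {v : HeightOneSpectrum (𝓞 L)} (h : OrdGE v (2 * k) (x ^ 2)) :
    OrdGE v k x := by
  by_cases hx : x = 0
  · rw [hx]; exact OrdGE.zero
  obtain ⟨m, hm⟩ := TotallyRealCubic.exists_ordEq v hx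
  have := (hm.pow 2).le_of_ge h
  push_cast at this
  exact hm.ge_of_le (by omega)

/-- The point `P` is close to zero, `t` being its local parameter: the `y`-coordinate of its
translate by the torsion point. -/
def Near (n : ℤ) (P : Pt L) (t : L) : Prop :=
  ∃ x, IsPt (P + torsionPt L) x t ∧ OrdGE (vu L) (2 * n) x

theorem ordEq_quadratic (hx : OrdGE (vu L) 1 x) :
    OrdEq (vu L) 0 (x ^ 2 + coeffA * x + coeffB) :=
  ordEq_vu_coeffB.ge_add (((hx.pow 2).mono (m := 1) (by norm_num)).add
    ((ordEq_coeffA.ge.mul hx).mono (m := 1) (by norm_num))) (by norm_num)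

theorem Near.ordGE (h : Near n P t) (hn : 1 ≤ n) : OrdGE (vu L) n t := by
  obtain ⟨x, h, hx⟩ := h
  refine OrdGE.of_sq ?_
  rw [h.eqn]
  exact (hx.mul (ordEq_quadratic (hx.mono (by omega))).ge).mono (by omega)

theorem Near.of_ordGE (h : Near n P t) (hn : 1 ≤ n) (ht : OrdGE (vu L) m t) : Near m P t := by
  obtain ⟨x, h, hx⟩ := h
  refine ⟨x, h, ?_⟩
  have hq := ordEq_quadratic (hx.mono (m := 1) (by omega))
  refine ((ht.pow 2).div hq).congr (by push_cast; omega) ?_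
  rw [h.eqn, mul_div_cancel_right₀ _ hq.ne_zero]

theorem Near.mono (h : Near n P t) (hm : m ≤ n) : Near m P t := by
  obtain ⟨x, h, hx⟩ := h
  exact ⟨x, h, hx.mono (by omega)⟩

theorem Near.unique (h₁ : Near n P t₁) (h₂ : Near m P t₂) : t₁ = t₂ := by
  obtain ⟨x₁, h₁, -⟩ := h₁
  obtain ⟨x₂, h₂, -⟩ := h₂
  exact (h₁.inj h₂).2

theorem Near.zero : Near n (0 : Pt L) 0 :=
  ⟨0, by rw [zero_add]; exact isPt_torsionPt, OrdGE.zero⟩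

theorem Near.eq_zero (h : Near n P 0) : P = 0 := by
  obtain ⟨x, h, -⟩ := h
  have hx : x = 0 := by
    have := h.eqn
    rw [zero_pow two_ne_zero] at this
    exact (mul_eq_zero.1 this.symm).resolve_right (quadratic_ne_zero x)
  subst hx
  simpa using h.eq_torsionPt

theorem Near.add (h₁ : Near n P t₁) (h₂ : Near n Q t₂) (hn : 2 ≤ n) :
    ∃ e, OrdGE (vu L) (2 * n + 3) e ∧ Near n (P + Q) ((t₁ + t₂) * (1 + e)) := by
  have o₁ := h₁.ordGE (by omega)
  have o₂ := h₂.ordGE (by omega)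
  obtain ⟨x₁, h₁, hx₁⟩ := h₁
  obtain ⟨x₂, h₂, hx₂⟩ := h₂
  have hT := torsionPt_add_self (L := L)
  have hPQ : P + torsionPt L + (Q + torsionPt L) = P + Q := by
    rw [add_add_add_comm, hT, add_zero]
  by_cases hs : x₁ = x₂ ∧ t₁ + t₂ = 0
  · have h0 : P + Q = 0 := by
      rw [← hPQ]
      exact h₁.add_eq_zero (h₂.congr hs.1.symm (by linear_combination hs.2))
    exact ⟨0, OrdGE.zero, by rw [h0, hs.2, zero_mul]; exact Near.zero⟩
  obtain ⟨l, -, hU, h₃⟩ := h₁.add h₂ (by tauto)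
  rw [hPQ] at h₃
  set U := x₁ ^ 2 + x₁ * x₂ + x₂ ^ 2 + coeffA * (x₁ + x₂) + coeffB with hUdef
  set s := t₁ + t₂
  have hs : OrdGE (vu L) n s := o₁.add o₂
  have hUB : OrdGE (vu L) (2 * n + 3) (U - coeffB) :=
    (((((hx₁.pow 2).mono (m := 2 * n + 3) (by push_cast; omega)).add
      ((hx₁.mul hx₂).mono (by omega))).add
      ((hx₂.pow 2).mono (by push_cast; omega))).add
      ((ordEq_coeffA.ge.mul (hx₁.add hx₂)).mono (by omega))).congr le_rfl (by rw [hUdef]; ring)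
  have hU0 : OrdEq (vu L) 0 U :=
    (ordEq_vu_coeffB.add_ge hUB (by omega)).congr rfl (by ring)
  have hs0 : s ≠ 0 := by
    intro h0
    rw [h0, mul_zero] at hU
    exact hU0.ne_zero hU.symm
  have hU1 := hU0.ne_zero
  have hl : l = U / s := by rw [← hU]; field_simp
  have hl0 : l ≠ 0 := by rw [hl]; exact div_ne_zero hU1 hs0
  have hli : OrdGE (vu L) n l⁻¹ := (hs.div hU0).congr (by omega) (by rw [hl, inv_div])
  set g := (coeffA + x₁ + x₂) * l⁻¹ ^ 2 with hg
  have og : OrdGE (vu L) (2 * n + 3) g :=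
    (((ordEq_coeffA.ge.add (hx₁.mono (by omega))).add (hx₂.mono (by omega))).mul
      (hli.pow 2)).mono (by push_cast; omega)
  set k := x₁ * l⁻¹ ^ 2 - t₁ * l⁻¹ ^ 3 with hk
  have ok : OrdGE (vu L) (2 * n + 3) k :=
    ((hx₁.mul (hli.pow 2)).mono (by push_cast; omega)).sub
      ((o₁.mul (hli.pow 3)).mono (by push_cast; omega))
  have og1 : OrdEq (vu L) 0 (1 - g) := OrdEq.one.sub_ge og (by omega)
  have hg0 := og1.ne_zero
  have hx₃ : l ^ 2 - coeffA - x₁ - x₂ = l ^ 2 * (1 - g) := by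
    rw [hg]; field_simp; ring
  have hy₃ : l * (x₁ - l ^ 2 * (1 - g)) - t₁ = -(l ^ 3 * (1 - g - k)) := by
    rw [hk]; field_simp; ring
  rw [hx₃, hy₃] at h₃
  have h₄ := h₃.add_torsionPt (mul_ne_zero (pow_ne_zero 2 hl0) hg0)
  have hB : OrdGE (vu L) 0 (coeffB : L) := ordEq_vu_coeffB.ge
  refine ⟨(-(U - coeffB) - coeffB * (g + k) + U * (2 * g - g * g)) / (U * (1 - g) ^ 2), ?_,
    coeffB / (l ^ 2 * (1 - g)), h₄.congr rfl ?_, ?_⟩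
  · refine OrdGE.congr (m := 2 * n + 3 - (0 + (2 : ℕ) * 0)) (OrdGE.div ?_ (hU0.mul (og1.pow 2)))
      (by push_cast; omega) rfl
    exact (hUB.neg.sub ((hB.mul (og.add ok)).mono (by omega))).add
      ((hU0.ge.mul ((((ordEq_two (L := L)).ge.mul og).mono (m := 2 * n + 3) (by omega)).sub
        ((og.mul og).mono (by omega)))).mono (by omega))
  · rw [show s = U / l by rw [hl]; field_simp]
    field_simp
    ring
  · refine ((hB.mul (hli.pow 2)).div og1).congr (by push_cast; omega) ?_
    field_simp

omit [TotallyRealCubic L] in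
theorem exists_one_add_mul {v : HeightOneSpectrum (𝓞 L)} (he : OrdGE v k e) (hf : OrdGE v k f)
    (hk : 0 ≤ k) : ∃ g, OrdGE v k g ∧ (1 + e) * (1 + f) = 1 + g :=
  ⟨e + f + e * f, (he.add hf).add ((he.mul hf).mono (by omega)), by ring⟩

theorem Near.two_pow_smul (h : Near n P t) (hn : 2 ≤ n) (j : ℕ) :
    ∃ e, OrdGE (vu L) (2 * n + 3) e ∧ Near (n + 3 * j) (2 ^ j • P) (2 ^ j * t * (1 + e)) := by
  induction j with
  | zero => exact ⟨0, OrdGE.zero, by simpa using h⟩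
  | succ j ih =>
    obtain ⟨e, he, h1⟩ := ih
    obtain ⟨f, hf, h2⟩ := h1.add h1 (by omega)
    obtain ⟨g, hg, hefg⟩ := exists_one_add_mul he (hf.mono (m := 2 * n + 3) (by omega)) (by omega)
    refine ⟨g, hg, ?_⟩
    have ht := h1.ordGE (by omega)
    have h3 : (2 ^ j * t * (1 + e) + 2 ^ j * t * (1 + e)) * (1 + f) =
        2 ^ (j + 1) * t * (1 + g) := by rw [← hefg]; ring
    have h4 : (2 : ℕ) ^ j • P + 2 ^ j • P = 2 ^ (j + 1) • P := by
      rw [← two_smul ℕ, smul_smul, pow_succ']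
    rw [h3, h4] at h2
    refine h2.of_ordGE (by omega) ?_
    refine ((ordEq_two.ge.mul ht).mul (k := 3 + (n + 3 * j)) (m := 0) (y := 1 + f)
      (OrdGE.one.add (hf.mono (by omega)))).congr (by push_cast; omega) ?_
    rw [← h3]
    ring

theorem Near.smul (h : Near n P t) (hn : 2 ≤ n) (j : ℕ) :
    ∃ e, OrdGE (vu L) (3 * n + 3) e ∧ Near n (j • P) (j * t + e) := by
  induction j with
  | zero => exact ⟨0, OrdGE.zero, by simpa using Near.zero⟩
  | succ j ih =>
    obtain ⟨e, he, h1⟩ := ih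
    obtain ⟨f, hf, h2⟩ := h1.add h hn
    have ht := (h1.ordGE (by omega)).add (h.ordGE (by omega))
    refine ⟨e + (j * t + e + t) * f, he.add ((ht.mul hf).mono (by omega)), ?_⟩
    rw [← succ_nsmul] at h2
    convert h2 using 1
    push_cast
    ring

end TotallyRealCubic

namespace TotallyRealCubic

open Polynomial Module NumberField IsDedekindDomain

variable {L : Type} [Field L] [NumberField L] [TotallyRealCubic L]

variable {P Q : Pt L} {x y t τ e : L} {n m k : ℤ}

theorem ordGE_one_add_coeffA_add_coeffB : OrdGE (vu L) 6 (1 + coeffA + coeffB : L) :=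
  (ordEq_four.ge.mul (ordGE_coords (vu L) (-419) 61 113)).congr (by norm_num)
    (by rw [coeffA, coeffB]; push_cast; ring)

theorem ordEq_one_add_coeffA_add_coeffB_sub :
    OrdEq (vu L) 7 (1 + coeffA + coeffB - u ^ 6 : L) := by
  have h1 := (ordEq_four.mul (ordEq_vu_u (L := L))).mul
    (ordEq_coords_odd (L := L) (a := 65) (by decide) 109 0)
  have h2 := (ordEq_four.mul (ordEq_four (L := L))).ge.mul (ordGE_intCast (v := vu L) (-105))
  refine (h1.add_ge h2 (by norm_num)).congr (by norm_num) ?_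
  have := u_cube (L := L)
  rw [coeffA, coeffB]
  push_cast
  grind

theorem ordGE_two_add_coeffA_add : OrdGE (vu L) 6 (2 + coeffA + u ^ 4 : L) := by
  refine (ordEq_four.ge.mul (ordGE_coords (vu L) 19 (-3) (-4))).congr (by norm_num) ?_
  have := u_cube (L := L)
  rw [coeffA]
  push_cast
  grind

theorem not_ordEq_two_sub_one (h : y ^ 2 = x * (x ^ 2 + coeffA * x + coeffB)) :
    ¬ OrdEq (vu L) 2 (x - 1) := by
  intro he
  obtain ⟨e, rfl⟩ : ∃ e, x = 1 + e := ⟨x - 1, by ring⟩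
  rw [add_sub_cancel_left] at he
  have he0 := he.ne_zero
  have hu := ordEq_vu_u (L := L)
  have o1 : OrdGE (vu L) 6 (e ^ 2 + (2 + coeffA)) := by
    have h1 := (ordGE_sub_of_eq he ((hu.pow 2).congr (by norm_num) rfl)).mul
      (ordGE_add_of_eq he ((hu.pow 2).congr (by norm_num) rfl))
    exact ((h1.mono (m := 6) (by norm_num)).add ordGE_two_add_coeffA_add).congr le_rfl (by ring)
  have ob := ordGE_one_add_coeffA_add_coeffB (L := L)
  have o2 : OrdGE (vu L) 8 (e * (e ^ 2 + (2 + coeffA)) + (1 + coeffA + coeffB) * e +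
      (2 + coeffA) * e ^ 2 - 2 * e * u ^ 3) :=
    ((((he.ge.mul o1).mono (by norm_num)).add ((ob.mul he.ge).mono (by norm_num))).add
      ((ordGE_two_add_coeffA.mul (he.pow 2).ge).mono (by norm_num))).sub
      (((ordEq_two.mul he).mul (hu.pow 3)).ge.mono (by norm_num))
  have o3 : OrdEq (vu L) 3 ((y / e) ^ 2 - (1 + u ^ 3 / e) ^ 2) := by
    refine ((ordEq_one_add_coeffA_add_coeffB_sub.add_ge o2 (by norm_num)).div
      (he.pow 2)).congr (by norm_num) ?_
    rw [div_pow, h]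
    field_simp
    ring
  have o4 : OrdEq (vu L) 0 (1 + u ^ 3 / e) :=
    OrdEq.one.add_ge ((hu.pow 3).div he).ge (by norm_num)
  have o5 : OrdEq (vu L) 0 (y / e) :=
    OrdEq.of_sq (((o4.pow 2).add_ge o3.ge (by norm_num)).congr (by norm_num) (by ring))
  have := ord_sq_sub_sq o5 o4 o3
  omega

theorem exists_ordEq_sq_sub_coeffB (hx : x ≠ 0) (h : y ^ 2 = x * (x ^ 2 + coeffA * x + coeffB)) :
    ∃ k, OrdEq (vu L) k (x ^ 2 - coeffB) ∧ OrdGE (vu L) (k + 2) (2 * y) := by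
  have h4 : (2 * y) ^ 2 = 4 * (x * (x ^ 2 + coeffA * x + coeffB)) := by rw [← h]; ring
  have hA := ordEq_coeffA (L := L)
  have hB := ordEq_vu_coeffB (L := L)
  obtain ⟨n, hn⟩ := exists_ordEq (vu L) hx
  rcases lt_trichotomy n 0 with hn0 | rfl | hn0
  · refine ⟨2 * n, ((hn.pow 2).sub_ge hB.ge (by push_cast; omega)).congr (by norm_num) rfl,
      OrdGE.of_sq ?_⟩
    rw [h4]
    have h5 : OrdGE (vu L) (2 * n) (x ^ 2 + coeffA * x + coeffB) :=
      (((hn.pow 2).ge.mono (by norm_num)).add ((hA.ge.mul hn.ge).mono (by omega))).add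
        (hB.ge.mono (by omega))
    exact (ordEq_four.ge.mul (hn.ge.mul h5)).mono (by omega)
  · have he := sub_one_of_point hn h
    have he3 : OrdGE (vu L) 3 (x - 1) := by
      by_contra h3
      exact not_ordEq_two_sub_one h (he.eq_of_not h3)
    refine ⟨4, ?_, OrdGE.of_sq ?_⟩
    · refine (ordEq_coeffB_sub_one.neg.add_ge (m := 6) (y := 2 * (x - 1) + (x - 1) ^ 2)
        ?_ (by norm_num)).congr rfl (by ring)
      exact (ordEq_two.ge.mul he3).add ((he3.pow 2).mono (by norm_num))
    · rw [h4]
      have h5 : OrdGE (vu L) 6 (x ^ 2 + coeffA * x + coeffB) :=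
        ((ordGE_one_add_coeffA_add_coeffB.add
          ((ordGE_two_add_coeffA.mul he3).mono (m := 6) (by norm_num))).add
          ((he3.pow 2).mono (m := 6) (by norm_num))).congr le_rfl (by ring)
      exact (ordEq_four.ge.mul (hn.ge.mul h5)).mono (by norm_num)
  · refine ⟨0, (hB.neg.add_ge (hn.pow 2).ge (by push_cast; omega)).congr rfl (by ring),
      OrdGE.of_sq ?_⟩
    rw [h4]
    exact (ordEq_four.ge.mul (hn.ge.mul
      (ordEq_quadratic (hn.ge.mono (by omega))).ge)).mono (by omega)

theorem exists_near_double (P : Pt L) : ∃ t, Near 2 (P + P) t := by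
  rcases eq_zero_or_isPt P with rfl | ⟨x, y, h⟩
  · exact ⟨0, by rw [add_zero]; exact Near.zero⟩
  by_cases hx : x = 0
  · subst hx
    exact ⟨0, by rw [h.eq_torsionPt, torsionPt_add_self]; exact Near.zero⟩
  have hy : y ≠ 0 := by
    intro h0
    have := h.eqn
    rw [h0, zero_pow two_ne_zero] at this
    exact mul_ne_zero hx (quadratic_ne_zero x) this.symm
  obtain ⟨k, hk, hk'⟩ := exists_ordEq_sq_sub_coeffB hx h.eqn
  have hk0 := hk.ne_zero
  obtain ⟨y', hd⟩ := h.double hy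
  have h1 := hd.add_torsionPt (pow_ne_zero 2 (div_ne_zero hk0 (by simpa using hy)))
  refine ⟨_, _, h1, ?_⟩
  refine (ordEq_vu_coeffB.ge.mul ((hk'.div hk).pow 2)).congr (by push_cast; omega) ?_
  field_simp

theorem exists_two_pow_mul_odd {m : ℕ} (hm : m ≠ 0) : ∃ j r : ℕ, Odd r ∧ m = 2 ^ j * r := by
  obtain ⟨j, r, hr, h⟩ := Nat.exists_eq_two_pow_mul_odd hm
  exact ⟨j, r, hr, h⟩

/-- Multiples by eight are determined up to high relative precision by a rational integer. -/
theorem exists_near_smul_eight (hτ : Near 6 ((4 : ℕ) • gen L) τ) (hτ' : OrdEq (vu L) 6 τ)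
    (hP : (8 : ℕ) • P ≠ 0) : ∃ (m : ℕ) (e : L), m ≠ 0 ∧ OrdGE (vu L) 15 e ∧
      Near 9 ((8 : ℕ) • P) (2 * m * τ * (1 + e)) := by
  obtain ⟨t₀, h₀⟩ := exists_near_double P
  obtain ⟨e₀, -, h₁⟩ := h₀.two_pow_smul le_rfl 2
  rw [← two_smul ℕ P, smul_smul, show 2 ^ 2 * 2 = 8 from rfl] at h₁
  set t := 2 ^ 2 * t₀ * (1 + e₀)
  have ht : t ≠ 0 := by
    intro h0
    rw [h0] at h₁
    exact hP h₁.eq_zero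
  obtain ⟨n, hn⟩ := exists_ordEq (vu L) ht
  obtain ⟨N, hN⟩ : ∃ N : ℕ, n + 20 ≤ N := ⟨(n + 20).toNat, Int.self_le_toNat _⟩
  obtain ⟨m, k, Q, hQ⟩ := exists_sub_two_pow N P
  have hT : (8 * k) • torsionPt L = 0 := by
    rw [show 8 * k = (4 * k) * 2 by ring, mul_smul, two_smul, torsionPt_add_self, smul_zero]
  obtain ⟨s₀, g₀⟩ := exists_near_double Q
  obtain ⟨f₀, -, g₁⟩ := g₀.two_pow_smul le_rfl (N + 2)
  set s := 2 ^ (N + 2) * s₀ * (1 + f₀)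
  have hdec : (8 : ℕ) • P = (2 * m) • (4 : ℕ) • gen L + 2 ^ (N + 2) • (Q + Q) := by
    rw [hQ, smul_add, smul_add, smul_smul, smul_smul, hT, add_zero, smul_smul, smul_smul,
      ← two_smul ℕ Q, smul_smul]
    congr 2 <;> ring
  have os := g₁.ordGE (by omega)
  by_cases hm : m = 0
  · rw [hm] at hdec
    simp only [mul_zero, zero_smul, zero_add] at hdec
    rw [hdec] at h₁
    rw [h₁.unique g₁] at hn
    have := hn.le_of_ge os
    push_cast at this
    omega
  obtain ⟨j, r, hr, hjr⟩ := exists_two_pow_mul_odd (mul_ne_zero two_ne_zero hm)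
  have or : OrdEq (vu L) 0 (r : L) := by
    simpa using ordEq_intCast_odd (L := L) (k := (r : ℤ)) (by exact_mod_cast hr)
  have hr0 := or.ne_zero
  have hτ0 := hτ'.ne_zero
  obtain ⟨e₁, oe₁, k₁⟩ := hτ.smul (by norm_num) r
  obtain ⟨e₂, oe₂, k₂⟩ := k₁.two_pow_smul (by norm_num) j
  rw [smul_smul, ← hjr] at k₂
  have ob : OrdGE (vu L) 15 (e₁ / (r * τ)) := (oe₁.div (or.mul hτ')).mono (by norm_num)
  obtain ⟨e₃, oe₃, h₃⟩ := exists_one_add_mul ob (oe₂.mono (m := 15) (by norm_num)) (by norm_num)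
  have hv : (2 : L) ^ j * (r * τ + e₁) * (1 + e₂) = 2 * m * τ * (1 + e₃) := by
    have h4 : (2 * m : L) = 2 ^ j * r := by exact_mod_cast congrArg (Nat.cast (R := L)) hjr
    rw [h4, ← h₃]
    field_simp
  rw [hv] at k₂
  have o3 : OrdEq (vu L) 0 (1 + e₃) := OrdEq.one.add_ge oe₃ (by norm_num)
  have om : OrdEq (vu L) (3 * j) (2 * m : L) := by
    refine ((ordEq_two.pow j).mul or).congr (by ring) ?_
    exact_mod_cast congrArg (Nat.cast (R := L)) hjr
  have ov : OrdEq (vu L) (3 * j + 6) (2 * m * τ * (1 + e₃)) :=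
    ((om.mul hτ').mul o3).congr (by ring) rfl
  obtain ⟨e₄, oe₄, h₅⟩ := (k₂.mono (m := 6) (by omega)).add
    (g₁.mono (m := 6) (by push_cast; omega)) (by norm_num)
  rw [← hdec] at h₅
  have o4 : OrdEq (vu L) 0 (1 + e₄) := OrdEq.one.add_ge oe₄ (by norm_num)
  rw [h₁.unique h₅] at hn
  have hj : 3 * (j : ℤ) + 6 = n := by
    by_cases hjN : 3 * (j : ℤ) + 6 < 2 + 3 * (N + 2 : ℕ)
    · have := ((ov.add_ge os hjN).mul o4).unique hn
      omega
    · have := hn.le_of_ge (((ov.ge_of_le (by omega)).add os).mul o4.ge)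
      push_cast at this
      omega
  have oq : OrdGE (vu L) 15 (s / (2 * m * τ * (1 + e₃))) :=
    (os.div ov).mono (by push_cast; omega)
  obtain ⟨e₅, oe₅, h₆⟩ := exists_one_add_mul oe₃ oq (by norm_num)
  obtain ⟨e₆, oe₆, h₇⟩ := exists_one_add_mul oe₅ (oe₄.mono (m := 15) (by norm_num)) (by norm_num)
  refine ⟨m, e₆, hm, oe₆, ?_⟩
  have h8 : (2 * m * τ * (1 + e₃) + s) * (1 + e₄) = 2 * m * τ * (1 + e₆) := by
    have := o3.ne_zero
    have h2m := om.ne_zero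
    have hm' := right_ne_zero_of_mul h2m
    rw [← h₇, ← h₆]
    field_simp
  rw [h8] at h₅ hn
  refine h₅.of_ordGE (by norm_num) (hn.ge_of_le ?_)
  have := om.le_of_ge (ordEq_two.ge.mul (ordGE_natCast m))
  omega

end TotallyRealCubic

namespace TotallyRealCubic

open Polynomial Module NumberField IsDedekindDomain

variable {L : Type} [Field L] [NumberField L] [TotallyRealCubic L]

variable {P Q : Pt L} {x y t τ e : L} {n m k : ℤ}

theorem isPt_two_gen :
    IsPt ((2 : ℕ) • gen L) (137 / 4 - 5 * u - 9 * u ^ 2) (1751 / 8 - 127 / 4 * u - 59 * u ^ 2) := by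
  have hu := u_cube (L := L)
  have hy : (176 - 26 * u - 48 * u ^ 2 : L) ≠ 0 := by
    intro h
    have h1 := coords_eq_zero (L := L) (a := 176) (b := -26) (c := -48)
      (by push_cast; linear_combination h)
    norm_num at h1
  obtain ⟨l, -, h2, h3⟩ := isPt_gen.add (isPt_gen (L := L))
    (Or.inr (by rw [← two_mul]; exact mul_ne_zero two_ne_zero hy))
  rw [← two_smul ℕ] at h3
  have hl : l = -19 / 2 + u + 2 * u ^ 2 := by
    refine mul_right_cancel₀ (mul_ne_zero two_ne_zero hy) ?_
    rw [two_mul, h2, rho, coeffA, coeffB]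
    linear_combination (88 + 80 * u) * hu
  subst hl
  have hx : (-19 / 2 + u + 2 * u ^ 2) ^ 2 - coeffA - rho - rho =
      (137 / 4 - 5 * u - 9 * u ^ 2 : L) := by
    rw [rho, coeffA]
    linear_combination (4 + 4 * u) * hu
  rw [hx] at h3
  refine h3.congr rfl ?_
  rw [rho]
  linear_combination (27 + 26 * u) * hu

theorem two_gen_y_ne_zero : (1751 / 8 - 127 / 4 * u - 59 * u ^ 2 : L) ≠ 0 := by
  intro h
  have h1 := coords_eq_zero (L := L) (a := 1751 / 8) (b := -127 / 4) (c := -59)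
    (by push_cast; linear_combination h)
  norm_num at h1

theorem isPt_four_gen :
    IsPt ((4 : ℕ) • gen L) (625 / 16 + 13 / 4 * u - 21 / 4 * u ^ 2)
      (-21017 / 64 - 351 / 32 * u + 517 / 8 * u ^ 2) := by
  have hu := u_cube (L := L)
  have hy := two_gen_y_ne_zero (L := L)
  obtain ⟨l, -, h2, h3⟩ := isPt_two_gen.add (isPt_two_gen (L := L))
    (Or.inr (by rw [← two_mul]; exact mul_ne_zero two_ne_zero hy))
  rw [← two_smul ℕ, smul_smul, show 2 * 2 = 4 from rfl] at h3
  have hl : l = 53 / 4 + 1 / 2 * u - 3 * u ^ 2 := by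
    refine mul_right_cancel₀ (mul_ne_zero two_ne_zero hy) ?_
    rw [two_mul, h2, coeffA, coeffB]
    linear_combination (1037 / 2 + 249 * u) * hu
  subst hl
  have hx : (53 / 4 + 1 / 2 * u - 3 * u ^ 2) ^ 2 - coeffA - (137 / 4 - 5 * u - 9 * u ^ 2) -
      (137 / 4 - 5 * u - 9 * u ^ 2) = (625 / 16 + 13 / 4 * u - 21 / 4 * u ^ 2 : L) := by
    rw [coeffA]
    linear_combination (-3 + 9 * u) * hu
  rw [hx] at h3
  refine h3.congr rfl ?_
  linear_combination (183 / 8 + 45 / 4 * u) * hu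

variable (L) in
/-- The local parameter of four times the generator, divided by `rho ^ 2`. -/
def mu : L := (-489040087996 + 68737775264 * u + 128748119616 * u ^ 2) / 5417 ^ 3

theorem ordEq_5417_pow (n : ℕ) : OrdEq (vu L) 0 (5417 ^ n : L) :=
  (ordEq_intCast_odd (L := L) (k := 5417 ^ n) (Odd.pow (by decide))).congr rfl (by push_cast; rfl)

theorem ordEq_mu : OrdEq (vu L) 6 (mu L) :=
  ((ordEq_four.mul (ordEq_coords_odd (L := L) (a := -122260021999) (by decide) 17184443816
    32187029904)).div (ordEq_5417_pow 3)).congr (by norm_num) (by rw [mu]; push_cast; ring)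

theorem near_four_gen : Near 6 ((4 : ℕ) • gen L) (rho ^ 2 * mu L) := by
  have hu := u_cube (L := L)
  obtain ⟨x, hx⟩ : ∃ x : L, x = 625 / 16 + 13 / 4 * u - 21 / 4 * u ^ 2 := ⟨_, rfl⟩
  have hX : (-1307421296 + 188877472 * u + 352802880 * u ^ 2) / 5417 ^ 2 * x = coeffB := by
    rw [hx, coeffB]
    linear_combination (-(155002632 / 29343889) + 1852215120 / 29343889 * u) * (-hu)
  have hx0 : x ≠ 0 := by
    intro h
    rw [h, mul_zero] at hX
    exact coeffB_ne_zero hX.symm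
  have hrho := ordEq_rho (v := vu L) prime_two_norms.1
  have h0 := isPt_four_gen (L := L)
  rw [← hx] at h0
  have h1 := h0.add_torsionPt hx0
  refine Near.of_ordGE (n := 3) ⟨_, h1.congr rfl ?_, ?_⟩ (by norm_num)
    (((hrho.pow 2).mul ordEq_mu).ge_of_le (by norm_num))
  · rw [eq_comm, ← neg_div, eq_div_iff (pow_ne_zero 2 hx0), hx, rho, mu, coeffB]
    linear_combination (-69417958956403297 / 4 - 22039806501917572 * u +
      6786366693232245 * u ^ 2 + 9346692729652457 * u ^ 3 - 706778842525612 * u ^ 4 -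
      1244082042973164 * u ^ 5 + 16794806331744 * u ^ 6 + 56777920750656 * u ^ 7) / 5417 ^ 3 * hu
  · rw [← hX, mul_div_cancel_right₀ _ hx0]
    exact ((ordEq_four.ge.mul (ordGE_coords (vu L) (-326855324) 47219368 88200720)).div
      (ordEq_5417_pow 2)).congr (by norm_num) (by push_cast; ring)

/-- The expansion of the `x`-coordinate near a point in terms of the local parameter. -/
theorem IsPt.ordGE_expansion {x₂ y₂ t : L} (hn : 9 ≤ n) (h : Near n P t) (hQ : IsPt Q x₂ y₂)
    (hx₂ : OrdEq (vu L) (-6) x₂) (hy₂ : OrdEq (vu L) (-9) y₂)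
    (hP : IsPt (P + torsionPt L + Q) x y) :
    OrdGE (vu L) (2 * n + 12)
      (x - coeffB / x₂ - (-(2 * y₂ / x₂ ^ 2) * t + t ^ 2 / coeffB)) := by
  have ot := h.ordGE (by omega)
  obtain ⟨z, h, oz⟩ := h
  have e₁ := h.eqn
  have e₂ := hQ.eqn
  have hne : z ≠ x₂ := by
    rintro rfl
    exact hx₂.not_ge (by omega) oz
  obtain ⟨l, hl, -, hs⟩ := h.add hQ (Or.inl hne)
  obtain ⟨rfl, -⟩ := hP.inj hs
  have hx0 := hx₂.ne_zero
  have hB := coeffB_ne_zero (L := L)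
  have oA := ordEq_coeffA (L := L)
  have oB := ordEq_vu_coeffB (L := L)
  set g := z / x₂ with hg
  have og : OrdGE (vu L) (2 * n + 6) g := (oz.div hx₂).congr (by omega) rfl
  have og1 : OrdEq (vu L) 0 (1 - g) := OrdEq.one.sub_ge og (by omega)
  have hg1 := og1.ne_zero
  set h := (3 * g ^ 2 - 2 * g ^ 3) / (1 - g) ^ 2 with hh
  have o3 : OrdGE (vu L) 0 (3 : L) := ordGE_ofNat 3
  have oh : OrdGE (vu L) (4 * n + 12) h :=
    OrdGE.congr (m := 4 * n + 12 - (2 : ℕ) * 0)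
      ((((o3.mul (og.pow 2)).mono (by push_cast; omega)).sub
        ((ordEq_two.ge.mul (og.pow 3)).mono (by push_cast; omega))).div (og1.pow 2))
      (by push_cast; omega) rfl
  have hl' : l ^ 2 = (y₂ - t) ^ 2 / x₂ ^ 2 * (1 + 2 * g + h) := by
    have h1 : l * (x₂ * (1 - g)) = y₂ - t := by
      rw [hg]; field_simp; linear_combination -hl
    rw [← h1, hh]
    field_simp
    ring
  have key : l ^ 2 - coeffA - z - x₂ - coeffB / x₂ -
      (-(2 * y₂ / x₂ ^ 2) * t + t ^ 2 / coeffB) =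
      t ^ 2 / x₂ ^ 2 + y₂ ^ 2 / x₂ ^ 2 * h + (t * (t - 2 * y₂)) / x₂ ^ 2 * (2 * g + h) +
      2 * z * ((coeffA * x₂ + coeffB) / x₂ ^ 2) - z ^ 2 * (z + coeffA) / coeffB := by
    have e₅ : t ^ 2 / coeffB = z + z ^ 2 * (z + coeffA) / coeffB := by
      rw [e₁]; field_simp; ring
    rw [hl', e₅, hg]
    have e₃ : y₂ ^ 2 / x₂ ^ 2 = x₂ + coeffA + coeffB / x₂ := by
      rw [e₂]; field_simp
    have e₄ : (y₂ - t) ^ 2 / x₂ ^ 2 = y₂ ^ 2 / x₂ ^ 2 + (t * (t - 2 * y₂)) / x₂ ^ 2 := by ring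
    rw [e₄, e₃]
    field_simp
    ring
  rw [key]
  refine ((((?_ : OrdGE _ _ _).add ?_).add ?_).add ?_).sub ?_
  · exact ((ot.pow 2).div (hx₂.pow 2)).mono (by push_cast; omega)
  · exact (((hy₂.pow 2).div (hx₂.pow 2)).ge.mul oh).mono (by push_cast; omega)
  · have h1 : OrdGE (vu L) (-6) (t - 2 * y₂) :=
      (ot.mono (by omega)).sub (ordEq_two.mul hy₂).ge
    have h2 : OrdGE (vu L) (2 * n + 6) (2 * g + h) :=
      ((ordEq_two.ge.mul og).mono (by omega)).add (oh.mono (by omega))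
    exact (((ot.mul h1).div (hx₂.pow 2)).mul h2).mono (by push_cast; omega)
  · have h1 : OrdGE (vu L) (-3) (coeffA * x₂ + coeffB) :=
      ((oA.mul hx₂).ge.mono (by norm_num)).add (oB.ge.mono (by norm_num))
    exact ((ordEq_two.ge.mul oz).mul (h1.div (hx₂.pow 2))).mono (by push_cast; omega)
  · exact (((oz.pow 2).mul ((oz.mono (by omega)).add oA.ge)).div oB).mono (by push_cast; omega)

end TotallyRealCubic

namespace TotallyRealCubic

open Polynomial Module NumberField IsDedekindDomain

variable {L : Type} [Field L] [NumberField L] [TotallyRealCubic L]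

variable {P Q : Pt L} {x y t τ e : L} {n m k : ℤ}

theorem isPt_two_gen_rho : IsPt ((2 : ℕ) • gen L) (rho ^ 2 / 4) (rho ^ 2 / (8 * eps₂)) := by
  have hu := u_cube (L := L)
  have he := eps₂_ne_zero (L := L)
  refine isPt_two_gen.congr ?_ ?_
  · rw [rho]
    linear_combination -(4 + 4 * u) * hu
  · rw [eq_div_iff (mul_ne_zero (by norm_num) he), rho, eps₂]
    grind

theorem ordEq_four_mul_mu_sub :
    OrdEq (vu L) 22 (4 * mu L - ((4 * -489040087996 / 5417 ^ 3 : ℚ) : L)) := by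
  refine ((((ordEq_two (L := L).pow 7).mul ordEq_vu_u).mul (ordEq_coords_odd (L := L)
    (a := 2148055477) (by decide) (2 * 2011689369) 0)).div (ordEq_5417_pow 3)).congr
    (by norm_num) ?_
  rw [mu]
  push_cast
  ring

theorem ordGE_eps₂_mul_rho_mul_mu_sub :
    OrdGE (vu L) 22 ((eps₂ * rho * mu L) ^ 2 -
      ((145499882691161811985040 / 5417 ^ 6 : ℚ) : L)) := by
  refine ((((ordEq_two (L := L).pow 7).mul ordEq_vu_u).ge.mul (ordGE_coords (vu L)
    (-180673375436669439561) (-2 * 145582566611007603889) 0)).div (ordEq_5417_pow 6)).congr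
    (by norm_num) ?_
  have hu := u_cube (L := L)
  rw [mu, eps₂, rho]
  push_cast
  linear_combination ((20136287606527362362520832 - 52451201456929358140705792 * u +
    3097644101995995442749440 * u ^ 2 + 40258059568390650291684352 * u ^ 3 -
    6375047252329923017555968 * u ^ 4 - 10939477546136301385711616 * u ^ 5 +
    1132781991913881341263872 * u ^ 6 + 1060869011497974015197184 * u ^ 7) / 5417 ^ 6) * hu

theorem eq_four_of_eight_smul {s : ℚ} {V : Pt L} (hP : IsPt P (-s / eps₂) y)
    (h : P = (8 : ℕ) • V + torsionPt L + (2 : ℕ) • gen L) : s = 4 := by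
  have he := eps₂_ne_zero (L := L)
  have hr := rho_ne_zero (L := L)
  have oe : OrdEq (vu L) 0 (eps₂ : L) := ordEq_eps₂
  have or := ordEq_rho (v := vu L) prime_two_norms.1
  have hB : (coeffB : L) = -rho ^ 2 / eps₂ := by
    rw [← eps₂_mul_coeffB, mul_div_cancel_left₀ _ he]
  by_cases h8 : (8 : ℕ) • V = 0
  · rw [h8, zero_add, add_comm] at h
    have h1 := isPt_two_gen_rho.add_torsionPt
      (div_ne_zero (pow_ne_zero 2 hr) (by norm_num : (4 : L) ≠ 0))
    rw [← h] at h1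
    have h2 := (hP.inj h1).1
    rw [hB] at h2
    field_simp at h2
    have h3 : (s : L) = (4 : ℚ) := by push_cast; linear_combination -h2
    exact_mod_cast h3
  obtain ⟨m, e, hm, oe', hW⟩ := exists_near_smul_eight near_four_gen
    (((or.pow 2).mul ordEq_mu).congr (by norm_num) rfl) h8
  have hm2 : (2 * m : L) ≠ 0 := by
    exact mul_ne_zero two_ne_zero (Nat.cast_ne_zero.2 hm)
  obtain ⟨k, hk⟩ := exists_ordEq (vu L) hm2
  have hk3 : 3 ≤ k := by
    have := hk.le_of_ge (ordEq_two.ge.mul (ordGE_natCast m))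
    omega
  have ot : OrdGE (vu L) (k + 6) (2 * m * (rho ^ 2 * mu L) * (1 + e)) :=
    ((hk.mul ((or.pow 2).mul ordEq_mu)).ge.mul
      (OrdGE.one.add (oe'.mono (by norm_num)))).mono (by push_cast; omega)
  have oE := IsPt.ordGE_expansion (by omega) (hW.of_ordGE (by norm_num) ot) isPt_two_gen_rho
    (((or.pow 2).div ordEq_four).congr (by norm_num) rfl)
    (((or.pow 2).div ((ordEq_two.pow 3).mul oe)).congr (by norm_num) (by norm_num)) (h ▸ hP)
  set E := -s / eps₂ - coeffB / (rho ^ 2 / 4) -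
    (-(2 * (rho ^ 2 / (8 * eps₂)) / (rho ^ 2 / 4) ^ 2) * (2 * m * (rho ^ 2 * mu L) * (1 + e)) +
      (2 * m * (rho ^ 2 * mu L) * (1 + e)) ^ 2 / coeffB) with hE
  have key : (((s - 4) / (2 * m) - 4 * -489040087996 / 5417 ^ 3 -
      2 * m * (145499882691161811985040 / 5417 ^ 6) : ℚ) : L) =
      (4 * mu L - ((4 * -489040087996 / 5417 ^ 3 : ℚ) : L)) +
      (2 * m * ((eps₂ * rho * mu L) ^ 2 - ((145499882691161811985040 / 5417 ^ 6 : ℚ) : L)) +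
        4 * mu L * e + 2 * m * (eps₂ * rho * mu L) ^ 2 * (e * (2 + e)) -
        eps₂ * E / (2 * m)) := by
    have h2 : (2 : L) ≠ 0 := two_ne_zero
    have hm' := right_ne_zero_of_mul hm2
    have hE' : eps₂ * E / (2 * m) = -(s - 4) / (2 * m) + 4 * mu L * (1 + e) +
        2 * m * (eps₂ * rho * mu L) ^ 2 * (1 + e) ^ 2 := by
      rw [hE, hB]
      field_simp
      ring
    rw [hE']
    push_cast
    ring
  have o22 := ordEq_four_mul_mu_sub.add_ge (m := 23) (y := _) (((((hk.ge.mul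
    ordGE_eps₂_mul_rho_mul_mu_sub).mono (m := 23) (by omega)).add
    (((ordEq_four.mul ordEq_mu).ge.mul oe').mono (by norm_num))).add
    (((hk.mul (((oe.mul or).mul ordEq_mu).pow 2)).ge.mul
      (oe'.mul (ordEq_two.ge.add (oe'.mono (m := 3) (by norm_num))))).mono
      (by push_cast; omega))).sub
    (((oe.ge.mul oE).div hk).mono (by omega))) (by norm_num)
  rw [← key] at o22
  obtain ⟨n, hn⟩ := exists_ordEq_ratCast (L := L) (Rat.cast_ne_zero.1 o22.ne_zero)
  have := o22.unique hn
  omega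

theorem sq_eq_four_of_third {X : ℚ} {Y : L} (hX : OrdEq (vu L) 3 (X : L))
    (h : -eps₂ * ((X : L) ^ 4 + (2 * u - 6) * X ^ 2 + rho ^ 2 * (1 - 2 * u)) = Y ^ 2) :
    X ^ 2 = 4 := by
  have he := eps₂_ne_zero (L := L)
  have hr := rho_ne_zero (L := L)
  have hX0 := hX.ne_zero
  have hT := torsionPt_add_self (L := L)
  have oe : OrdEq (vu L) 0 (eps₂ : L) := ordEq_eps₂
  have hA : (coeffA : L) = (6 - 2 * u) / eps₂ := by
    rw [← eps₂_mul_coeffA, mul_div_cancel_left₀ _ he]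
  have hB : (coeffB : L) = -rho ^ 2 / eps₂ := by
    rw [← eps₂_mul_coeffB, mul_div_cancel_left₀ _ he]
  obtain ⟨P, hP⟩ := exists_isPt (x := -((X ^ 2 : ℚ) : L) / eps₂) (y := X * Y / eps₂ ^ 2) (by
    rw [hA, hB, div_pow, mul_pow, ← h]
    rw [show (1 - 2 * u : L) = -eps₂ by rw [eps₂]; ring]
    push_cast
    field_simp
    ring)
  have hx0 : -((X ^ 2 : ℚ) : L) / eps₂ ≠ 0 := by
    push_cast
    exact div_ne_zero (neg_ne_zero.2 (pow_ne_zero 2 hX0)) he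
  have hTT : P + torsionPt L + torsionPt L = P := by rw [add_assoc, hT, add_zero]
  have ox : OrdEq (vu L) 6 (-((X ^ 2 : ℚ) : L) / eps₂) :=
    ((hX.pow 2).neg.div oe).congr (by norm_num) (by push_cast; ring)
  have hnear : Near 3 (P + torsionPt L) (X * Y / eps₂ ^ 2) :=
    ⟨_, by rw [hTT]; exact hP, ox.ge⟩
  have oy : OrdEq (vu L) 3 (X * Y / eps₂ ^ 2) := by
    refine OrdEq.of_sq ?_
    rw [hP.eqn]
    exact (ox.mul (ordEq_quadratic (ox.ge_of_le (by norm_num)))).congr (by norm_num) rfl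
  obtain ⟨V₀, hV₀⟩ := ((hP.add_torsionPt hx0).congr (x₂ := (rho / (X : L)) ^ 2) (by
    rw [hB]
    push_cast
    field_simp) rfl).exists_half (div_ne_zero hr hX0)
  obtain ⟨i, k, V₁, hi, hV₁⟩ := exists_sub_double V₀
  have hk : k • torsionPt L + k • torsionPt L = 0 := by rw [← smul_add, hT, smul_zero]
  interval_cases i
  · obtain ⟨t, ht⟩ := exists_near_double V₁
    obtain ⟨e, -, h1⟩ := ht.two_pow_smul le_rfl 1
    have h2 : P + torsionPt L = 2 ^ 1 • (V₁ + V₁) := by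
      rw [hV₀, hV₁, pow_one, two_smul, zero_smul, zero_add, add_add_add_comm, hk, zero_add]
    rw [← h2] at h1
    rw [hnear.unique h1] at oy
    have := oy.le_of_ge (h1.ordGE (by norm_num))
    norm_num at this
  · obtain ⟨j, l, V₂, hj, hV₂⟩ := exists_sub_double V₁
    have hl : l • torsionPt L + l • torsionPt L = 0 := by rw [← smul_add, hT, smul_zero]
    have h3 : V₁ + V₁ = (2 * j) • gen L + (4 : ℕ) • V₂ := by
      calc V₁ + V₁ = (2 * j) • gen L + (4 : ℕ) • V₂ +
            (l • torsionPt L + l • torsionPt L) := by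
            rw [hV₂, mul_smul, two_smul]; abel
        _ = _ := by rw [hl, add_zero]
    have h4 : P + torsionPt L = (2 : ℕ) • gen L + (4 * j) • gen L + (8 : ℕ) • V₂ := by
      calc P + torsionPt L = (2 : ℕ) • gen L + ((V₁ + V₁) + (V₁ + V₁)) +
            (k • torsionPt L + k • torsionPt L) := by
            rw [hV₀, hV₁, one_smul]; abel
        _ = (2 : ℕ) • gen L + ((V₁ + V₁) + (V₁ + V₁)) := by rw [hk, add_zero]
        _ = _ := by
          rw [h3, show 4 * j = 2 * (2 * j) by ring, mul_smul 2 (2 * j), two_smul ℕ ((2 * j) • gen L)]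
          abel
    have h5 : P = (2 : ℕ) • gen L + (4 * j) • gen L + (8 : ℕ) • V₂ + torsionPt L := by
      rw [← h4, hTT]
    interval_cases j
    · refine eq_four_of_eight_smul (V := V₂) hP ?_
      rw [h5, mul_zero, zero_smul, add_zero]
      abel
    · refine eq_four_of_eight_smul (V := -gen L - V₂) hP.neg ?_
      have h6 : -torsionPt L = torsionPt L := neg_eq_of_add_eq_zero_left hT
      rw [h5, neg_add, h6]
      abel

end TotallyRealCubic

namespace TotallyRealCubic

theorem sq_eq_four {X y : ℚ} (h : y ^ 2 = X ^ 6 - 9 * X ^ 4 + 11 * X ^ 2 + 37) : X ^ 2 = 4 := by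
  obtain ⟨L, hF, hN, ⟨hT⟩⟩ := exists_model
  rcases third_cases (L := L) h with ⟨n, Y, hn, hX, hY⟩ | ⟨Y, hX, hY⟩
  · obtain ⟨m, rfl⟩ := Nat.exists_eq_add_of_le' hn
    exact absurd hY (no_third_of_neg m (X : L) Y (by exact_mod_cast hX))
  · exact sq_eq_four_of_third hX hY

theorem neg_sq_ne (t w : ℚ) : -w ^ 2 ≠ t ^ 3 - 16 * t + 16 := fun h =>
  no_first (-t / 4) (w / 4) (by linear_combination -h / 16)

/-- A point of `y² = t³ - 16t + 16` over `ℚ(i)` with `t = p + qi`, `y = c + di` is rational: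
otherwise the line through it and minus its conjugate has a rational third point on the
quadratic twist by `-1`. -/
theorem im_eq_zero {p q c d : ℚ} (hre : c ^ 2 - d ^ 2 = p ^ 3 - 3 * p * q ^ 2 - 16 * p + 16)
    (him : 2 * c * d = 3 * p ^ 2 * q - q ^ 3 - 16 * q) : q = 0 ∧ d = 0 := by
  have hq : q = 0 := by
    by_contra hq
    obtain ⟨k, rfl⟩ : ∃ k, c = k * q := ⟨c / q, by field_simp⟩
    have h2 : 2 * k * d = 3 * p ^ 2 - q ^ 2 - 16 := mul_right_cancel₀ hq (by linear_combination him)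
    exact neg_sq_ne (-k ^ 2 - 2 * p) (d + k ^ 3 + 3 * k * p)
      (by linear_combination hre - (k ^ 2 + 3 * p) * h2)
  subst hq
  refine ⟨rfl, ?_⟩
  have h : c * d = 0 := by linear_combination him / 2
  rcases mul_eq_zero.1 h with rfl | h
  · exact absurd (by linear_combination hre) (neg_sq_ne p d)
  · exact h

theorem exists_eq_add_mul_I {z : ℂ} (hz : z ∈ IntermediateField.adjoin ℚ {Complex.I}) :
    ∃ a b : ℚ, z = a + b * Complex.I := by
  induction hz using IntermediateField.adjoin_induction with
  | mem z hz => exact ⟨0, 1, by simpa using hz⟩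
  | algebraMap r => exact ⟨r, 0, by simp⟩
  | add z w _ _ hz hw =>
    obtain ⟨a, b, rfl⟩ := hz
    obtain ⟨c, d, rfl⟩ := hw
    exact ⟨a + c, b + d, by push_cast; ring⟩
  | inv z _ hz =>
    obtain ⟨a, b, rfl⟩ := hz
    refine ⟨a / (a ^ 2 + b ^ 2), -b / (a ^ 2 + b ^ 2), ?_⟩
    by_cases h : a ^ 2 + b ^ 2 = 0
    · have ha : a = 0 := by nlinarith [sq_nonneg a, sq_nonneg b]
      have hb : b = 0 := by nlinarith [sq_nonneg a, sq_nonneg b]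
      simp [ha, hb]
    · have h' : (a ^ 2 + b ^ 2 : ℂ) ≠ 0 := by exact_mod_cast h
      refine inv_eq_of_mul_eq_one_right ?_
      push_cast
      field_simp
      linear_combination -(b : ℂ) ^ 2 * Complex.I_sq
  | mul z w _ _ hz hw =>
    obtain ⟨a, b, rfl⟩ := hz
    obtain ⟨c, d, rfl⟩ := hw
    refine ⟨a * c - b * d, a * d + b * c, ?_⟩
    push_cast
    linear_combination (b * d : ℂ) * Complex.I_sq

theorem add_mul_I_inj {a b c d : ℚ} (h : (a + b * Complex.I : ℂ) = c + d * Complex.I) :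
    a = c ∧ b = d := by
  have h1 := congrArg Complex.re h
  have h2 := congrArg Complex.im h
  simp at h1 h2
  exact ⟨h1, h2⟩

end TotallyRealCubic

open TotallyRealCubic in
/-- The only points on the affine model `y² = -x⁶ - 9x⁴ - 11x² + 37` of the modular curve
`X₀(37)` with coordinates in `ℚ(i)` are `(±2i, ±1)` and `(±1, ±4)`. -/
theorem Qi_points_X0_37 (x y : ℂ)
    (hx : x ∈ IntermediateField.adjoin ℚ {Complex.I})
    (hy : y ∈ IntermediateField.adjoin ℚ {Complex.I}) :
    y ^ 2 = -x ^ 6 - 9 * x ^ 4 - 11 * x ^ 2 + 37 ↔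
      (((x = 2 * Complex.I ∨ x = -(2 * Complex.I)) ∧ (y = 1 ∨ y = -1)) ∨
        ((x = 1 ∨ x = -1) ∧ (y = 4 ∨ y = -4))) := by
  have hI := Complex.I_sq
  constructor
  · intro h
    obtain ⟨a, b, rfl⟩ := exists_eq_add_mul_I hx
    obtain ⟨c, d, rfl⟩ := exists_eq_add_mul_I hy
    obtain ⟨p, hp⟩ : ∃ p, p = -(a ^ 2 - b ^ 2) - 3 := ⟨_, rfl⟩
    obtain ⟨q, hq⟩ : ∃ q, q = -2 * a * b := ⟨_, rfl⟩
    have ht : -((a + b * Complex.I : ℂ) ^ 2) - 3 = p + q * Complex.I := by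
      rw [hp, hq]
      push_cast
      linear_combination -(b : ℂ) ^ 2 * hI
    have hE : (((c ^ 2 - d ^ 2 : ℚ) : ℂ) + ((2 * c * d : ℚ) : ℂ) * Complex.I) =
        ((p ^ 3 - 3 * p * q ^ 2 - 16 * p + 16 : ℚ) : ℂ) +
          ((3 * p ^ 2 * q - q ^ 3 - 16 * q : ℚ) : ℂ) * Complex.I := by
      have h1 : (c + d * Complex.I : ℂ) ^ 2 =
          (p + q * Complex.I) ^ 3 - 16 * (p + q * Complex.I) + 16 := by
        rw [← ht, h]
        ring
      push_cast
      linear_combination h1 + (3 * p * q ^ 2 + q ^ 3 * Complex.I - d ^ 2 : ℂ) * hI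
    obtain ⟨hre, him⟩ := add_mul_I_inj hE
    obtain ⟨hq0, rfl⟩ := im_eq_zero hre him
    have hab : a * b = 0 := by linear_combination -hq0 / 2 + hq / 2
    rw [hq0, hp] at hre
    rcases mul_eq_zero.1 hab with rfl | rfl
    · have hc : c ^ 2 = b ^ 6 - 9 * b ^ 4 + 11 * b ^ 2 + 37 := by linear_combination hre
      have hb := sq_eq_four hc
      have hb' : b = 2 ∨ b = -2 := sq_eq_sq_iff_eq_or_eq_neg.1 (by rw [hb]; norm_num)
      have hc' : c = 1 ∨ c = -1 := sq_eq_sq_iff_eq_or_eq_neg.1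
        (by linear_combination hc + (b ^ 4 - 5 * b ^ 2 - 9) * hb)
      left
      rcases hb' with rfl | rfl <;> rcases hc' with rfl | rfl <;> simp
    · have hc : c ^ 2 = -a ^ 6 - 9 * a ^ 4 - 11 * a ^ 2 + 37 := by linear_combination hre
      have ha := rat_points hc
      have ha' : a = 1 ∨ a = -1 := sq_eq_sq_iff_eq_or_eq_neg.1 (by rw [ha]; norm_num)
      have hc' : c = 4 ∨ c = -4 := sq_eq_sq_iff_eq_or_eq_neg.1
        (by linear_combination hc - (a ^ 4 + 10 * a ^ 2 + 21) * ha)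
      right
      rcases ha' with rfl | rfl <;> rcases hc' with rfl | rfl <;> simp
  · rintro (⟨rfl | rfl, rfl | rfl⟩ | ⟨rfl | rfl, rfl | rfl⟩)
    all_goals grind
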